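/- arXiv:0705.4114 — 2 statements merged into one kernel-verified Lean document; each statement's English description precedes it below -/
import Mathlib

section
/- Let a_1,…,a_l, h_1,…,h_n be polynomial indeterminates, p(x,a) = x^l + a_1x^{l−1} + … + a_l, and let I_D(z) be the ideal of ℂ[a_1,…,a_l,h_1,…,h_n] generated by ∑_s h_s, by ∑_s z_s h_s − l(∑_s m_s + 1 − l), and by all coefficients with respect to x of T_h(p(x,a)) (a polynomial in x with coefficients in ℂ[a,h]). If the pair (m_1,…,m_n; l) is separating, then the algebra A_D(z) = ℂ[a,h]/I_D(z) is finite-dimensional as a ℂ-vector space and its dimension does not depend on the choice of the distinct numbers z_1,…,z_n. -/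
noncomputable section

/-- The pair (m; l) is separating. -/
def Separating {n : ℕ} (m : Fin n → ℂ) (l : ℕ) : Prop :=
  ∀ i : ℕ, 1 ≤ i → i ≤ l → (∑ s, m s) - 2 * l + 1 + i ≠ 0

/-- The universal monic polynomial p(x,a) = x^l + a_1 x^{l-1} + … + a_l, whose
coefficients a_1,…,a_l are the indeterminates `Sum.inl i` (the variable
`Sum.inl i` is the coefficient a_{i+1} of x^{l-1-i}). -/
def pUniv (n l : ℕ) : Polynomial (MvPolynomial (Fin l ⊕ Fin n) ℂ) :=
  Polynomial.X ^ l +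
    ∑ i : Fin l, Polynomial.C (MvPolynomial.X (Sum.inl i)) * Polynomial.X ^ (l - 1 - (i : ℕ))

/-- T_h(p(x,a)) where h_1,…,h_n are the indeterminates `Sum.inr s`. -/
def TUniv (n l : ℕ) (m z : Fin n → ℂ) : Polynomial (MvPolynomial (Fin l ⊕ Fin n) ℂ) :=
  (∏ s, (Polynomial.X - Polynomial.C (MvPolynomial.C (z s)))) *
      Polynomial.derivative (Polynomial.derivative (pUniv n l))
    - (∑ s, Polynomial.C (MvPolynomial.C (m s)) *
        ∏ r ∈ Finset.univ.erase s,
          (Polynomial.X - Polynomial.C (MvPolynomial.C (z r)))) *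
      Polynomial.derivative (pUniv n l)
    + (∑ s, Polynomial.C (MvPolynomial.X (Sum.inr s)) *
        ∏ r ∈ Finset.univ.erase s,
          (Polynomial.X - Polynomial.C (MvPolynomial.C (z r)))) * pUniv n l

/-- The ideal I_D(z) generated by ∑_s h_s, by ∑_s z_s h_s − l(∑_s m_s + 1 − l),
and by all coefficients in x of T_h(p(x,a)). -/
def idealD (n l : ℕ) (m z : Fin n → ℂ) : Ideal (MvPolynomial (Fin l ⊕ Fin n) ℂ) :=
  Ideal.span
    ({∑ s, MvPolynomial.X (Sum.inr s),
      (∑ s, MvPolynomial.C (z s) * MvPolynomial.X (Sum.inr s)) -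
        MvPolynomial.C ((l : ℂ) * ((∑ s, m s) + 1 - l))} ∪
     Set.range fun k : ℕ => (TUniv n l m z).coeff k)

section RegularSequences

open RingTheory.Sequence CategoryTheory Abelian Polynomial

/-- The combination `a₀ + c a₁ + c² a₂ + ⋯` of the entries of a list. -/
def List.powerCombination {k A : Type} [CommRing k] [CommRing A] [Algebra k A] (c : k)
    (L : List A) : A :=
  L.foldr (fun a b => a + algebraMap k A c * b) 0

lemma List.powerCombination_mem {k A : Type} [CommRing k] [CommRing A] [Algebra k A] (c : k)
    (L : List A) : L.powerCombination c ∈ Ideal.ofList L := by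
  induction L with
  | nil => simp [powerCombination]
  | cons a L ih =>
    rw [Ideal.ofList_cons]
    exact Submodule.add_mem_sup (Ideal.mem_span_singleton_self a) (Ideal.mul_mem_left _ _ ih)

lemma List.finite_setOf_powerCombination_mem {k A : Type} [Field k] [CommRing A] [Algebra k A]
    (L : List A) (Q : Ideal A) [Q.IsPrime] (hL : ¬ Ideal.ofList L ≤ Q) :
    {c : k | L.powerCombination c ∈ Q}.Finite := by
  classical
  let P : List A → (A ⧸ Q)[X] := fun L =>
    L.foldr (fun a b => C (Ideal.Quotient.mk Q a) + X * b) 0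
  have heval : ∀ (c : k) (L : List A),
      (P L).eval (algebraMap k (A ⧸ Q) c) = Ideal.Quotient.mk Q (L.powerCombination c) := by
    intro c L
    induction L with
    | nil => simp [P, powerCombination]
    | cons a L ih =>
      have h1 : P (a :: L) = C (Ideal.Quotient.mk Q a) + X * P L := rfl
      have h2 : (a :: L).powerCombination c = a + algebraMap k A c * L.powerCombination c := rfl
      rw [h1, h2]
      simp [ih]
  have hzero : ∀ L : List A, P L = 0 → Ideal.ofList L ≤ Q := by
    intro L
    induction L with
    | nil => simp
    | cons a L ih =>
      intro h
      have h1 : C (Ideal.Quotient.mk Q a) + X * P L = 0 := h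
      have h0 : Ideal.Quotient.mk Q a = 0 := by simpa using congrArg (fun p => p.coeff 0) h1
      rw [h0, C_0, zero_add] at h1
      have h2 : P L = 0 := by simpa using h1
      rw [Ideal.ofList_cons, sup_le_iff, Ideal.span_singleton_le_iff_mem]
      exact ⟨Ideal.Quotient.eq_zero_iff_mem.mp h0, ih h2⟩
  have hP : P L ≠ 0 := fun h => hL (hzero L h)
  refine Set.Finite.of_finite_image (f := algebraMap k (A ⧸ Q)) ?_
    (algebraMap k (A ⧸ Q)).injective.injOn
  refine (P L).roots.toFinset.finite_toSet.subset ?_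
  rintro _ ⟨c, hc, rfl⟩
  simpa [hP, heval] using Ideal.Quotient.eq_zero_iff_mem.mpr hc

lemma exists_add_notMem_of_not_ofList_le (k : Type) {A : Type} [Field k] [Infinite k] [CommRing A]
    [Algebra k A] (f : A) (fs : List A) (T : Set (Ideal A)) (hT : T.Finite)
    (hprime : ∀ Q ∈ T, Q.IsPrime) (hle : ∀ Q ∈ T, ¬ Ideal.ofList (f :: fs) ≤ Q) :
    ∃ b ∈ Ideal.ofList fs, ∀ Q ∈ T, f + b ∉ Q := by
  have hfin : (⋃ Q ∈ T, {c : k | (f :: fs).powerCombination c ∈ Q}).Finite :=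
    hT.biUnion fun Q hQ =>
      have := hprime Q hQ
      List.finite_setOf_powerCombination_mem _ Q (hle Q hQ)
  obtain ⟨c, hc⟩ := hfin.exists_notMem
  simp only [Set.mem_iUnion, not_exists, Set.mem_ofPred_eq] at hc
  exact ⟨algebraMap k A c * fs.powerCombination c,
    Ideal.mul_mem_left _ _ (fs.powerCombination_mem c), hc⟩

lemma subsingleton_ext_quotSMulTop {A : Type} [CommRing A] (N M : ModuleCat.{0} A) {x : A}
    (hx : IsSMulRegular M x) (i : ℕ) (h₁ : Subsingleton (Ext N M i))
    (h₂ : Subsingleton (Ext N M (i + 1))) :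
    Subsingleton (Ext N (ModuleCat.of A (QuotSMulTop x M)) i) := by
  have zero1 := AddCommGrpCat.isZero_of_iff_subsingleton.mpr h₁
  have zero2 := AddCommGrpCat.isZero_of_iff_subsingleton.mpr h₂
  exact AddCommGrpCat.subsingleton_of_isZero <| ShortComplex.Exact.isZero_of_both_zeros
    ((Ext.covariant_sequence_exact₃' N hx.smulShortComplex_shortExact) i (i + 1) rfl)
    (zero1.eq_zero_of_src _) (zero2.eq_zero_of_tgt _)

lemma annihilator_le_annihilator_quotSMulTop {A M : Type} [CommRing A] [AddCommGroup M]
    [Module A M] (x : A) :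
    Module.annihilator A M ≤ Module.annihilator A (QuotSMulTop x M) :=
  LinearMap.annihilator_le_of_surjective _ (Submodule.mkQ_surjective _)

/-- If the depth of `M` with respect to `Ann N` is at least the length of `fs`, and `Ann N` is
generated by `fs` modulo `Ann M`, then the ideal generated by `fs` is generated by a weakly
regular sequence of the same length. -/
lemma exists_isWeaklyRegular_ofList_eq (k : Type) {A : Type} [Field k] [Infinite k] [CommRing A]
    [IsNoetherianRing A] [Algebra k A] (N : ModuleCat.{0} A) [Module.Finite A N] (fs : List A)
    (M : ModuleCat.{0} A) [Module.Finite A M]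
    (hN : Module.annihilator A N ≤ Ideal.ofList fs ⊔ Module.annihilator A M)
    (hext : ∀ i < fs.length, Subsingleton (Ext N M i)) :
    ∃ gs : List A, Ideal.ofList gs = Ideal.ofList fs ∧ IsWeaklyRegular M gs := by
  induction fs generalizing M with
  | nil => exact ⟨[], rfl, IsWeaklyRegular.nil A M⟩
  | cons f fs ih =>
    have : Subsingleton (N →ₗ[A] M) :=
      ((Ext.addEquiv₀.trans ModuleCat.homAddEquiv).symm.subsingleton_congr).mpr
        (hext 0 (by simp))
    obtain ⟨x, hxN, hx⟩ := IsSMulRegular.subsingleton_linearMap_iff.mp this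
    have hass := biUnion_associatedPrimes_eq_compl_regular A M
    obtain ⟨b, hb, hbQ⟩ := exists_add_notMem_of_not_ofList_le k f fs (associatedPrimes A M)
      (associatedPrimes.finite A M) (fun Q hQ => IsAssociatedPrime.isPrime hQ) (by
        intro Q hQ hle
        have hannQ : Module.annihilator A M ≤ Q := by
          rw [← Submodule.annihilator_top]
          exact IsAssociatedPrime.annihilator_le hQ
        have hxQ : x ∈ Q := sup_le hle hannQ (hN hxN)
        have : x ∈ ⋃ p ∈ associatedPrimes A M, (p : Set A) := Set.mem_biUnion hQ hxQ
        rw [hass] at this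
        exact this hx)
    have hreg : IsSMulRegular M (f + b) := by
      by_contra hcon
      have : f + b ∈ ⋃ p ∈ associatedPrimes A M, (p : Set A) := by
        rw [hass]; exact hcon
      obtain ⟨Q, hQ, hmem⟩ := Set.mem_iUnion₂.mp this
      exact hbQ Q hQ hmem
    have hsup : Ideal.span {f + b} ⊔ Ideal.ofList fs = Ideal.ofList (f :: fs) := by
      rw [Ideal.ofList_cons]
      refine le_antisymm (sup_le ?_ le_sup_right) (sup_le ?_ le_sup_right) <;>
        rw [Ideal.span_singleton_le_iff_mem]
      · exact Submodule.add_mem_sup (Ideal.mem_span_singleton_self f) hb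
      · have := Submodule.add_mem_sup (Ideal.mem_span_singleton_self (f + b)) (neg_mem hb)
        simpa using this
    obtain ⟨gs, hgs, hgsreg⟩ := ih (ModuleCat.of A (QuotSMulTop (f + b) M)) (by
        refine hN.trans ?_
        rw [← hsup]
        refine sup_le (sup_le ?_ le_sup_left) ?_
        · rw [Ideal.span_singleton_le_iff_mem]
          exact le_sup_right (a := Ideal.ofList fs) (QuotSMulTop.mem_annihilator M (f + b))
        · exact (annihilator_le_annihilator_quotSMulTop (f + b)).trans le_sup_right)
      (fun i hi => subsingleton_ext_quotSMulTop N M hreg i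
        (hext i (by simp; omega)) (hext (i + 1) (by simpa using hi)))
    refine ⟨(f + b) :: gs, ?_, ?_⟩
    · rw [Ideal.ofList_cons, hgs, hsup]
    · exact (isWeaklyRegular_cons_iff M _ _).mpr ⟨hreg, hgsreg⟩

/-- In a Noetherian local ring of depth at least `fs.length + 1`, if `f₀` is regular and the ideal
`(f₀, fs)` is primary to the maximal ideal then `f₀` is regular modulo `fs`. -/
lemma mem_ofList_of_mul_mem_of_isLocalRing (k : Type) {A : Type} [Field k] [Infinite k]
    [CommRing A] [IsLocalRing A] [IsNoetherianRing A] [Algebra k A] (f₀ : A)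
    (hf₀ : IsSMulRegular A f₀) (fs : List A)
    (hmem : ∀ f ∈ f₀ :: fs, f ∈ IsLocalRing.maximalIdeal A)
    (hmax : ∀ q : Ideal A, q.IsPrime → Ideal.ofList (f₀ :: fs) ≤ q →
      IsLocalRing.maximalIdeal A ≤ q)
    (rs : List A) (hlen : rs.length = fs.length + 1) (hrs : IsRegular A rs)
    (hrsmem : ∀ r ∈ rs, r ∈ IsLocalRing.maximalIdeal A) {u : A}
    (hu : f₀ * u ∈ Ideal.ofList fs) : u ∈ Ideal.ofList fs := by
  let N : ModuleCat.{0} A := ModuleCat.of A (A ⧸ Ideal.ofList (f₀ :: fs))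
  have hN : Module.annihilator A N = Ideal.ofList (f₀ :: fs) := Ideal.annihilator_quotient
  have hfin : Module.Finite A N := inferInstanceAs (Module.Finite A (A ⧸ Ideal.ofList (f₀ :: fs)))
  have hfin' : Module.Finite A (ModuleCat.of A A) := inferInstanceAs (Module.Finite A A)
  have hext : ∀ i < fs.length + 1, Subsingleton (Ext N (ModuleCat.of A A) i) := by
    rw [← hlen]
    refine ModuleCat.subsingleton_ext_of_exists_isRegular (IsLocalRing.maximalIdeal A) N ?_
      (ModuleCat.of A A) ?_ rs hrsmem hrs
    · rw [Module.support_eq_zeroLocus, hN]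
      intro q hq
      exact hmax q.asIdeal q.2 hq
    · rw [lt_top_iff_ne_top]
      simpa using (IsLocalRing.maximalIdeal.isMaximal A).ne_top
  obtain ⟨gs, hgs, hreg⟩ := exists_isWeaklyRegular_ofList_eq k N fs
    (ModuleCat.of A (QuotSMulTop f₀ A)) (by
      rw [hN, Ideal.ofList_cons]
      refine sup_le ?_ le_sup_left
      rw [Ideal.span_singleton_le_iff_mem]
      exact le_sup_right (a := Ideal.ofList fs) (QuotSMulTop.mem_annihilator A f₀))
    (fun i hi => subsingleton_ext_quotSMulTop N (ModuleCat.of A A) hf₀ i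
      (hext i (by omega)) (hext (i + 1) (by omega)))
  have hcons : IsWeaklyRegular A (f₀ :: gs) := (isWeaklyRegular_cons_iff A _ _).mpr ⟨hf₀, hreg⟩
  have hperm : IsWeaklyRegular A (gs ++ [f₀]) := by
    refine IsLocalRing.isWeaklyRegular_of_perm_of_subset_maximalIdeal hcons
      (List.perm_append_singleton f₀ gs).symm ?_
    have hle : Ideal.ofList (f₀ :: gs) ≤ IsLocalRing.maximalIdeal A := by
      rw [Ideal.ofList_cons, hgs, ← Ideal.ofList_cons]
      exact Ideal.span_le.mpr hmem
    exact fun r hr => hle (Ideal.subset_span hr)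
  have h := ((isWeaklyRegular_append_iff A gs [f₀]).mp hperm).2
  rw [isWeaklyRegular_singleton_iff] at h
  have htop : (Ideal.ofList gs • ⊤ : Submodule A A) = Ideal.ofList fs := by
    rw [hgs]; simp
  rw [htop] at h
  have h0 : f₀ • (Submodule.Quotient.mk u : A ⧸ Ideal.ofList fs) = f₀ • 0 := by
    rw [smul_zero, ← Submodule.Quotient.mk_smul, Submodule.Quotient.mk_eq_zero]
    exact hu
  exact (Submodule.Quotient.mk_eq_zero _).mp (h h0)

/-- If `R/(f₀, fs)` has dimension zero and `R` has depth at least `fs.length + 1` at each of its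
points, then a nonzero `f₀` is regular modulo `fs`. -/
lemma mem_ofList_of_mul_mem (k : Type) {R : Type} [Field k] [Infinite k] [CommRing R] [IsDomain R]
    [IsNoetherianRing R] [Algebra k R] (f₀ : R) (hf₀ : f₀ ≠ 0) (fs : List R)
    (hmax : ∀ p : Ideal R, p.IsPrime → Ideal.ofList (f₀ :: fs) ≤ p → p.IsMaximal)
    (hreg : ∀ p : Ideal R, p.IsMaximal → ∃ rs : List R, rs.length = fs.length + 1 ∧
      (∀ r ∈ rs, r ∈ p) ∧ IsWeaklyRegular R rs) {u : R}
    (hu : f₀ * u ∈ Ideal.ofList fs) : u ∈ Ideal.ofList fs := by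
  refine Ideal.mem_of_localization_maximal fun P hP => ?_
  set A := Localization.AtPrime P
  set φ := algebraMap R A
  have hu' : φ f₀ * φ u ∈ (Ideal.ofList fs).map φ := by
    rw [← map_mul]; exact Ideal.mem_map_of_mem φ hu
  by_cases hle : Ideal.ofList (f₀ :: fs) ≤ P
  · obtain ⟨rs, hlen, hrsP, hrs⟩ := hreg P hP
    have hφ : ∀ r ∈ P, φ r ∈ IsLocalRing.maximalIdeal A := fun r hr =>
      (IsLocalization.AtPrime.to_map_mem_maximal_iff A P r).mpr hr
    rw [Ideal.map_ofList] at hu' ⊢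
    refine mem_ofList_of_mul_mem_of_isLocalRing k (φ f₀) ?_ (fs.map φ) ?_ ?_ (rs.map φ)
      (by simpa using hlen) (hrs.isRegular_of_isLocalization_of_mem A P hrsP) ?_ hu'
    · have : φ f₀ ≠ 0 := by
        simpa [φ] using (IsLocalization.injective A P.primeCompl_le_nonZeroDivisors).ne hf₀
      exact isSMulRegular_iff_right_eq_zero_of_smul.mpr fun x hx => by simpa [this] using hx
    · rw [← List.map_cons]
      intro f hf
      obtain ⟨r, hr, rfl⟩ := List.mem_map.mp hf
      exact hφ r (hle (Ideal.subset_span hr))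
    · intro q hq hqle
      have hcomap : Ideal.ofList (f₀ :: fs) ≤ q.comap φ := by
        rw [← Ideal.map_le_iff_le_comap, Ideal.map_ofList]
        simpa using hqle
      have hqmax := hmax (q.comap φ) inferInstance hcomap
      have hPq : q.comap φ = P := by
        refine hqmax.eq_of_le hP.ne_top fun r hr => ?_
        have : φ r ∈ IsLocalRing.maximalIdeal A := IsLocalRing.le_maximalIdeal hq.ne_top hr
        exact (IsLocalization.AtPrime.to_map_mem_maximal_iff A P r).mp this
      rw [← Localization.AtPrime.map_eq_maximalIdeal, Ideal.map_le_iff_le_comap]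
      exact hPq.ge
    · intro r hr
      obtain ⟨s, hs, rfl⟩ := List.mem_map.mp hr
      exact hφ s (hrsP s hs)
  · obtain ⟨f, hf, hfP⟩ : ∃ f ∈ f₀ :: fs, f ∉ P := by
      by_contra! h
      exact hle (Ideal.span_le.mpr h)
    have hunit : IsUnit (φ f) := IsLocalization.map_units A (⟨f, hfP⟩ : P.primeCompl)
    rcases List.mem_cons.mp hf with rfl | hf
    · exact (Ideal.unit_mul_mem_iff_mem _ hunit).mp hu'
    · have := Ideal.eq_top_of_isUnit_mem _
        (Ideal.mem_map_of_mem φ (Ideal.subset_span hf : f ∈ Ideal.ofList fs)) hunit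
      rw [this]; trivial

end RegularSequences

section PolynomialRegularSequences

open RingTheory.Sequence

lemma MvPolynomial.isWeaklyRegular_map_X {σ K : Type} [CommRing K] (l : List σ) (hl : l.Nodup) :
    IsWeaklyRegular (MvPolynomial σ K) (l.map (X : σ → MvPolynomial σ K)) := by
  induction l using List.reverseRecOn with
  | nil => exact IsWeaklyRegular.nil _ _
  | append_singleton l i ih =>
    rw [List.nodup_append] at hl
    have hi : i ∉ l := fun h => hl.2.2 i h i (by simp) rfl
    rw [List.map_append, isWeaklyRegular_append_iff]
    refine ⟨ih hl.1, ?_⟩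
    rw [List.map_singleton, isWeaklyRegular_singleton_iff,
      isSMulRegular_iff_right_eq_zero_of_smul]
    have hspan : (Ideal.ofList (l.map (X : σ → MvPolynomial σ K)) • ⊤ :
        Submodule (MvPolynomial σ K) (MvPolynomial σ K)) = Ideal.span (X '' {j | j ∈ l}) := by
      rw [Ideal.ofList]
      simp [Set.image]
    rw [hspan]
    intro x
    induction x using Submodule.Quotient.induction_on with
    | _ p =>
    rw [← Submodule.Quotient.mk_smul, Submodule.Quotient.mk_eq_zero, Submodule.Quotient.mk_eq_zero,
      mem_ideal_span_X_image, mem_ideal_span_X_image, smul_eq_mul]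
    intro h m hm
    obtain ⟨j, hj, hne⟩ := h (Finsupp.single i 1 + m) (by
      rw [mem_support_iff, coeff_X_mul]
      exact mem_support_iff.mp hm)
    refine ⟨j, hj, ?_⟩
    have hij : i ≠ j := by rintro rfl; exact hi hj
    simpa [Finsupp.single_apply, hij] using hne

lemma MvPolynomial.exists_isWeaklyRegular_of_isMaximal {σ K : Type} [Field K] [IsAlgClosed K]
    [Fintype σ] (m : Ideal (MvPolynomial σ K)) (hm : m.IsMaximal) :
    ∃ rs : List (MvPolynomial σ K), rs.length = Fintype.card σ ∧ (∀ r ∈ rs, r ∈ m) ∧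
      IsWeaklyRegular (MvPolynomial σ K) rs := by
  obtain ⟨α, rfl⟩ := isMaximal_iff_eq_vanishingIdeal_singleton.mp hm
  let e : MvPolynomial σ K ≃ₐ[K] MvPolynomial σ K :=
    AlgEquiv.ofAlgHom (aeval fun i => X i - C (α i)) (aeval fun i => X i + C (α i))
      (by ext i; simp) (by ext i; simp)
  refine ⟨Finset.univ.toList.map fun i => X i - C (α i), by simp, ?_, ?_⟩
  · intro r hr
    obtain ⟨i, -, rfl⟩ := List.mem_map.mp hr
    simp [mem_vanishingIdeal_iff]
  · refine (AddEquiv.isWeaklyRegular_congr (e := e.toAddEquiv) ?_).mp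
      (isWeaklyRegular_map_X Finset.univ.toList (Finset.nodup_toList _))
    rw [List.forall₂_map_left_iff, List.forall₂_map_right_iff, List.forall₂_same]
    intro i _ x
    simp [e]

lemma RingEquiv.exists_isWeaklyRegular {R S : Type} [CommRing R] [CommRing S] (e : R ≃+* S)
    (N : ℕ) (h : ∀ m : Ideal R, m.IsMaximal → ∃ rs : List R, rs.length = N ∧ (∀ r ∈ rs, r ∈ m) ∧
      IsWeaklyRegular R rs) (m : Ideal S) (hm : m.IsMaximal) :
    ∃ rs : List S, rs.length = N ∧ (∀ r ∈ rs, r ∈ m) ∧ IsWeaklyRegular S rs := by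
  obtain ⟨rs, hlen, hmem, hreg⟩ := h (m.comap e) (Ideal.comap_isMaximal_of_equiv e)
  refine ⟨rs.map e, by simpa using hlen, ?_, ?_⟩
  · intro r hr
    obtain ⟨s, hs, rfl⟩ := List.mem_map.mp hr
    exact hmem s hs
  · refine (AddEquiv.isWeaklyRegular_congr (e := e.toAddEquiv) ?_).mp hreg
    rw [List.forall₂_map_right_iff, List.forall₂_same]
    intro i _ x
    simp

end PolynomialRegularSequences

section Fibers

open Polynomial

lemma Polynomial.isTorsionFree_of_injective_X_sub_C_smul {K B : Type} [Field K] [IsAlgClosed K]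
    [AddCommGroup B] [Module K[X] B] (hB : ∀ (c : K) (b : B), (X - C c) • b = 0 → b = 0) :
    Module.IsTorsionFree K[X] B := by
  refine ⟨fun p hp => ?_⟩
  rw [isSMulRegular_iff_right_eq_zero_of_smul]
  have hp0 : p ≠ 0 := hp.ne_zero
  have key : ∀ (s : Multiset K) (b : B), (s.map fun a => X - C a).prod • b = 0 → b = 0 := by
    intro s
    induction s using Multiset.induction_on with
    | empty => simp
    | cons a s ih =>
      intro b hb
      rw [Multiset.map_cons, Multiset.prod_cons, mul_smul] at hb
      exact ih b (hB a _ hb)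
  intro b hb
  rw [(IsAlgClosed.splits p).eq_prod_roots, mul_smul] at hb
  refine key p.roots b ?_
  have := congrArg (fun y => C (p.leadingCoeff)⁻¹ • y) hb
  rwa [smul_zero, ← mul_smul, ← C_mul,
    inv_mul_cancel₀ (leadingCoeff_ne_zero.mpr hp0), C_1, one_smul] at this

lemma Polynomial.finrank_fiber {K B A : Type} [Field K] [IsAlgClosed K] [AddCommGroup B]
    [Module K[X] B] [Module.Finite K[X] B] [AddCommGroup A] [Module K A]
    (hB : ∀ (c : K) (b : B), (X - C c) • b = 0 → b = 0) (c : K) (π : B →+ A)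
    (hπ : ∀ (p : K[X]) b, π (p • b) = p.eval c • π b) (hsurj : Function.Surjective π)
    (hker : ∀ b, π b = 0 → ∃ b', b = (X - C c) • b') :
    Module.Finite K A ∧ Module.finrank K A = Module.finrank K[X] B := by
  have := isTorsionFree_of_injective_X_sub_C_smul hB
  have : Module.Free K[X] B := Module.free_of_finite_type_torsion_free'
  let b := Module.finBasis K[X] B
  have hli : LinearIndependent K (fun i => π (b i)) := by
    rw [Fintype.linearIndependent_iff]
    intro g hg i
    obtain ⟨b', hb'⟩ := hker (∑ i, C (g i) • b i) (by
      rw [map_sum, ← hg]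
      exact Finset.sum_congr rfl fun i _ => by rw [hπ, eval_C])
    have h := congrArg (fun y => (b.repr y i).eval c) hb'
    rw [b.repr_sum_self] at h
    simpa using h
  have hsp : ⊤ ≤ Submodule.span K (Set.range fun i => π (b i)) := by
    intro a _
    obtain ⟨y, rfl⟩ := hsurj a
    rw [← b.sum_repr y, map_sum]
    refine Submodule.sum_mem _ fun i _ => ?_
    rw [hπ]
    exact Submodule.smul_mem _ _ (Submodule.subset_span ⟨i, rfl⟩)
  let b' := Module.Basis.mk hli hsp
  exact ⟨Module.Finite.of_basis b', by
    rw [Module.finrank_eq_card_basis b', Fintype.card_fin]⟩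

end Fibers

section Weighted

open MvPolynomial

lemma MvPolynomial.weightedHomogeneousComponent_mul_of_right {R τ : Type} [CommRing R]
    (w : τ → ℕ) (a b : MvPolynomial τ R) {i : ℕ} (hb : b.IsWeightedHomogeneous w i) (n : ℕ) :
    weightedHomogeneousComponent w n (a * b) =
      if i ≤ n then weightedHomogeneousComponent w (n - i) a * b else 0 := by
  let := weightedGradedAlgebra R w
  have h := DirectSum.coe_decompose_mul_of_right_mem (a := a)
    (weightedHomogeneousSubmodule R w) n ((mem_weightedHomogeneousSubmodule R w i b).mpr hb)
  have h2 := fun (φ : MvPolynomial τ R) (m : ℕ) => weightedDecomposition.decompose'_apply R w φ m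
  simpa only [DirectSum.decompose, Equiv.coe_fn_mk, h2] using h

lemma MvPolynomial.exists_X_pow_eq_sum {K τ ι : Type} [Field K] [IsAlgClosed K] [Fintype τ]
    [Fintype ι] (w : τ → ℕ) (d : ι → ℕ) (g : ι → MvPolynomial τ K)
    (hg : ∀ j, (g j).IsWeightedHomogeneous w (d j))
    (hzero : ∀ y : τ → K, (∀ j, eval y (g j) = 0) → y = 0) :
    ∃ N : ℕ, ∀ i, ∃ u : ι → MvPolynomial τ K, X i ^ N = ∑ j, u j * g j ∧
      ∀ j, ∀ m ∈ (u j).support, Finsupp.weight w m + d j = N * w i := by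
  classical
  have hrad : ∀ i, ∃ N, (X i : MvPolynomial τ K) ^ N ∈ Ideal.span (Set.range g) := by
    intro i
    have : (X i : MvPolynomial τ K) ∈ (Ideal.span (Set.range g)).radical := by
      rw [← vanishingIdeal_zeroLocus_eq_radical (K := K), mem_vanishingIdeal_iff]
      intro y hy
      have := hzero y fun j => by
        simpa [aeval_eq_eval] using mem_zeroLocus_iff.mp hy (g j) (Ideal.subset_span ⟨j, rfl⟩)
      simp [this]
    exact this
  choose N hN using hrad
  refine ⟨∑ i, N i, fun i => ?_⟩
  have hmem : (X i : MvPolynomial τ K) ^ (∑ i, N i) ∈ Ideal.span (Set.range g) :=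
    Ideal.pow_mem_of_pow_mem _ (hN i)
      (Finset.single_le_sum (f := N) (fun _ _ => Nat.zero_le _) (Finset.mem_univ i))
  obtain ⟨v, hv⟩ := (Ideal.mem_span_range_iff_exists_fun).mp hmem
  set k := (∑ i, N i) * w i with hk
  refine ⟨fun j => if d j ≤ k then weightedHomogeneousComponent w (k - d j) (v j) else 0, ?_, ?_⟩
  · have hX : (X i ^ (∑ i, N i) : MvPolynomial τ K).IsWeightedHomogeneous w k := by
      simpa [hk] using (isWeightedHomogeneous_X K w i).pow (∑ i, N i)
    rw [← hX.weightedHomogeneousComponent_same]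
    conv_lhs => rw [← hv, map_sum]
    refine Finset.sum_congr rfl fun j _ => ?_
    rw [weightedHomogeneousComponent_mul_of_right w _ _ (hg j)]
    by_cases hd : d j ≤ k <;> simp [hd]
  · intro j m hm
    simp only [mem_support_iff] at hm
    split_ifs at hm with hd
    · rw [coeff_weightedHomogeneousComponent] at hm
      split_ifs at hm with h
      · omega
      · exact absurd rfl hm
    · simp at hm

lemma MvPolynomial.finite_quotient_of_X_pow_eq_sum {K S τ ι : Type} [Field K] [CommRing S]
    [Algebra K S] [Fintype τ] [Fintype ι] (w : τ → ℕ) (d : ι → ℕ) (g : ι → MvPolynomial τ K)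
    (N : ℕ) (hN : ∀ i, ∃ u : ι → MvPolynomial τ K, X i ^ N = ∑ j, u j * g j ∧
      ∀ j, ∀ m ∈ (u j).support, Finsupp.weight w m + d j = N * w i)
    (r : ι → MvPolynomial τ S) (hr : ∀ j, ∀ m ∈ (r j).support, Finsupp.weight w m < d j) :
    Module.Finite S (MvPolynomial τ S ⧸
      Ideal.span (Set.range fun j => map (algebraMap K S) (g j) + r j)) := by
  classical
  set I := Ideal.span (Set.range fun j => map (algebraMap K S) (g j) + r j) with hI
  set s : Set (τ →₀ ℕ) := {α | ∀ i, α i < N} with hs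
  have hsfin : s.Finite := by
    refine (Set.finite_Iic (Finsupp.equivFunOnFinite.symm fun _ => N)).subset fun α hα => ?_
    rw [Set.mem_Iic]
    intro i
    simpa using (hα i).le
  let T : Submodule S (MvPolynomial τ S ⧸ I) :=
    Submodule.span S ((fun α => Ideal.Quotient.mk I (monomial α 1)) '' s)
  have hsum : ∀ (P : MvPolynomial τ S),
      (∀ m ∈ P.support, Ideal.Quotient.mk I (monomial m 1) ∈ T) → Ideal.Quotient.mk I P ∈ T := by
    intro P hP
    rw [P.as_sum, map_sum]
    refine Submodule.sum_mem _ fun m hm => ?_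
    have : (monomial m (coeff m P) : MvPolynomial τ S) = coeff m P • monomial m 1 := by
      rw [smul_monomial, smul_eq_mul, mul_one]
    rw [this]
    exact T.smul_mem _ (hP m hm)
  have key : ∀ (k : ℕ) (α : τ →₀ ℕ), Finsupp.weight w α = k →
      Ideal.Quotient.mk I (monomial α 1) ∈ T := by
    intro k
    induction k using Nat.strong_induction_on with
    | _ k ih =>
    intro α hα
    by_cases hαs : α ∈ s
    · exact Submodule.subset_span ⟨α, hαs, rfl⟩
    obtain ⟨i, hi⟩ : ∃ i, N ≤ α i := by simpa [hs] using hαs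
    obtain ⟨u, hu, hud⟩ := hN i
    obtain ⟨β, rfl⟩ : ∃ β, α = β + Finsupp.single i N := by
      refine ⟨α - Finsupp.single i N, (tsub_add_cancel_of_le ?_).symm⟩
      rwa [Finsupp.single_le_iff]
    have hu' := congrArg (map (algebraMap K S)) hu
    simp only [map_pow, map_X, map_sum, map_mul] at hu'
    have hmon : (monomial (β + Finsupp.single i N) 1 : MvPolynomial τ S) =
        monomial β 1 * ∑ j, map (algebraMap K S) (u j) * (map (algebraMap K S) (g j) + r j) -
        ∑ j, monomial β 1 * (map (algebraMap K S) (u j) * r j) := by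
      rw [← Finset.mul_sum, ← mul_sub, ← Finset.sum_sub_distrib]
      simp_rw [mul_add, add_sub_cancel_right]
      rw [← hu', X_pow_eq_monomial, monomial_mul, one_mul]
    have hmemI : monomial β 1 * ∑ j, map (algebraMap K S) (u j) *
        (map (algebraMap K S) (g j) + r j) ∈ I :=
      I.mul_mem_left _ (I.sum_mem fun j _ => I.mul_mem_left _ (Ideal.subset_span ⟨j, rfl⟩))
    rw [hmon, map_sub, Ideal.Quotient.eq_zero_iff_mem.mpr hmemI, zero_sub, map_sum]
    refine T.neg_mem (T.sum_mem fun j _ => hsum _ fun m hm => ih (Finsupp.weight w m) ?_ m rfl)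
    obtain ⟨b, hb, c, hc, rfl⟩ := Finset.mem_add.mp (support_mul _ _ hm)
    obtain ⟨a, ha, e, he, rfl⟩ := Finset.mem_add.mp (support_mul _ _ hc)
    have h1 := hud j a (support_map_subset _ _ ha)
    have h2 := hr j e he
    obtain rfl : b = β := by simpa using support_monomial_subset hb
    rw [← hα, map_add, map_add, map_add, Finsupp.weight_single, smul_eq_mul]
    omega
  refine Module.finite_def.mpr (Submodule.fg_def.mpr
    ⟨(fun α => Ideal.Quotient.mk I (monomial α 1)) '' s, hsfin.image _, eq_top_iff.mpr ?_⟩)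
  rintro b -
  obtain ⟨P, rfl⟩ := Ideal.Quotient.mk_surjective b
  exact hsum P fun m _ => key _ m rfl

end Weighted

section Deformation

open MvPolynomial

lemma MvPolynomial.isMaximal_of_finite_quotient {K τ : Type} [Field K]
    (I p : Ideal (MvPolynomial τ (Polynomial K))) [p.IsPrime]
    [Module.Finite (Polynomial K) (MvPolynomial τ (Polynomial K) ⧸ I)] (hIp : I ≤ p) (c : K)
    (hc : C (Polynomial.X - Polynomial.C c) ∈ p) : p.IsMaximal := by
  have : Module.Finite (Polynomial K) (MvPolynomial τ (Polynomial K) ⧸ p) :=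
    Module.Finite.of_surjective
      ((Ideal.Quotient.factorₐ (Polynomial K) hIp).toLinearMap)
      (Ideal.Quotient.factor_surjective hIp)
  rw [← Ideal.bot_quotient_isMaximal_iff]
  have hmax : (Ideal.span {Polynomial.X - Polynomial.C c}).IsMaximal :=
    PrincipalIdealRing.isMaximal_of_irreducible (Polynomial.irreducible_X_sub_C c)
  refine Ideal.isMaximal_of_isIntegral_of_isMaximal_comap (R := Polynomial K)
    (S := MvPolynomial τ (Polynomial K) ⧸ p) ⊥ ?_
  have hprime : ((⊥ : Ideal (MvPolynomial τ (Polynomial K) ⧸ p)).comap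
      (algebraMap (Polynomial K) _)).IsPrime := Ideal.comap_isPrime _ _
  rw [← hmax.eq_of_le hprime.ne_top]
  · exact hmax
  · rw [Ideal.span_singleton_le_iff_mem, Ideal.mem_comap, Ideal.mem_bot]
    exact Ideal.Quotient.eq_zero_iff_mem.mpr hc

lemma MvPolynomial.mem_of_C_X_sub_C_mul_mem {K τ ι : Type} [Field K] [IsAlgClosed K] [Fintype τ]
    [Fintype ι] (hcard : Fintype.card ι = Fintype.card τ)
    (f : ι → MvPolynomial τ (Polynomial K))
    [Module.Finite (Polynomial K) (MvPolynomial τ (Polynomial K) ⧸ Ideal.span (Set.range f))]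
    (c : K) (P : MvPolynomial τ (Polynomial K))
    (hP : C (Polynomial.X - Polynomial.C c) * P ∈ Ideal.span (Set.range f)) :
    P ∈ Ideal.span (Set.range f) := by
  have hf : Ideal.ofList (Finset.univ.toList.map f) = Ideal.span (Set.range f) := by
    rw [Ideal.ofList]
    congr 1
    ext x
    simp
  have := IsAlgClosed.instInfinite (K := K)
  rw [← hf] at hP ⊢
  refine mem_ofList_of_mul_mem K _ ?_ _ ?_ ?_ hP
  · rw [Ne, map_eq_zero_iff _ (C_injective τ (Polynomial K))]
    exact Polynomial.X_sub_C_ne_zero c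
  · intro p hp hle
    rw [Ideal.ofList_cons, hf, sup_le_iff, Ideal.span_singleton_le_iff_mem] at hle
    exact isMaximal_of_finite_quotient _ p hle.2 c hle.1
  · intro p hp
    have h := (optionEquivRight K τ).toRingEquiv.exists_isWeaklyRegular
      _ exists_isWeaklyRegular_of_isMaximal p hp
    simpa [hcard] using h

/-- Adding terms of lower weight to a weighted homogeneous complete intersection supported at the
origin does not change the dimension of the quotient. -/
lemma MvPolynomial.finrank_quotient_add_of_weight_lt {K τ ι : Type} [Field K] [IsAlgClosed K]
    [Fintype τ] [Fintype ι] (hcard : Fintype.card ι = Fintype.card τ) (w : τ → ℕ) (d : ι → ℕ)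
    (g e : ι → MvPolynomial τ K) (hg : ∀ j, (g j).IsWeightedHomogeneous w (d j))
    (he : ∀ j, ∀ m ∈ (e j).support, Finsupp.weight w m < d j)
    (hzero : ∀ y : τ → K, (∀ j, eval y (g j) = 0) → y = 0) :
    FiniteDimensional K (MvPolynomial τ K ⧸ Ideal.span (Set.range fun j => g j + e j)) ∧
      Module.finrank K (MvPolynomial τ K ⧸ Ideal.span (Set.range fun j => g j + e j)) =
        Module.finrank K (MvPolynomial τ K ⧸ Ideal.span (Set.range g)) := by
  obtain ⟨N, hN⟩ := exists_X_pow_eq_sum w d g hg hzero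
  let ev : K → MvPolynomial τ (Polynomial K) →+* MvPolynomial τ K :=
    fun c => map (Polynomial.evalRingHom c)
  have hev : ∀ c, Function.Surjective (ev c) := fun c =>
    map_surjective _ fun a => ⟨Polynomial.C a, by simp⟩
  have hevC : ∀ c (q : MvPolynomial τ K), ev c (map (algebraMap K (Polynomial K)) q) = q := by
    intro c q
    simp only [ev, map_map]
    convert map_id q
    ext
    simp
  let r : ι → MvPolynomial τ (Polynomial K) :=
    fun j => C Polynomial.X * map (algebraMap K (Polynomial K)) (e j)
  have hr : ∀ j, ∀ m ∈ (r j).support, Finsupp.weight w m < d j := by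
    intro j m hm
    refine he j m (support_map_subset (algebraMap K (Polynomial K)) _ ?_)
    rw [mem_support_iff] at hm ⊢
    intro h0
    exact hm (by simp only [r, coeff_C_mul, h0, mul_zero])
  let f : ι → MvPolynomial τ (Polynomial K) :=
    fun j => map (algebraMap K (Polynomial K)) (g j) + r j
  have hfin : Module.Finite (Polynomial K)
      (MvPolynomial τ (Polynomial K) ⧸ Ideal.span (Set.range f)) :=
    finite_quotient_of_X_pow_eq_sum w d g N hN r hr
  have hevf : ∀ c j, ev c (f j) = g j + C c * e j := by
    intro c j
    simp only [f, r, map_add, map_mul, hevC]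
    simp [ev]
  have hmap : ∀ c, (Ideal.span (Set.range f)).map (ev c) =
      Ideal.span (Set.range fun j => g j + C c * e j) := by
    intro c
    rw [Ideal.map_span, ← Set.range_comp]
    congr 2
    ext1 j
    exact hevf c j
  have hfiber : ∀ c, FiniteDimensional K
        (MvPolynomial τ K ⧸ Ideal.span (Set.range fun j => g j + C c * e j)) ∧
      Module.finrank K (MvPolynomial τ K ⧸ Ideal.span (Set.range fun j => g j + C c * e j)) =
        Module.finrank (Polynomial K)
          (MvPolynomial τ (Polynomial K) ⧸ Ideal.span (Set.range f)) := by
    intro c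
    rw [← hmap]
    refine Polynomial.finrank_fiber ?_ c
      (Ideal.quotientMap _ (ev c) Ideal.le_comap_map).toAddMonoidHom ?_ ?_ ?_
    · intro c' b hb
      obtain ⟨P, rfl⟩ := Ideal.Quotient.mk_surjective b
      rw [Ideal.Quotient.eq_zero_iff_mem]
      refine mem_of_C_X_sub_C_mul_mem hcard f c' P ?_
      rw [← Ideal.Quotient.eq_zero_iff_mem, ← hb, ← smul_eq_C_mul]
      rfl
    · intro p b
      obtain ⟨P, rfl⟩ := Ideal.Quotient.mk_surjective b
      have h1 : p • Ideal.Quotient.mk (Ideal.span (Set.range f)) P =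
          Ideal.Quotient.mk _ (C p * P) := by
        rw [← smul_eq_C_mul]
        rfl
      have h2 : ∀ (a : K) (Q : MvPolynomial τ K),
          a • Ideal.Quotient.mk ((Ideal.span (Set.range f)).map (ev c)) Q =
          Ideal.Quotient.mk _ (C a * Q) := by
        intro a Q
        rw [← smul_eq_C_mul]
        rfl
      simp [h1, h2, ev]
    · exact Ideal.quotientMap_surjective (H := Ideal.le_comap_map) (hev c)
    · intro b hb
      obtain ⟨P, rfl⟩ := Ideal.Quotient.mk_surjective b
      have hb' : ev c P ∈ (Ideal.span (Set.range f)).map (ev c) := by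
        simpa [Ideal.Quotient.eq_zero_iff_mem] using hb
      obtain ⟨Q, hQ, hQP⟩ := (Ideal.mem_map_iff_of_surjective _ (hev c)).mp hb'
      have hk : P - Q ∈ RingHom.ker (ev c) := by
        rw [RingHom.mem_ker, map_sub, hQP, sub_self]
      rw [ker_map, Polynomial.ker_evalRingHom, Ideal.map_span, Set.image_singleton,
        Ideal.mem_span_singleton] at hk
      obtain ⟨P', hP'⟩ := hk
      refine ⟨Ideal.Quotient.mk _ P', ?_⟩
      rw [← sub_eq_zero, ← Ideal.Quotient.eq_zero_iff_mem.mpr hQ]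
      rw [sub_eq_iff_eq_add, ← sub_eq_iff_eq_add', ← map_sub, hP', ← smul_eq_C_mul]
      rfl
  have hone : (fun j => g j + C 1 * e j) = fun j => g j + e j := by simp
  have hz : (fun j => g j + C 0 * e j) = g := by simp
  have h1 := hfiber 1
  have h0 := hfiber 0
  rw [hone] at h1
  rw [hz] at h0
  exact ⟨h1.1, h1.2.trans h0.2.symm⟩

end Deformation

section WeightedPolynomials

open Polynomial

/-- Every monomial `y ^ m * X ^ i` occurring in `P` satisfies `Q (weight w m + i)`. -/
def Polynomial.HasWeight {τ R : Type} [CommRing R] (w : τ → ℕ) (Q : ℕ → Prop)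
    (P : (MvPolynomial τ R)[X]) : Prop :=
  ∀ i, ∀ m ∈ (P.coeff i).support, Q (Finsupp.weight w m + i)

namespace Polynomial.HasWeight

variable {τ R : Type} [CommRing R] {w : τ → ℕ} {Q Q₁ Q₂ : ℕ → Prop}
  {P P₁ P₂ : (MvPolynomial τ R)[X]}

lemma add (h₁ : HasWeight w Q P₁) (h₂ : HasWeight w Q P₂) : HasWeight w Q (P₁ + P₂) := by
  classical
  intro i m hm
  rw [coeff_add] at hm
  rcases Finset.mem_union.mp (MvPolynomial.support_add hm) with h | h
  · exact h₁ i m h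
  · exact h₂ i m h

lemma sub (h₁ : HasWeight w Q P₁) (h₂ : HasWeight w Q P₂) : HasWeight w Q (P₁ - P₂) := by
  classical
  intro i m hm
  rw [coeff_sub] at hm
  rcases Finset.mem_union.mp (MvPolynomial.support_sub _ _ _ hm) with h | h
  · exact h₁ i m h
  · exact h₂ i m h

lemma sum {ι : Type} (s : Finset ι) (f : ι → (MvPolynomial τ R)[X])
    (h : ∀ j ∈ s, HasWeight w Q (f j)) : HasWeight w Q (∑ j ∈ s, f j) := by
  classical
  intro i m hm
  rw [finsetSum_coeff] at hm
  obtain ⟨j, hj, hm⟩ := Finset.mem_biUnion.mp (MvPolynomial.support_sum hm)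
  exact h j hj i m hm

lemma mul (h₁ : HasWeight w Q₁ P₁) (h₂ : HasWeight w Q₂ P₂)
    (h : ∀ a b, Q₁ a → Q₂ b → Q (a + b)) : HasWeight w Q (P₁ * P₂) := by
  classical
  intro i m hm
  rw [coeff_mul] at hm
  obtain ⟨⟨a, b⟩, hab, hm⟩ := Finset.mem_biUnion.mp (MvPolynomial.support_sum hm)
  obtain ⟨m₁, hm₁, m₂, hm₂, rfl⟩ := Finset.mem_add.mp (MvPolynomial.support_mul _ _ hm)
  have := h _ _ (h₁ a m₁ hm₁) (h₂ b m₂ hm₂)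
  rw [Finset.HasAntidiagonal.mem_antidiagonal] at hab
  rw [map_add]
  convert this using 1
  simp only at hab
  omega

lemma derivative (h₁ : HasWeight w Q₁ P) (h : ∀ a, Q₁ (a + 1) → Q a) :
    HasWeight w Q (derivative P) := by
  intro i m hm
  refine h _ (h₁ (i + 1) m ?_)
  rw [MvPolynomial.mem_support_iff] at hm ⊢
  intro h0
  apply hm
  rw [coeff_derivative, ← Nat.cast_succ, mul_comm, ← nsmul_eq_mul, MvPolynomial.coeff_smul, h0,
    smul_zero]

lemma map_C (q : R[X]) (h : ∀ i, q.coeff i ≠ 0 → Q i) :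
    HasWeight w Q (q.map (MvPolynomial.C (σ := τ))) := by
  classical
  intro i m hm
  rw [coeff_map, MvPolynomial.mem_support_iff, MvPolynomial.coeff_C] at hm
  split_ifs at hm with h0
  · subst h0
    simpa using h i hm
  · exact absurd rfl hm

lemma C_X_mul_X_pow (t : τ) (k : ℕ) (h : Q (w t + k)) :
    HasWeight w Q (C (MvPolynomial.X t : MvPolynomial τ R) * X ^ k) := by
  classical
  intro i m hm
  rw [coeff_C_mul, coeff_X_pow, MvPolynomial.mem_support_iff] at hm
  split_ifs at hm with h0
  · subst h0
    rw [mul_one, MvPolynomial.coeff_X] at hm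
    split_ifs at hm with h1
    · subst h1
      rwa [Finsupp.weight_single, smul_eq_mul, one_mul]
    · exact absurd rfl hm
  · simp at hm

lemma coeff_eq_zero (h : HasWeight w Q P) {i : ℕ} (hi : ∀ a, ¬ Q (a + i)) : P.coeff i = 0 := by
  by_contra hne
  obtain ⟨m, hm⟩ := MvPolynomial.support_nonempty.mpr hne
  exact hi _ (h i m hm)

end Polynomial.HasWeight

end WeightedPolynomials

section DifferentialOperator

open Polynomial

/-- The polynomial with coefficient `v i` at `X ^ (l - 1 - i)` for `i < l`. -/
def Polynomial.ofRevCoeffs {R : Type} [CommRing R] {l : ℕ} (v : Fin l → R) : R[X] :=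
  ∑ i : Fin l, C (v i) * X ^ (l - 1 - (i : ℕ))

lemma Polynomial.coeff_ofRevCoeffs {R : Type} [CommRing R] {l : ℕ} (v : Fin l → R) (i : Fin l) :
    (ofRevCoeffs v).coeff (l - 1 - i) = v i := by
  rw [ofRevCoeffs, finsetSum_coeff, Finset.sum_eq_single i]
  · simp
  · intro j _ hj
    rw [coeff_C_mul, coeff_X_pow, if_neg, mul_zero]
    have : (i : ℕ) ≠ j := fun h => hj (Fin.ext h.symm)
    omega
  · simp

lemma Polynomial.coeff_ofRevCoeffs_of_le {R : Type} [CommRing R] {l : ℕ} (v : Fin l → R) {j : ℕ}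
    (hj : l ≤ j) : (ofRevCoeffs v).coeff j = 0 := by
  rw [ofRevCoeffs, finsetSum_coeff]
  refine Finset.sum_eq_zero fun i _ => ?_
  rw [coeff_C_mul, coeff_X_pow, if_neg, mul_zero]
  omega

lemma Polynomial.map_ofRevCoeffs {R S : Type} [CommRing R] [CommRing S] (f : R →+* S) {l : ℕ}
    (v : Fin l → R) : (ofRevCoeffs v).map f = ofRevCoeffs fun i => f (v i) := by
  simp [ofRevCoeffs, Polynomial.map_sum]

/-- The differential operator with coefficients `P₂`, `-P₁`, `W` applied to `p`. -/
def Polynomial.secondOrder {R : Type} [CommRing R] (P₂ P₁ W p : R[X]) : R[X] :=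
  P₂ * derivative (derivative p) - P₁ * derivative p + W * p

lemma Polynomial.map_secondOrder {R S : Type} [CommRing R] [CommRing S] (f : R →+* S)
    (P₂ P₁ W p : R[X]) : (secondOrder P₂ P₁ W p).map f =
      secondOrder (P₂.map f) (P₁.map f) (W.map f) (p.map f) := by
  simp [secondOrder, derivative_map]

lemma Polynomial.coeff_X_pow_mul_derivative {R : Type} [CommRing R] (q : R[X]) (k i : ℕ) :
    (X ^ (k + 1) * derivative q).coeff (k + i) = i * q.coeff i := by
  rw [pow_add, mul_assoc, coeff_X_pow_mul', if_pos (by omega), add_tsub_cancel_left]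
  cases i with
  | zero => simp
  | succ i => simp [coeff_X_mul, coeff_derivative, mul_comm]

lemma Polynomial.coeff_X_pow_mul_derivative_derivative {R : Type} [CommRing R] (q : R[X])
    (k i : ℕ) : (X ^ (k + 2) * derivative (derivative q)).coeff (k + i) =
      i * (i - 1) * q.coeff i := by
  rw [pow_add, mul_assoc, coeff_X_pow_mul', if_pos (by omega), add_tsub_cancel_left]
  rcases i with _ | _ | i
  · simp
  · simp [pow_two, mul_assoc]
  · rw [show i + 1 + 1 = i + 2 from rfl, coeff_X_pow_mul, coeff_derivative, coeff_derivative]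
    push_cast
    ring

lemma Polynomial.eq_of_secondOrder_coeff_eq_zero {K : Type} [Field K] [CharZero K] {k l : ℕ}
    {M : K} {q V : K[X]}
    (hq : q.coeff l = 1) (hV : V.coeff k = l * (M + 1 - l)) (hVk : ∀ j, k < j → V.coeff j = 0)
    (hsep : ∀ i : ℕ, 1 ≤ i → i ≤ l → M - 2 * l + 1 + i ≠ 0)
    (h : ∀ j < k + l, (secondOrder (X ^ (k + 2)) (C M * X ^ (k + 1)) V q).coeff j = 0) :
    (∀ j < l, q.coeff j = 0) ∧ ∀ j < k, V.coeff j = 0 := by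
  have hq0 : q ≠ 0 := by
    rintro rfl
    simp at hq
  have hrl : q.natTrailingDegree ≤ l := natTrailingDegree_le_of_ne_zero (by simp [hq])
  have hV0 : ∀ v < k, V.coeff v = 0 := by
    intro v
    induction v using Nat.strong_induction_on with
    | _ v ih =>
    intro hv
    have hc := h (v + q.natTrailingDegree) (by omega)
    have hlow : ∀ i < q.natTrailingDegree, q.coeff i = 0 := fun i hi =>
      coeff_eq_zero_of_lt_natTrailingDegree hi
    have hVq : (V * q).coeff (v + q.natTrailingDegree) = V.coeff v * q.trailingCoeff := by
      rw [coeff_mul, Finset.sum_eq_single (v, q.natTrailingDegree)]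
      · rfl
      · rintro ⟨a, b⟩ hab hne
        rw [Finset.HasAntidiagonal.mem_antidiagonal] at hab
        simp only at hab ⊢
        rcases lt_or_ge a v with ha | ha
        · rw [ih a ha (by omega), zero_mul]
        · rw [hlow b, mul_zero]
          by_contra hb
          exact hne (Prod.ext (by simp only; omega) (by simp only; omega))
      · simp
    have hD : (X ^ (k + 2) * derivative (derivative q)).coeff (v + q.natTrailingDegree) = 0 ∧
        (X ^ (k + 1) * derivative q).coeff (v + q.natTrailingDegree) = 0 := by
      rcases lt_or_ge (v + q.natTrailingDegree) k with hlt | hge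
      · simp [coeff_X_pow_mul', show ¬ k + 2 ≤ v + q.natTrailingDegree by omega,
          show ¬ k + 1 ≤ v + q.natTrailingDegree by omega]
      · obtain ⟨i, hi⟩ := Nat.exists_eq_add_of_le hge
        rw [hi, coeff_X_pow_mul_derivative, coeff_X_pow_mul_derivative_derivative,
          hlow i (by omega)]
        simp
    rw [secondOrder, coeff_add, coeff_sub, mul_assoc, coeff_C_mul, hD.1, hD.2, hVq, mul_zero,
      sub_zero, zero_add, mul_eq_zero] at hc
    exact hc.resolve_right (by simpa using hq0)
  refine ⟨fun i hi => ?_, hV0⟩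
  have hVX : V = C (l * (M + 1 - l)) * X ^ k := by
    ext j
    rw [coeff_C_mul, coeff_X_pow]
    rcases lt_trichotomy j k with hj | rfl | hj
    · simp [hV0 j hj, hj.ne]
    · simp [hV]
    · simp [hVk j hj, hj.ne']
  have hc := h (k + i) (by omega)
  rw [secondOrder, coeff_add, coeff_sub, mul_assoc, coeff_C_mul, coeff_X_pow_mul_derivative,
    coeff_X_pow_mul_derivative_derivative, hVX, mul_assoc (C _), coeff_C_mul, add_comm k i,
    coeff_X_pow_mul] at hc
  have hs := hsep (l - i) (by omega) (by omega)
  rw [Nat.cast_sub hi.le] at hs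
  have hli : ((l : K) - i) ≠ 0 := sub_ne_zero.mpr (by exact_mod_cast hi.ne')
  refine (mul_eq_zero.mp ?_).resolve_left (mul_ne_zero hli hs)
  linear_combination hc

end DifferentialOperator

section PartialFractions

open Polynomial

/-- The numerator `∑ s, v s * ∏ r ≠ s, (X - z r)` of `∑ s, v s / (X - z s)`. -/
def Polynomial.partialFractionNum {R : Type} [CommRing R] {n : ℕ} (z v : Fin n → R) : R[X] :=
  ∑ s, C (v s) * ∏ r ∈ Finset.univ.erase s, (X - C (z r))

variable {R : Type} [CommRing R]

lemma Polynomial.map_partialFractionNum {S : Type} [CommRing S] (f : R →+* S) {n : ℕ}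
    (z v : Fin n → R) : (partialFractionNum z v).map f =
      partialFractionNum (fun i => f (z i)) fun i => f (v i) := by
  simp [partialFractionNum, Polynomial.map_sum, Polynomial.map_prod]

lemma Polynomial.natDegree_partialFractionNum_le {k : ℕ} (z v : Fin (k + 1) → R) :
    (partialFractionNum z v).natDegree ≤ k := by
  nontriviality R
  refine natDegree_sum_le_of_forall_le _ _ fun s _ => (natDegree_C_mul_le _ _).trans ?_
  rw [natDegree_finsetProd_X_sub_C_eq_card, Finset.card_erase_of_mem (Finset.mem_univ _)]
  simp

lemma Polynomial.coeff_partialFractionNum {k : ℕ} (z v : Fin (k + 1) → R) :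
    (partialFractionNum z v).coeff k = ∑ s, v s := by
  nontriviality R
  rw [partialFractionNum, finsetSum_coeff]
  refine Finset.sum_congr rfl fun s _ => ?_
  have h := (monic_prod_X_sub_C z (Finset.univ.erase s)).coeff_natDegree
  rw [natDegree_finsetProd_X_sub_C_eq_card, Finset.card_erase_of_mem (Finset.mem_univ _),
    Finset.card_univ, Fintype.card_fin, Nat.add_sub_cancel] at h
  rw [coeff_C_mul, h, mul_one]

lemma Polynomial.coeff_partialFractionNum_pred {k : ℕ} (z v : Fin (k + 2) → R) :
    (partialFractionNum z v).coeff k = ∑ s, z s * v s - (∑ s, z s) * ∑ s, v s := by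
  rw [partialFractionNum, finsetSum_coeff, Finset.mul_sum, ← Finset.sum_sub_distrib]
  refine Finset.sum_congr rfl fun s _ => ?_
  have hc : (Finset.univ.erase s : Finset (Fin (k + 2))).card = k + 1 := by
    rw [Finset.card_erase_of_mem (Finset.mem_univ _)]
    simp
  have h := prod_X_sub_C_coeff_card_pred (Finset.univ.erase s) z (by omega)
  rw [hc, Nat.add_sub_cancel] at h
  rw [coeff_C_mul, h, ← Finset.add_sum_erase _ z (Finset.mem_univ s)]
  ring

lemma Polynomial.eval_partialFractionNum {n : ℕ} (z v : Fin n → R) (s : Fin n) :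
    (partialFractionNum z v).eval (z s) = v s * ∏ r ∈ Finset.univ.erase s, (z s - z r) := by
  rw [partialFractionNum, eval_finsetSum, Finset.sum_eq_single s]
  · simp [eval_prod]
  · intro t _ hts
    rw [eval_mul, eval_prod, Finset.prod_eq_zero (Finset.mem_erase.mpr ⟨hts.symm,
      Finset.mem_univ s⟩) (by simp), mul_zero]
  · simp

lemma Polynomial.partialFractionNum_eq [IsDomain R] {k : ℕ} {z v : Fin (k + 1) → R}
    (hz : Function.Injective z) {W : R[X]} (hW : W.natDegree ≤ k)
    (hv : ∀ s, v s * ∏ r ∈ Finset.univ.erase s, (z s - z r) = W.eval (z s)) :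
    partialFractionNum z v = W := by
  have hdeg : ∀ P : R[X], P.natDegree ≤ k → P.degree < (Finset.univ : Finset (Fin (k + 1))).card :=
    fun P hP => degree_le_natDegree.trans_lt (by
      rw [Finset.card_univ, Fintype.card_fin]
      exact_mod_cast Nat.lt_succ_of_le hP)
  refine eq_of_degrees_lt_of_eval_index_eq Finset.univ hz.injOn
    (hdeg _ (natDegree_partialFractionNum_le z v)) (hdeg _ hW) fun s _ => ?_
  rw [eval_partialFractionNum, hv]

end PartialFractions

section Family

open Polynomial

/-- The general polynomial of degree at most `k` with coefficient `c` at `X ^ k`. -/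
def potentialUniv (k l : ℕ) (c : ℂ) : (MvPolynomial (Fin l ⊕ Fin k) ℂ)[X] :=
  C (MvPolynomial.C c) * X ^ k + ofRevCoeffs fun i => MvPolynomial.X (Sum.inr i)

lemma pUniv_eq (n l : ℕ) :
    pUniv n l = X ^ l + ofRevCoeffs fun i : Fin l => MvPolynomial.X (Sum.inl i) := rfl

lemma coeff_pUniv_self (n l : ℕ) : (pUniv n l).coeff l = 1 := by
  rw [pUniv_eq, coeff_add, coeff_X_pow_self, coeff_ofRevCoeffs_of_le _ le_rfl, add_zero]

lemma coeff_potentialUniv_self (k l : ℕ) (c : ℂ) :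
    (potentialUniv k l c).coeff k = MvPolynomial.C c := by
  rw [potentialUniv, coeff_add, coeff_C_mul, coeff_X_pow_self,
    coeff_ofRevCoeffs_of_le _ le_rfl, add_zero, mul_one]

lemma natDegree_potentialUniv_le (k l : ℕ) (c : ℂ) : (potentialUniv k l c).natDegree ≤ k := by
  rw [natDegree_le_iff_coeff_eq_zero]
  intro j hj
  rw [potentialUniv, coeff_add, coeff_C_mul, coeff_X_pow, if_neg hj.ne',
    coeff_ofRevCoeffs_of_le _ hj.le, add_zero, mul_zero]

/-- The operator with leading coefficients `P₂`, `P₁` and generic potential, applied to the generic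
monic polynomial of degree `l`. -/
def operatorUniv (k l : ℕ) (c : ℂ) (P₂ P₁ : ℂ[X]) : (MvPolynomial (Fin l ⊕ Fin k) ℂ)[X] :=
  secondOrder (P₂.map MvPolynomial.C) (P₁.map MvPolynomial.C) (potentialUniv k l c) (pUniv k l)

/-- The index of the variable `a_i` or `b_i`, as a weight. -/
def indexWeight (k l : ℕ) : Fin l ⊕ Fin k → ℕ :=
  Sum.elim (fun i => i + 1) fun i => i + 1

lemma hasWeight_pUniv (k l : ℕ) : HasWeight (indexWeight k l) (· = l) (pUniv k l) := by
  rw [pUniv_eq]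
  refine HasWeight.add ?_ (HasWeight.sum _ _ fun i _ => HasWeight.C_X_mul_X_pow _ _ ?_)
  · simpa using HasWeight.map_C (Q := (· = l)) (w := indexWeight k l) (X ^ l : ℂ[X])
      fun i hi => by simpa [coeff_X_pow] using hi
  · simp only [indexWeight, Sum.elim_inl]
    omega

lemma hasWeight_potentialUniv (k l : ℕ) (c : ℂ) :
    HasWeight (indexWeight k l) (· = k) (potentialUniv k l c) := by
  refine HasWeight.add ?_ (HasWeight.sum _ _ fun i _ => HasWeight.C_X_mul_X_pow _ _ ?_)
  · have h := HasWeight.map_C (Q := (· = k)) (w := indexWeight k l) (C c * X ^ k : ℂ[X])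
      fun i hi => by
        by_contra h
        exact hi (by rw [coeff_C_mul, coeff_X_pow, if_neg h, mul_zero])
    rwa [Polynomial.map_mul, Polynomial.map_pow, map_C, map_X] at h
  · simp only [indexWeight, Sum.elim_inr]
    omega

lemma hasWeight_operatorUniv (k l : ℕ) (c M : ℂ) : HasWeight (indexWeight k l) (· = k + l)
    (operatorUniv k l c (X ^ (k + 2)) (C M * X ^ (k + 1))) := by
  have hp := hasWeight_pUniv k l
  have hp' : HasWeight (indexWeight k l) (· + 1 = l) (derivative (pUniv k l)) :=
    hp.derivative fun a h => h
  have hp'' : HasWeight (indexWeight k l) (· + 2 = l) (derivative (derivative (pUniv k l))) :=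
    hp'.derivative fun a h => h
  refine HasWeight.add (HasWeight.sub ?_ ?_) ?_
  · refine HasWeight.mul (HasWeight.map_C (Q := (· = k + 2)) _ fun i hi => ?_) hp''
      fun a b ha hb => by omega
    simpa [coeff_X_pow] using hi
  · refine HasWeight.mul (HasWeight.map_C (Q := (· = k + 1)) _ fun i hi => ?_) hp'
      fun a b ha hb => by omega
    by_contra h
    exact hi (by rw [coeff_C_mul, coeff_X_pow, if_neg h, mul_zero])
  · exact HasWeight.mul (hasWeight_potentialUniv k l c) hp fun a b ha hb => by omega

lemma hasWeight_operatorUniv_sub {k l : ℕ} {c M : ℂ} {P₂ P₁ : ℂ[X]}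
    (h₂ : P₂.Monic) (h₂' : P₂.natDegree = k + 2) (h₁ : P₁.natDegree ≤ k + 1)
    (h₁' : P₁.coeff (k + 1) = M) : HasWeight (indexWeight k l) (· < k + l)
    (operatorUniv k l c P₂ P₁ - operatorUniv k l c (X ^ (k + 2)) (C M * X ^ (k + 1))) := by
  have hp := hasWeight_pUniv k l
  have hp' : HasWeight (indexWeight k l) (· + 1 = l) (derivative (pUniv k l)) :=
    hp.derivative fun a h => h
  have hp'' : HasWeight (indexWeight k l) (· + 2 = l) (derivative (derivative (pUniv k l))) :=
    hp'.derivative fun a h => h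
  have heq : operatorUniv k l c P₂ P₁ - operatorUniv k l c (X ^ (k + 2)) (C M * X ^ (k + 1)) =
      (P₂ - X ^ (k + 2)).map MvPolynomial.C * derivative (derivative (pUniv k l)) -
      (P₁ - C M * X ^ (k + 1)).map MvPolynomial.C * derivative (pUniv k l) := by
    simp only [operatorUniv, secondOrder, Polynomial.map_sub]
    ring
  rw [heq]
  refine HasWeight.sub ?_ ?_
  · refine HasWeight.mul (HasWeight.map_C (Q := (· < k + 2)) _ fun i hi => ?_) hp''
      fun a b ha hb => by omega
    by_contra h
    apply hi
    rw [coeff_sub, coeff_X_pow]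
    split_ifs with h0
    · rw [h0, ← h₂', h₂.coeff_natDegree, sub_self]
    · rw [coeff_eq_zero_of_natDegree_lt (by omega), sub_self]
  · refine HasWeight.mul (HasWeight.map_C (Q := (· < k + 1)) _ fun i hi => ?_) hp'
      fun a b ha hb => by omega
    by_contra h
    apply hi
    rw [coeff_sub, coeff_C_mul, coeff_X_pow]
    split_ifs with h0
    · rw [h0, h₁', mul_one, sub_self]
    · rw [coeff_eq_zero_of_natDegree_lt (by omega), mul_zero, sub_self]

lemma coeff_operatorUniv_eq_zero {k l : ℕ} {M : ℂ} {P₂ P₁ : ℂ[X]}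
    (h₂ : P₂.Monic) (h₂' : P₂.natDegree = k + 2) (h₁ : P₁.natDegree ≤ k + 1)
    (h₁' : P₁.coeff (k + 1) = M) {j : ℕ} (hj : k + l ≤ j) :
    (operatorUniv k l (l * (M + 1 - l)) P₂ P₁).coeff j = 0 := by
  have hsub := (hasWeight_operatorUniv_sub (l := l) (c := l * (M + 1 - l)) h₂ h₂' h₁ h₁'
    ).coeff_eq_zero (i := j) fun a => by omega
  rw [coeff_sub, sub_eq_zero] at hsub
  rw [hsub]
  rcases hj.lt_or_eq with hj | rfl
  · exact (hasWeight_operatorUniv k l _ M).coeff_eq_zero fun a => by omega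
  have hp : (pUniv k l).natDegree ≤ l := by
    rw [natDegree_le_iff_coeff_eq_zero]
    intro j hj
    exact (hasWeight_pUniv k l).coeff_eq_zero fun a => by omega
  rw [operatorUniv, secondOrder, coeff_add, coeff_sub, Polynomial.map_mul, map_C,
    Polynomial.map_pow, Polynomial.map_pow, map_X, mul_assoc, coeff_C_mul,
    coeff_X_pow_mul_derivative, coeff_X_pow_mul_derivative_derivative,
    coeff_mul_add_eq_of_natDegree_le (natDegree_potentialUniv_le _ _ _) hp,
    coeff_potentialUniv_self, coeff_pUniv_self]
  simp only [map_mul, map_sub, map_add, map_natCast, map_one]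
  ring

lemma finrank_quotient_operatorUniv {k l : ℕ} {M : ℂ} {P₂ P₁ : ℂ[X]}
    (hsep : ∀ i : ℕ, 1 ≤ i → i ≤ l → M - 2 * l + 1 + i ≠ 0)
    (h₂ : P₂.Monic) (h₂' : P₂.natDegree = k + 2) (h₁ : P₁.natDegree ≤ k + 1)
    (h₁' : P₁.coeff (k + 1) = M) :
    FiniteDimensional ℂ (MvPolynomial (Fin l ⊕ Fin k) ℂ ⧸ Ideal.span (Set.range
        fun j : Fin (k + l) => (operatorUniv k l (l * (M + 1 - l)) P₂ P₁).coeff j)) ∧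
      Module.finrank ℂ (MvPolynomial (Fin l ⊕ Fin k) ℂ ⧸ Ideal.span (Set.range
        fun j : Fin (k + l) => (operatorUniv k l (l * (M + 1 - l)) P₂ P₁).coeff j)) =
      Module.finrank ℂ (MvPolynomial (Fin l ⊕ Fin k) ℂ ⧸ Ideal.span (Set.range
        fun j : Fin (k + l) => (operatorUniv k l (l * (M + 1 - l)) (X ^ (k + 2))
          (C M * X ^ (k + 1))).coeff j)) := by
  set c : ℂ := l * (M + 1 - l) with hc
  let F₀ := operatorUniv k l c (X ^ (k + 2)) (C M * X ^ (k + 1))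
  let F := operatorUniv k l c P₂ P₁
  have h := MvPolynomial.finrank_quotient_add_of_weight_lt (K := ℂ) (ι := Fin (k + l))
    (by simp [add_comm]) (indexWeight k l) (fun j => k + l - j) (fun j => F₀.coeff j)
    (fun j => (F - F₀).coeff j) ?_ ?_ ?_
  · have heq : (fun j : Fin (k + l) => F₀.coeff j + (F - F₀).coeff j) =
        fun j : Fin (k + l) => F.coeff j := by
      ext1 j
      rw [coeff_sub, add_sub_cancel]
    rw [heq] at h
    exact h
  · intro j m hm
    have := hasWeight_operatorUniv k l c M j m (MvPolynomial.mem_support_iff.mpr hm)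
    omega
  · intro j m hm
    have := hasWeight_operatorUniv_sub (c := c) h₂ h₂' h₁ h₁' j m hm
    omega
  · intro y hy
    have hF : F₀.map (MvPolynomial.eval y) = secondOrder (X ^ (k + 2)) (C M * X ^ (k + 1))
        (C c * X ^ k + ofRevCoeffs fun i => y (Sum.inr i))
        (X ^ l + ofRevCoeffs fun i => y (Sum.inl i)) := by
      simp [F₀, operatorUniv, map_secondOrder, potentialUniv, pUniv_eq, map_ofRevCoeffs]
    obtain ⟨hq, hV⟩ := eq_of_secondOrder_coeff_eq_zero (k := k) (l := l) (M := M)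
      (q := X ^ l + ofRevCoeffs fun i => y (Sum.inl i))
      (V := C c * X ^ k + ofRevCoeffs fun i => y (Sum.inr i))
      (by simp [coeff_ofRevCoeffs_of_le])
      (by rw [coeff_add, coeff_C_mul, coeff_X_pow_self, coeff_ofRevCoeffs_of_le _ le_rfl, mul_one,
        add_zero])
      (fun j hj => by simp [coeff_ofRevCoeffs_of_le _ hj.le, coeff_X_pow, hj.ne']) hsep
      (fun j hj => by rw [← hF, coeff_map]; exact hy ⟨j, hj⟩)
    ext t
    rcases t with i | i
    · have := hq (l - 1 - i) (by omega)
      rw [coeff_add, coeff_X_pow, if_neg (by omega), zero_add, coeff_ofRevCoeffs] at this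
      exact this
    · have := hV (k - 1 - i) (by omega)
      rw [coeff_add, coeff_C_mul, coeff_X_pow, if_neg (by omega), mul_zero, zero_add,
        coeff_ofRevCoeffs] at this
      exact this

end Family

section Reduction

open Polynomial

lemma map_pUniv {S : Type} [CommRing S] {n l : ℕ} (f : MvPolynomial (Fin l ⊕ Fin n) ℂ →+* S) :
    (pUniv n l).map f = X ^ l + ofRevCoeffs fun i => f (MvPolynomial.X (Sum.inl i)) := by
  rw [pUniv_eq, Polynomial.map_add, Polynomial.map_pow, map_X, map_ofRevCoeffs]

/-- The numerator of `∑ s, h_s / (x - z_s)` for indeterminate `h_s`. -/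
def residueNum (l : ℕ) {n : ℕ} (z : Fin n → ℂ) : (MvPolynomial (Fin l ⊕ Fin n) ℂ)[X] :=
  partialFractionNum (fun s => MvPolynomial.C (z s)) fun s => MvPolynomial.X (Sum.inr s)

lemma TUniv_eq (n l : ℕ) (m z : Fin n → ℂ) : TUniv n l m z =
    secondOrder ((∏ s, (X - C (z s))).map MvPolynomial.C)
      ((partialFractionNum z m).map MvPolynomial.C) (residueNum l z) (pUniv n l) := by
  rw [map_partialFractionNum, Polynomial.map_prod]
  simp only [Polynomial.map_sub, map_X, map_C]
  rfl

/-- The family `operatorUniv` with leading coefficients given by the points `z` and the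
exponents `m`. -/
def reducedUniv (k l : ℕ) (m z : Fin (k + 2) → ℂ) : (MvPolynomial (Fin l ⊕ Fin k) ℂ)[X] :=
  operatorUniv k l (l * (∑ s, m s + 1 - l)) (∏ s, (X - C (z s))) (partialFractionNum z m)

/-- The ideal generated by the coefficients of `reducedUniv`. -/
def reducedIdeal (k l : ℕ) (m z : Fin (k + 2) → ℂ) : Ideal (MvPolynomial (Fin l ⊕ Fin k) ℂ) :=
  Ideal.span (Set.range fun j : Fin (k + l) => (reducedUniv k l m z).coeff j)

/-- Substitution of the values of the generic potential for the residues. -/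
def toReduced (k l : ℕ) (c : ℂ) (z : Fin (k + 2) → ℂ) :
    MvPolynomial (Fin l ⊕ Fin (k + 2)) ℂ →ₐ[ℂ] MvPolynomial (Fin l ⊕ Fin k) ℂ :=
  MvPolynomial.aeval (Sum.elim (fun i => MvPolynomial.X (Sum.inl i)) fun s =>
    (potentialUniv k l c).eval (MvPolynomial.C (z s)) *
      MvPolynomial.C (∏ r ∈ Finset.univ.erase s, (z s - z r))⁻¹)

/-- Substitution of the coefficients of `residueNum` for those of the generic potential. -/
def ofReduced (k l : ℕ) (z : Fin (k + 2) → ℂ) :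
    MvPolynomial (Fin l ⊕ Fin k) ℂ →ₐ[ℂ] MvPolynomial (Fin l ⊕ Fin (k + 2)) ℂ :=
  MvPolynomial.aeval (Sum.elim (fun i => MvPolynomial.X (Sum.inl i)) fun i =>
    (residueNum l z).coeff (k - 1 - i))

variable {k l : ℕ} {m z : Fin (k + 2) → ℂ} {c : ℂ}

lemma prod_erase_sub_ne_zero {n : ℕ} {z : Fin n → ℂ} (hz : Function.Injective z) (s : Fin n) :
    ∏ r ∈ Finset.univ.erase s, (z s - z r) ≠ 0 :=
  Finset.prod_ne_zero_iff.mpr fun _ hr =>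
    sub_ne_zero.mpr fun h => Finset.ne_of_mem_erase hr (hz h).symm

lemma map_toReduced_residueNum (hz : Function.Injective z) :
    (residueNum l z).map (toReduced k l c z : _ →+* MvPolynomial (Fin l ⊕ Fin k) ℂ) =
      potentialUniv k l c := by
  rw [residueNum, map_partialFractionNum]
  refine partialFractionNum_eq (k := k + 1) ?_ ((natDegree_potentialUniv_le k l c).trans
    (Nat.le_succ k)) fun s => ?_
  · intro s t hst
    simp only [toReduced, RingHom.coe_coe, MvPolynomial.aeval_C] at hst
    exact hz (MvPolynomial.C_injective _ _ hst)
  · have h : (∏ r ∈ Finset.univ.erase s, (MvPolynomial.C (z s) - MvPolynomial.C (z r)) :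
        MvPolynomial (Fin l ⊕ Fin k) ℂ) =
        MvPolynomial.C (∏ r ∈ Finset.univ.erase s, (z s - z r)) := by
      simp
    simp only [toReduced, RingHom.coe_coe, MvPolynomial.aeval_C, MvPolynomial.aeval_X,
      Sum.elim_inr, MvPolynomial.algebraMap_eq]
    rw [h, mul_assoc, ← MvPolynomial.C_mul, inv_mul_cancel₀ (prod_erase_sub_ne_zero hz s),
      MvPolynomial.C_1, mul_one]

lemma toReduced_residueNum_coeff (hz : Function.Injective z) (j : ℕ) :
    toReduced k l c z ((residueNum l z).coeff j) = (potentialUniv k l c).coeff j := by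
  rw [← map_toReduced_residueNum hz, coeff_map]
  rfl

lemma map_toReduced_TUniv (hz : Function.Injective z) :
    (TUniv (k + 2) l m z).map (toReduced k l (l * (∑ s, m s + 1 - l)) z :
      _ →+* MvPolynomial (Fin l ⊕ Fin k) ℂ) = reducedUniv k l m z := by
  have hC : (toReduced k l (l * (∑ s, m s + 1 - l)) z :
      MvPolynomial (Fin l ⊕ Fin (k + 2)) ℂ →+* MvPolynomial (Fin l ⊕ Fin k) ℂ).comp
      MvPolynomial.C = MvPolynomial.C :=
    (toReduced k l (l * (∑ s, m s + 1 - l)) z).comp_algebraMap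
  have hp : (fun i : Fin l => (toReduced k l (l * (∑ s, m s + 1 - l)) z :
      MvPolynomial (Fin l ⊕ Fin (k + 2)) ℂ →+* MvPolynomial (Fin l ⊕ Fin k) ℂ)
        (MvPolynomial.X (Sum.inl i))) =
      fun i => MvPolynomial.X (Sum.inl i) := by
    ext1 i
    simp [toReduced]
  rw [TUniv_eq, map_secondOrder, Polynomial.map_map, Polynomial.map_map, hC,
    map_toReduced_residueNum hz, map_pUniv, hp]
  rfl

lemma coeff_residueNum_succ : (residueNum l z).coeff (k + 1) = ∑ s, MvPolynomial.X (Sum.inr s) :=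
  coeff_partialFractionNum _ _

lemma coeff_residueNum : (residueNum l z).coeff k = ∑ s, MvPolynomial.C (z s) *
    MvPolynomial.X (Sum.inr s) - (∑ s, MvPolynomial.C (z s)) * ∑ s, MvPolynomial.X (Sum.inr s) :=
  coeff_partialFractionNum_pred _ _

lemma coeff_reducedUniv_eq_zero {j : ℕ} (hj : k + l ≤ j) :
    (reducedUniv k l m z).coeff j = 0 :=
  coeff_operatorUniv_eq_zero (monic_prod_X_sub_C _ _)
    (by rw [natDegree_finsetProd_X_sub_C_eq_card, Finset.card_univ, Fintype.card_fin])
    (natDegree_partialFractionNum_le _ _) (coeff_partialFractionNum _ _) hj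

lemma idealD_le_comap_toReduced (hz : Function.Injective z) : idealD (k + 2) l m z ≤
    (reducedIdeal k l m z).comap (toReduced k l (l * (∑ s, m s + 1 - l)) z) := by
  have hs : toReduced k l (l * (∑ s, m s + 1 - l)) z (∑ s, MvPolynomial.X (Sum.inr s)) = 0 := by
    rw [← coeff_residueNum_succ (z := z), toReduced_residueNum_coeff hz]
    exact coeff_eq_zero_of_natDegree_lt (Nat.lt_succ_of_le (natDegree_potentialUniv_le _ _ _))
  rw [idealD, Ideal.span_le]
  rintro _ ((rfl | rfl) | ⟨j, rfl⟩)
  · simp only [SetLike.mem_coe, Ideal.mem_comap, hs, zero_mem]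
  · have h := toReduced_residueNum_coeff (l := l) (c := l * (∑ s, m s + 1 - l)) hz k
    rw [coeff_residueNum, map_sub, map_mul, hs, mul_zero, sub_zero, coeff_potentialUniv_self] at h
    rw [SetLike.mem_coe, Ideal.mem_comap, map_sub, h, ← MvPolynomial.algebraMap_eq,
      ← MvPolynomial.algebraMap_eq, AlgHom.commutes, sub_self]
    exact zero_mem _
  · rw [SetLike.mem_coe, Ideal.mem_comap]
    have h : toReduced k l (l * (∑ s, m s + 1 - l)) z ((TUniv (k + 2) l m z).coeff j) =
        (reducedUniv k l m z).coeff j := by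
      rw [← map_toReduced_TUniv hz, coeff_map]
      rfl
    simp only [h]
    rcases lt_or_ge j (k + l) with hj | hj
    · exact Ideal.subset_span ⟨⟨j, hj⟩, rfl⟩
    · rw [coeff_reducedUniv_eq_zero hj]
      exact zero_mem _

lemma mk_sum_X_eq_zero : Ideal.Quotient.mk (idealD (k + 2) l m z)
    (∑ s, MvPolynomial.X (Sum.inr s)) = 0 :=
  Ideal.Quotient.eq_zero_iff_mem.mpr (Ideal.subset_span (Or.inl (Or.inl rfl)))

lemma map_ofReduced_potentialUniv :
    (potentialUniv k l (l * (∑ s, m s + 1 - l))).map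
      ((Ideal.Quotient.mk (idealD (k + 2) l m z)).comp
        (ofReduced k l z : _ →+* MvPolynomial (Fin l ⊕ Fin (k + 2)) ℂ)) =
      (residueNum l z).map (Ideal.Quotient.mk (idealD (k + 2) l m z)) := by
  ext j
  rw [coeff_map, coeff_map, RingHom.comp_apply, RingHom.coe_coe]
  rcases lt_trichotomy j k with hj | rfl | hj
  · obtain ⟨i, rfl⟩ : ∃ i : Fin k, j = k - 1 - i := ⟨⟨k - 1 - j, by omega⟩, by simp only; omega⟩
    rw [potentialUniv, coeff_add, coeff_C_mul, coeff_X_pow, if_neg (by omega), mul_zero, zero_add,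
      coeff_ofRevCoeffs]
    simp [ofReduced]
  · rw [coeff_potentialUniv_self, coeff_residueNum, map_sub, map_mul _ (∑ s, MvPolynomial.C _),
      mk_sum_X_eq_zero, mul_zero, sub_zero, ← MvPolynomial.algebraMap_eq, AlgHom.commutes]
    refine (Ideal.Quotient.eq.mpr ?_).symm
    exact Ideal.subset_span (Or.inl (Or.inr rfl))
  · rw [coeff_eq_zero_of_natDegree_lt ((natDegree_potentialUniv_le _ _ _).trans_lt hj), map_zero,
      map_zero]
    rcases (Nat.succ_le_of_lt hj).eq_or_lt with rfl | hj
    · exact (congrArg _ coeff_residueNum_succ).trans mk_sum_X_eq_zero |>.symm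
    · rw [residueNum, coeff_eq_zero_of_natDegree_lt
        ((natDegree_partialFractionNum_le _ _).trans_lt hj),
        map_zero]

lemma reducedIdeal_le_comap_ofReduced :
    reducedIdeal k l m z ≤ (idealD (k + 2) l m z).comap (ofReduced k l z) := by
  have h : (reducedUniv k l m z).map ((Ideal.Quotient.mk (idealD (k + 2) l m z)).comp
      (ofReduced k l z : _ →+* MvPolynomial (Fin l ⊕ Fin (k + 2)) ℂ)) =
      (TUniv (k + 2) l m z).map (Ideal.Quotient.mk (idealD (k + 2) l m z)) := by
    have hC : (ofReduced k l z : MvPolynomial (Fin l ⊕ Fin k) ℂ →+*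
        MvPolynomial (Fin l ⊕ Fin (k + 2)) ℂ).comp MvPolynomial.C = MvPolynomial.C :=
      (ofReduced k l z).comp_algebraMap
    have hp : (fun i : Fin l => ((Ideal.Quotient.mk (idealD (k + 2) l m z)).comp
        (ofReduced k l z : MvPolynomial (Fin l ⊕ Fin k) ℂ →+*
          MvPolynomial (Fin l ⊕ Fin (k + 2)) ℂ)) (MvPolynomial.X (Sum.inl i))) =
        fun i => Ideal.Quotient.mk (idealD (k + 2) l m z) (MvPolynomial.X (Sum.inl i)) := by
      ext1 i
      simp [ofReduced]
    rw [TUniv_eq, reducedUniv, operatorUniv, map_secondOrder, map_secondOrder,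
      map_ofReduced_potentialUniv, map_pUniv, map_pUniv, hp]
    simp only [Polynomial.map_map, RingHom.comp_assoc, hC]
  rw [reducedIdeal, Ideal.span_le]
  rintro _ ⟨j, rfl⟩
  have hj := congrArg (coeff · (j : ℕ)) h
  simp only [coeff_map] at hj
  rw [SetLike.mem_coe, Ideal.mem_comap, ← Ideal.Quotient.eq_zero_iff_mem]
  exact hj.trans (Ideal.Quotient.eq_zero_iff_mem.mpr (Ideal.subset_span (Or.inr ⟨j, rfl⟩)))

/-- Eliminating two of the residues from the algebra `A_D(z)`. -/
def quotientIdealDEquiv (hz : Function.Injective z) :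
    (MvPolynomial (Fin l ⊕ Fin (k + 2)) ℂ ⧸ idealD (k + 2) l m z) ≃ₐ[ℂ]
      MvPolynomial (Fin l ⊕ Fin k) ℂ ⧸ reducedIdeal k l m z :=
  AlgEquiv.ofAlgHom
    (Ideal.quotientMapₐ _ (toReduced k l (l * (∑ s, m s + 1 - l)) z)
      (idealD_le_comap_toReduced hz))
    (Ideal.quotientMapₐ _ (ofReduced k l z) reducedIdeal_le_comap_ofReduced)
    (by
      apply Ideal.Quotient.algHom_ext
      apply MvPolynomial.algHom_ext
      rintro (i | i)
      · simp [toReduced, ofReduced]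
      · simp only [AlgHom.comp_apply, Ideal.Quotient.mkₐ_eq_mk, Ideal.quotient_map_mkₐ,
          AlgHom.id_apply]
        congr 1
        rw [ofReduced, MvPolynomial.aeval_X, Sum.elim_inr, toReduced_residueNum_coeff hz,
          potentialUniv, coeff_add, coeff_C_mul, coeff_X_pow, if_neg (by omega), mul_zero,
          zero_add, coeff_ofRevCoeffs])
    (by
      apply Ideal.Quotient.algHom_ext
      apply MvPolynomial.algHom_ext
      rintro (i | s)
      · simp [toReduced, ofReduced]
      · simp only [AlgHom.comp_apply, Ideal.Quotient.mkₐ_eq_mk, Ideal.quotient_map_mkₐ,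
          AlgHom.id_apply]
        have h := congrArg (eval (Ideal.Quotient.mk (idealD (k + 2) l m z)
          (MvPolynomial.C (z s)))) (map_ofReduced_potentialUniv (k := k) (l := l) (m := m) (z := z))
        rw [residueNum, eval_map_apply, eval_partialFractionNum (fun s => MvPolynomial.C (z s))
          (fun s => MvPolynomial.X (Sum.inr s)) s] at h
        have hC : Ideal.Quotient.mk (idealD (k + 2) l m z) (MvPolynomial.C (z s)) =
            ((Ideal.Quotient.mk (idealD (k + 2) l m z)).comp
              (ofReduced k l z : MvPolynomial (Fin l ⊕ Fin k) ℂ →+*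
                MvPolynomial (Fin l ⊕ Fin (k + 2)) ℂ)) (MvPolynomial.C (z s)) :=
          congrArg _ ((ofReduced k l z).commutes (z s)).symm
        rw [hC, eval_map_apply, RingHom.comp_apply, RingHom.coe_coe] at h
        have hu : (∏ r ∈ Finset.univ.erase s, (MvPolynomial.C (z s) - MvPolynomial.C (z r)) :
            MvPolynomial (Fin l ⊕ Fin (k + 2)) ℂ) =
            MvPolynomial.C (∏ r ∈ Finset.univ.erase s, (z s - z r)) := by
          simp
        have hI (a : ℂ) : ofReduced k l z (MvPolynomial.C a) = MvPolynomial.C a :=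
          (ofReduced k l z).commutes a
        rw [toReduced, MvPolynomial.aeval_X, Sum.elim_inr, map_mul, map_mul, h, hI, ← map_mul,
          mul_assoc, hu, ← MvPolynomial.C_mul, mul_inv_cancel₀ (prod_erase_sub_ne_zero hz s),
          MvPolynomial.C_1, mul_one])

lemma finrank_quotient_idealD (hsep : Separating m l) (hz : Function.Injective z) :
    FiniteDimensional ℂ (MvPolynomial (Fin l ⊕ Fin (k + 2)) ℂ ⧸ idealD (k + 2) l m z) ∧
      Module.finrank ℂ (MvPolynomial (Fin l ⊕ Fin (k + 2)) ℂ ⧸ idealD (k + 2) l m z) =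
      Module.finrank ℂ (MvPolynomial (Fin l ⊕ Fin k) ℂ ⧸ Ideal.span (Set.range
        fun j : Fin (k + l) => (operatorUniv k l (l * (∑ s, m s + 1 - l)) (X ^ (k + 2))
          (C (∑ s, m s) * X ^ (k + 1))).coeff j)) := by
  obtain ⟨hfin, hrank⟩ := finrank_quotient_operatorUniv (k := k) hsep
    (monic_prod_X_sub_C z Finset.univ)
    (by rw [natDegree_finsetProd_X_sub_C_eq_card, Finset.card_univ, Fintype.card_fin])
    (natDegree_partialFractionNum_le z m) (coeff_partialFractionNum z m)
  have e := (quotientIdealDEquiv (k := k) (l := l) (m := m) hz).toLinearEquiv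
  have : FiniteDimensional ℂ (MvPolynomial (Fin l ⊕ Fin k) ℂ ⧸ reducedIdeal k l m z) := hfin
  exact ⟨Module.Finite.equiv e.symm, e.finrank_eq.trans hrank⟩

end Reduction

section OnePoint

open Polynomial

lemma TUniv_one_zero (m z : Fin 1 → ℂ) :
    TUniv 1 0 m z = C (MvPolynomial.X (Sum.inr 0)) := by
  simp [TUniv, pUniv]

lemma idealD_one_zero (m z : Fin 1 → ℂ) :
    idealD 1 0 m z = Ideal.span {MvPolynomial.X (Sum.inr 0)} := by
  refine le_antisymm (Ideal.span_le.mpr ?_) (Ideal.span_le.mpr ?_)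
  · rintro _ ((rfl | rfl) | ⟨j, rfl⟩)
    · simp
    · simpa using Ideal.mul_mem_left _ _ (Ideal.mem_span_singleton_self _)
    · simp only [TUniv_one_zero, coeff_C]
      split_ifs
      · exact Ideal.mem_span_singleton_self _
      · exact zero_mem _
  · rintro _ rfl
    exact Ideal.subset_span (Or.inr ⟨0, by simp [TUniv_one_zero]⟩)

lemma idealD_one_eq_top {l : ℕ} (hl : l ≠ 0) {m z : Fin 1 → ℂ} (hsep : Separating m l) :
    idealD 1 l m z = ⊤ := by
  have hc : (l : ℂ) * (∑ s, m s + 1 - l) ≠ 0 := by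
    refine mul_ne_zero (Nat.cast_ne_zero.mpr hl) ?_
    have := hsep l (Nat.one_le_iff_ne_zero.mpr hl) le_rfl
    intro h
    exact this (by linear_combination h)
  have h₁ : ∑ s, MvPolynomial.X (Sum.inr s) ∈ idealD 1 l m z :=
    Ideal.subset_span (Or.inl (Or.inl rfl))
  have h₂ : (∑ s, MvPolynomial.C (z s) * MvPolynomial.X (Sum.inr s)) -
      MvPolynomial.C ((l : ℂ) * ((∑ s, m s) + 1 - l)) ∈ idealD 1 l m z :=
    Ideal.subset_span (Or.inl (Or.inr rfl))
  refine Ideal.eq_top_of_isUnit_mem _ ?_ ((isUnit_iff_ne_zero.mpr hc).map MvPolynomial.C)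
  have h := sub_mem (Ideal.mul_mem_left _ (MvPolynomial.C (z 0)) h₁) h₂
  simpa only [Fin.sum_univ_one, sub_sub_cancel] using h

lemma finiteDimensional_quotient_idealD_one_zero (m z : Fin 1 → ℂ) :
    FiniteDimensional ℂ (MvPolynomial (Fin 0 ⊕ Fin 1) ℂ ⧸ idealD 1 0 m z) := by
  rw [idealD_one_zero]
  refine Module.Finite.of_surjective (Algebra.linearMap ℂ _) fun q => ?_
  obtain ⟨p, rfl⟩ := Ideal.Quotient.mk_surjective q
  induction p using MvPolynomial.induction_on with
  | C a => exact ⟨a, rfl⟩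
  | add p q hp hq =>
    obtain ⟨a, ha⟩ := hp
    obtain ⟨b, hb⟩ := hq
    exact ⟨a + b, by rw [map_add, map_add, ha, hb]⟩
  | mul_X p i hp =>
    refine ⟨0, ?_⟩
    rcases i with i | i
    · exact i.elim0
    · rw [Subsingleton.elim i 0, map_zero, eq_comm, Ideal.Quotient.eq_zero_iff_mem]
      exact Ideal.mul_mem_left _ _ (Ideal.mem_span_singleton_self _)

end OnePoint

theorem statement_5 {n : ℕ} (hn : 1 ≤ n) (m : Fin n → ℂ) (l : ℕ)
    (hsep : Separating m l) :
    (∀ z : Fin n → ℂ, Function.Injective z →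
      FiniteDimensional ℂ (MvPolynomial (Fin l ⊕ Fin n) ℂ ⧸ idealD n l m z)) ∧
    (∀ z z' : Fin n → ℂ, Function.Injective z → Function.Injective z' →
      Module.finrank ℂ (MvPolynomial (Fin l ⊕ Fin n) ℂ ⧸ idealD n l m z) =
      Module.finrank ℂ (MvPolynomial (Fin l ⊕ Fin n) ℂ ⧸ idealD n l m z')) := by
  obtain rfl | ⟨k, rfl⟩ : n = 1 ∨ ∃ k, n = k + 2 :=
    hn.eq_or_lt.imp Eq.symm fun h => ⟨n - 2, by omega⟩
  · rcases eq_or_ne l 0 with rfl | hl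
    · refine ⟨fun z _ => finiteDimensional_quotient_idealD_one_zero m z, fun z z' _ _ => ?_⟩
      rw [idealD_one_zero, idealD_one_zero]
    · refine ⟨fun z _ => ?_, fun z z' _ _ => ?_⟩
      · rw [idealD_one_eq_top hl hsep]
        infer_instance
      · rw [idealD_one_eq_top hl hsep, idealD_one_eq_top hl hsep]
  · exact ⟨fun z hz => (finrank_quotient_idealD hsep hz).1, fun z z' hz hz' =>
      (finrank_quotient_idealD hsep hz).2.trans (finrank_quotient_idealD hsep hz').2.symm⟩

end
end

section
/- Assume z_1,…,z_n are distinct real numbers, m_1,…,m_n are nonnegative integers, and 2l ≤ ∑_s m_s; set l̃ = ∑_s m_s + 1 − l. Let a_1,…,a_l and ã_1,…,ã_{l̃−l−1},ã_{l̃−l+1},…,ã_{l̃} and h_1,…,h_n be polynomial indeterminates, p(x,a) = x^l + a_1x^{l−1} + … + a_l, and p̃(x,ã) = x^{l̃} + ã_1x^{l̃−1} + … + ã_{l̃−l−1}x^{l+1} + ã_{l̃−l+1}x^{l−1} + … + ã_{l̃} (the coefficient of x^l being omitted). Let I_P be the ideal of ℂ[ã,a,h] generated by ∑_s h_s, by ∑_s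 z_s h_s − l(∑_s m_s + 1 − l), and by all coefficients with respect to x of T_h(p(x,a)) and of T_h(p̃(x,ã)). Then the algebra A_P = ℂ[ã,a,h]/I_P has no nonzero nilpotent elements; equivalently, all points of the corresponding intersection of Schubert cycles C_{z_1,Λ^{(1)}} ∩ … ∩ C_{z_n,Λ^{(n)}} ∩ C_{∞,Λ^{(∞)}} have multiplicity one. -/
noncomputable section

/-- l̃ = ∑ m_s + 1 − l. -/
def ltilde {n : ℕ} (m : Fin n → ℕ) (l : ℕ) : ℕ := (∑ s, m s) + 1 - l

/-- The indeterminates: `Sum.inl i` is the coefficient a_{i+1} of x^{l-1-i} in p,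
`Sum.inr (Sum.inl k)` is the coefficient ã of x^k (k ≠ l) in p̃, and
`Sum.inr (Sum.inr s)` is h_s. -/
abbrev VarsP {n : ℕ} (m : Fin n → ℕ) (l : ℕ) : Type :=
  Fin l ⊕ ({k : Fin (ltilde m l) // (k : ℕ) ≠ l} ⊕ Fin n)

/-- The operator T_h with indeterminate h_s, applied to a polynomial with
indeterminate coefficients. -/
def TopP {n : ℕ} (m : Fin n → ℕ) (l : ℕ) (z : Fin n → ℝ)
    (p : Polynomial (MvPolynomial (VarsP m l) ℂ)) :
    Polynomial (MvPolynomial (VarsP m l) ℂ) :=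
  (∏ s, (Polynomial.X - Polynomial.C (MvPolynomial.C ((z s : ℂ))))) *
      Polynomial.derivative (Polynomial.derivative p)
    - (∑ s, Polynomial.C (MvPolynomial.C ((m s : ℂ))) *
        ∏ r ∈ Finset.univ.erase s,
          (Polynomial.X - Polynomial.C (MvPolynomial.C ((z r : ℂ))))) *
      Polynomial.derivative p
    + (∑ s, Polynomial.C (MvPolynomial.X (Sum.inr (Sum.inr s))) *
        ∏ r ∈ Finset.univ.erase s,
          (Polynomial.X - Polynomial.C (MvPolynomial.C ((z r : ℂ))))) * p

/-- p(x,a) = x^l + a_1 x^{l-1} + … + a_l. -/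
def pP {n : ℕ} (m : Fin n → ℕ) (l : ℕ) : Polynomial (MvPolynomial (VarsP m l) ℂ) :=
  Polynomial.X ^ l +
    ∑ i : Fin l, Polynomial.C (MvPolynomial.X (Sum.inl i)) * Polynomial.X ^ (l - 1 - (i : ℕ))

/-- p̃(x,ã) = x^l̃ + ã_1 x^{l̃-1} + … (the coefficient of x^l being omitted). -/
def ptP {n : ℕ} (m : Fin n → ℕ) (l : ℕ) : Polynomial (MvPolynomial (VarsP m l) ℂ) :=
  Polynomial.X ^ ltilde m l +
    ∑ k : {k : Fin (ltilde m l) // (k : ℕ) ≠ l},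
      Polynomial.C (MvPolynomial.X (Sum.inr (Sum.inl k))) * Polynomial.X ^ ((k : Fin (ltilde m l)) : ℕ)

/-- The ideal I_P. -/
def idealP {n : ℕ} (m : Fin n → ℕ) (l : ℕ) (z : Fin n → ℝ) :
    Ideal (MvPolynomial (VarsP m l) ℂ) :=
  Ideal.span
    ({∑ s, MvPolynomial.X (Sum.inr (Sum.inr s)),
      (∑ s, MvPolynomial.C ((z s : ℂ)) * MvPolynomial.X (Sum.inr (Sum.inr s))) -
        MvPolynomial.C ((l : ℂ) * ((∑ s, (m s : ℂ)) + 1 - l))} ∪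
     Set.range (fun k : ℕ => (TopP m l z (pP m l)).coeff k) ∪
     Set.range (fun k : ℕ => (TopP m l z (ptP m l)).coeff k))

section RemainderMatrix

open Polynomial Matrix

variable {R : Type*} [CommRing R]

theorem det_updateCol_add_vecMulVec {ι : Type*} [Fintype ι] [DecidableEq ι]
    (N : Matrix ι ι R) (u σ : ι → R) (i : ι) :
    ((N + vecMulVec u σ).updateCol i u).det = (N.updateCol i u).det := by
  rw [← det_transpose, ← det_transpose (N.updateCol i u)]
  refine det_eq_of_forall_row_eq_smul_add_const (Function.update σ i 0) i (by simp) ?_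
  intro a b
  by_cases h : a = i
  · subst h; simp
  · simp [h, vecMulVec_apply, mul_comm]

theorem adjugate_add_vecMulVec_mulVec {ι : Type*} [Fintype ι] [DecidableEq ι]
    (N : Matrix ι ι R) (u σ : ι → R) :
    (N + vecMulVec u σ).adjugate *ᵥ u = N.adjugate *ᵥ u := by
  rw [← cramer_eq_adjugate_mulVec, ← cramer_eq_adjugate_mulVec]
  ext i
  rw [cramer_apply, cramer_apply, det_updateCol_add_vecMulVec]

theorem det_add_vecMulVec_eq {ι : Type*} [Fintype ι] [DecidableEq ι]
    (N : Matrix ι ι R) (u σ : ι → R) :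
    (N + vecMulVec u σ).det = N.det + σ ⬝ᵥ (N.adjugate *ᵥ u) := by
  have key : ∀ s : Finset ι, (N + vecMulVec u (fun i => if i ∈ s then σ i else 0)).det =
      N.det + ∑ i ∈ s, σ i * (N.updateCol i u).det := by
    intro s
    induction s using Finset.induction_on with
    | empty =>
      have : vecMulVec u (fun _ : ι => (0 : R)) = 0 := by
        ext a b; simp [vecMulVec_apply]
      simp [this]
    | insert i s hi ih =>
      have hcol : N + vecMulVec u (fun k => if k ∈ insert i s then σ k else 0) =
          (N + vecMulVec u (fun k => if k ∈ s then σ k else 0)).updateCol i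
            ((N + vecMulVec u (fun k => if k ∈ s then σ k else 0)).col i + σ i • u) := by
        ext a b
        by_cases h : b = i
        · subst h; simp [vecMulVec_apply, hi, mul_comm]
        · simp [vecMulVec_apply, h]
      rw [hcol, det_updateCol_add, det_updateCol_smul, det_updateCol_add_vecMulVec,
        Finset.sum_insert hi]
      have : (N + vecMulVec u (fun k => if k ∈ s then σ k else 0)).updateCol i
          ((N + vecMulVec u (fun k => if k ∈ s then σ k else 0)).col i) =
          N + vecMulVec u (fun k => if k ∈ s then σ k else 0) := by
        ext a b
        by_cases h : b = i
        · subst h; simp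
        · simp [h]
      rw [this, ih]
      ring
  have := key Finset.univ
  simp only [Finset.mem_univ, if_true] at this
  rw [this, ← cramer_eq_adjugate_mulVec]
  simp [dotProduct, cramer_apply]

/-- The polynomial with coefficient vector `v`. -/
def polyOf {l : ℕ} (v : Fin l → R) : R[X] := ∑ i : Fin l, monomial (i : ℕ) (v i)

/-- The vector of the first `l` coefficients of `f`. -/
def vecOf (l : ℕ) : R[X] →ₗ[R] (Fin l → R) :=
  LinearMap.pi fun i => lcoeff R (i : ℕ)

@[simp] theorem vecOf_apply (l : ℕ) (f : R[X]) (i : Fin l) : vecOf l f i = f.coeff i := rfl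

theorem polyOf_add {l : ℕ} (v w : Fin l → R) : polyOf (v + w) = polyOf v + polyOf w := by
  simp [polyOf, Finset.sum_add_distrib]

theorem polyOf_smul {l : ℕ} (c : R) (v : Fin l → R) : polyOf (c • v) = c • polyOf v := by
  simp [polyOf, Finset.smul_sum, smul_monomial]

theorem polyOf_zero {l : ℕ} : polyOf (0 : Fin l → R) = 0 := by
  simp [polyOf]

theorem polyOf_sum {l : ℕ} {ι : Type*} (s : Finset ι) (v : ι → Fin l → R) :
    polyOf (∑ i ∈ s, v i) = ∑ i ∈ s, polyOf (v i) := by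
  classical
  induction s using Finset.induction_on with
  | empty => simp [polyOf_zero]
  | insert a s ha ih => rw [Finset.sum_insert ha, Finset.sum_insert ha, polyOf_add, ih]

theorem degree_polyOf_lt {l : ℕ} (v : Fin l → R) : (polyOf v).degree < l := by
  unfold polyOf
  refine lt_of_le_of_lt (degree_sum_le _ _) ?_
  rw [Finset.sup_lt_iff (by exact WithBot.bot_lt_coe l)]
  intro i _
  exact lt_of_le_of_lt (degree_monomial_le _ _) (by exact_mod_cast i.2)

theorem coeff_polyOf {l : ℕ} (v : Fin l → R) (i : Fin l) : (polyOf v).coeff i = v i := by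
  simp only [polyOf, finsetSum_coeff, coeff_monomial]
  rw [Finset.sum_eq_single i]
  · simp
  · intro b _ hb
    rw [if_neg (fun h => hb (Fin.ext h))]
  · simp

theorem polyOf_vecOf {l : ℕ} {f : R[X]} (hf : f.degree < l) : polyOf (vecOf l f) = f := by
  ext k
  by_cases hk : k < l
  · exact coeff_polyOf (vecOf l f) ⟨k, hk⟩
  · have h1 : (l : WithBot ℕ) ≤ k := by exact_mod_cast not_lt.1 hk
    rw [coeff_eq_zero_of_degree_lt (lt_of_lt_of_le hf h1),
      coeff_eq_zero_of_degree_lt (lt_of_lt_of_le (degree_polyOf_lt _) h1)]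

theorem vecOf_polyOf {l : ℕ} (v : Fin l → R) : vecOf l (polyOf v) = v := by
  ext i; exact coeff_polyOf v i

/-- The matrix of `f ↦ T f mod d` on polynomials of degree less than `l`. -/
def remMatrix (T : R[X] →ₗ[R] R[X]) (l : ℕ) (d : R[X]) : Matrix (Fin l) (Fin l) R :=
  Matrix.of fun i k => (T (X ^ (k : ℕ)) %ₘ d).coeff i

theorem linearMap_polyOf {M : Type*} [AddCommGroup M] [Module R M] (T : R[X] →ₗ[R] M) {l : ℕ}
    (v : Fin l → R) : T (polyOf v) = ∑ k : Fin l, v k • T (X ^ (k : ℕ)) := by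
  simp only [polyOf, map_sum, ← smul_X_eq_monomial, map_smul]

theorem remMatrix_mulVec (T : R[X] →ₗ[R] R[X]) (l : ℕ) (d : R[X]) (v : Fin l → R) :
    remMatrix T l d *ᵥ v = vecOf l (T (polyOf v) %ₘ d) := by
  have h := linearMap_polyOf ((vecOf l) ∘ₗ (modByMonicHom d) ∘ₗ T) v
  simp only [LinearMap.comp_apply, modByMonicHom_apply] at h
  rw [h]
  ext i
  simp [remMatrix, mulVec, dotProduct, mul_comm]

theorem polyOf_remMatrix_mulVec [Nontrivial R] (T : R[X] →ₗ[R] R[X]) {l : ℕ} {d : R[X]}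
    (hd : d.Monic) (hdl : d.natDegree ≤ l) (v : Fin l → R) :
    polyOf (remMatrix T l d *ᵥ v) = T (polyOf v) %ₘ d := by
  rw [remMatrix_mulVec, polyOf_vecOf]
  refine lt_of_lt_of_le (degree_modByMonic_lt _ hd) ?_
  exact natDegree_le_iff_degree_le.1 hdl

theorem modByMonic_X_sub_C_mul [Nontrivial R] {w : R[X]} (hw : w.Monic) (y : R) (f : R[X]) :
    f %ₘ ((X - C y) * w) = f %ₘ w + C ((f /ₘ w).eval y) * w := by
  have hm : ((X - C y) * w).Monic := (monic_X_sub_C y).mul hw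
  refine (div_modByMonic_unique ((f /ₘ w) /ₘ (X - C y)) _ hm ⟨?_, ?_⟩).2
  · have h1 := modByMonic_add_div f w
    have h2 := modByMonic_add_div (f /ₘ w) (X - C y)
    rw [modByMonic_X_sub_C_eq_C_eval] at h2
    linear_combination h1 + w * h2
  · have hdeg : ((X - C y) * w).degree = 1 + w.degree := by
      rw [hw.degree_mul, degree_X_sub_C]
    have hlt : w.degree < ((X - C y) * w).degree := by
      rw [hdeg, degree_eq_natDegree hw.ne_zero]
      exact_mod_cast (by omega : w.natDegree < 1 + w.natDegree)
    refine lt_of_le_of_lt (degree_add_le _ _) (max_lt ?_ ?_)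
    · exact (degree_modByMonic_lt _ hw).trans hlt
    · rw [← smul_eq_C_mul]
      exact lt_of_le_of_lt (degree_smul_le _ _) hlt

theorem remMatrix_X_sub_C_mul [Nontrivial R] (T : R[X] →ₗ[R] R[X]) (l : ℕ) {w : R[X]}
    (hw : w.Monic) (y : R) :
    remMatrix T l ((X - C y) * w) = remMatrix T l w +
      vecMulVec (vecOf l w) (fun k : Fin l => (T (X ^ (k : ℕ)) /ₘ w).eval y) := by
  ext i k
  simp only [remMatrix, of_apply, modByMonic_X_sub_C_mul hw, Matrix.add_apply, vecMulVec_apply,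
    coeff_add, coeff_C_mul, vecOf_apply]
  ring

/-- The polynomial `v` with `T v` divisible by `w`, given by Cramer's rule. -/
def cramerPoly (T : R[X] →ₗ[R] R[X]) (l : ℕ) (w : R[X]) : R[X] :=
  polyOf ((remMatrix T l w).adjugate *ᵥ vecOf l w)

theorem divByMonic_linear (w f g : R[X]) (c : R) (hw : w.Monic) :
    (f + c • g) /ₘ w = f /ₘ w + c • (g /ₘ w) := by
  nontriviality R
  refine (div_modByMonic_unique _ (f %ₘ w + c • (g %ₘ w)) hw ⟨?_, ?_⟩).1
  · conv_rhs => rw [← modByMonic_add_div f w, ← modByMonic_add_div g w]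
    simp only [smul_add, mul_add, mul_smul_comm]
    ring
  · refine lt_of_le_of_lt (degree_add_le _ _) (max_lt (degree_modByMonic_lt _ hw) ?_)
    exact lt_of_le_of_lt (degree_smul_le _ _) (degree_modByMonic_lt _ hw)

/-- Division by a monic polynomial as a linear map. -/
def divByMonicHom {w : R[X]} (hw : w.Monic) : R[X] →ₗ[R] R[X] where
  toFun f := f /ₘ w
  map_add' f g := by simpa using divByMonic_linear w f g 1 hw
  map_smul' c f := by simpa using divByMonic_linear w 0 f c hw

theorem det_remMatrix_eq_zero [Nontrivial R] (T : R[X] →ₗ[R] R[X]) {l : ℕ} {w : R[X]}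
    (hw : w.Monic) (hwl : w.natDegree + 1 = l) : (remMatrix T l w).det = 0 := by
  refine det_eq_zero_of_row_eq_zero ⟨w.natDegree, by omega⟩ fun k => ?_
  refine coeff_eq_zero_of_degree_lt ?_
  have := degree_modByMonic_lt (T (X ^ (k : ℕ))) hw
  rwa [degree_eq_natDegree hw.ne_zero] at this

theorem exists_map_cramerPoly [Nontrivial R] (T : R[X] →ₗ[R] R[X]) {l : ℕ} {w : R[X]}
    (hw : w.Monic) (hwl : w.natDegree + 1 = l) :
    ∃ g, T (cramerPoly T l w) = w * g ∧
      ∀ y, g.eval y = (remMatrix T l ((X - C y) * w)).det := by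
  have h0 := det_remMatrix_eq_zero T hw hwl
  refine ⟨T (cramerPoly T l w) /ₘ w, ?_, fun y => ?_⟩
  · have h1 : T (cramerPoly T l w) %ₘ w = 0 := by
      rw [cramerPoly, ← polyOf_remMatrix_mulVec T hw (by omega), mulVec_mulVec, mul_adjugate, h0]
      simp [polyOf_zero]
    conv_lhs => rw [← modByMonic_add_div (T (cramerPoly T l w)) w, h1, zero_add]
  · rw [remMatrix_X_sub_C_mul T l hw, det_add_vecMulVec_eq, h0, zero_add]
    have h := linearMap_polyOf ((leval y) ∘ₗ (divByMonicHom hw) ∘ₗ T)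
      ((remMatrix T l w).adjugate *ᵥ vecOf l w)
    simp only [LinearMap.comp_apply, leval_apply, divByMonicHom, LinearMap.coe_mk,
      AddHom.coe_mk] at h
    rw [cramerPoly, h]
    simp [dotProduct, mul_comm]

theorem polyOf_adjugate_vecOf [Nontrivial R] (T : R[X] →ₗ[R] R[X]) {l : ℕ} {w : R[X]}
    (hw : w.Monic) (y : R) :
    polyOf ((remMatrix T l ((X - C y) * w)).adjugate *ᵥ vecOf l w) = cramerPoly T l w := by
  rw [remMatrix_X_sub_C_mul T l hw, adjugate_add_vecMulVec_mulVec, cramerPoly]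

theorem det_remMatrix_smul (T : R[X] →ₗ[R] R[X]) {l : ℕ} (d : R[X]) {u : R[X]}
    (hu : u.degree < l) :
    (remMatrix T l d).det • u = polyOf ((remMatrix T l d).adjugate *ᵥ vecOf l (T u %ₘ d)) := by
  have h := remMatrix_mulVec T l d (vecOf l u)
  rw [polyOf_vecOf hu] at h
  rw [← h, mulVec_mulVec, adjugate_mul, smul_mulVec, one_mulVec, polyOf_smul, polyOf_vecOf hu]

theorem det_remMatrix_mul_eval_eq_zero [Nontrivial R] (T : R[X] →ₗ[R] R[X]) {l : ℕ} {d : R[X]}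
    (hd : d.Monic) (hdl : d.natDegree = l) {y : R} {k : ℕ} (hk : k ≠ 0) (hyd : (X - C y) ^ k ∣ d)
    (hT : ∀ f, (X - C y) ^ k ∣ f → (X - C y) ^ k ∣ T f) {f : R[X]} (hf : T f = 0) :
    (remMatrix T l d).det * f.eval y = 0 := by
  set M := remMatrix T l d
  have hmod : ∀ g, (X - C y) ^ k ∣ g → (X - C y) ^ k ∣ g %ₘ d := by
    intro g hg
    rw [modByMonic_eq_sub_mul_div g d]
    exact dvd_sub hg (hyd.mul_right _)
  have hstab : ∀ v : Fin l → R, (X - C y) ^ k ∣ polyOf v → (X - C y) ^ k ∣ polyOf (M *ᵥ v) := by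
    intro v hv
    rw [polyOf_remMatrix_mulVec T hd hdl.le]
    exact hmod _ (hT _ hv)
  have hdeg : (f %ₘ d).degree < l := by
    have := degree_modByMonic_lt f hd
    rwa [degree_eq_natDegree hd.ne_zero, hdl] at this
  set v := vecOf l (f %ₘ d)
  have hMv : (X - C y) ^ k ∣ polyOf (M *ᵥ v) := by
    rw [polyOf_remMatrix_mulVec T hd hdl.le, polyOf_vecOf hdeg]
    refine hmod _ ?_
    rw [modByMonic_eq_sub_mul_div f d, map_sub, hf, zero_sub, dvd_neg]
    exact hT _ (hyd.mul_right _)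
  have hpoly : ∀ Q : R[X], (X - C y) ^ k ∣ polyOf ((aeval M Q) *ᵥ (M *ᵥ v)) := by
    intro Q
    induction Q using Polynomial.induction_on' with
    | add p q hp hq =>
      rw [map_add, add_mulVec, polyOf_add]
      exact dvd_add hp hq
    | monomial i a =>
      have hpow : ∀ i : ℕ, (X - C y) ^ k ∣ polyOf ((M ^ i) *ᵥ (M *ᵥ v)) := by
        intro i
        induction i with
        | zero => simpa using hMv
        | succ i ih => rw [pow_succ', ← mulVec_mulVec]; exact hstab _ ih
      rw [aeval_monomial, ← Algebra.smul_def, smul_mulVec, polyOf_smul, smul_eq_C_mul]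
      exact (hpow i).mul_left _
  have hCH := aeval_self_charpoly M
  rw [← divX_mul_X_add M.charpoly, map_add, map_mul, aeval_X, aeval_C,
    Algebra.algebraMap_eq_smul_one] at hCH
  have h2 := congrArg (fun N : Matrix (Fin l) (Fin l) R => polyOf (N *ᵥ v)) hCH
  simp only [add_mulVec, polyOf_add, smul_mulVec, one_mulVec, zero_mulVec, polyOf_zero,
    polyOf_smul, ← mulVec_mulVec] at h2
  have h3 : (X - C y) ^ k ∣ M.charpoly.coeff 0 • polyOf v := by
    rw [eq_neg_of_add_eq_zero_right h2, dvd_neg]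
    exact hpoly _
  have h4 : (X - C y) ∣ M.det • (f %ₘ d) := by
    rw [det_eq_sign_charpoly_coeff, mul_smul, ← polyOf_vecOf hdeg, smul_eq_C_mul]
    exact ((dvd_pow_self _ hk).trans h3).mul_left _
  have h5 : (X - C y) ∣ M.det • f := by
    conv_rhs => rw [← modByMonic_add_div f d, smul_add]
    refine dvd_add h4 ?_
    rw [smul_eq_C_mul]
    exact (((dvd_pow_self _ hk).trans hyd).mul_right _).mul_left _
  have := dvd_iff_isRoot.1 h5
  simpa using this

theorem map_det_remMatrix {S : Type*} [CommRing S] (φ : R →+* S) (T : R[X] →ₗ[R] R[X])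
    (T' : S[X] →ₗ[S] S[X]) (hT : ∀ f, (T f).map φ = T' (f.map φ)) (l : ℕ) {d : R[X]}
    (hd : d.Monic) :
    φ (remMatrix T l d).det = (remMatrix T' l (d.map φ)).det := by
  rw [RingHom.map_det]
  congr 1
  ext i k
  simp only [remMatrix, RingHom.mapMatrix_apply, Matrix.map_apply, Matrix.of_apply]
  rw [← coeff_map, map_modByMonic _ hd, hT]
  simp

end RemainderMatrix

section FuchsianOperator

open Polynomial

variable {R : Type*} [CommRing R] {ι : Type*} [Fintype ι] [DecidableEq ι]

/-- The product of all `X - z s`. -/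
def fullProd (z : ι → R) : R[X] := ∏ s, (X - C (z s))

/-- The product of the `X - z r` with `r ≠ s`. -/
def delProd (z : ι → R) (s : ι) : R[X] := ∏ r ∈ Finset.univ.erase s, (X - C (z r))

/-- The product of the `X - z t` with `t ≠ r, s`. -/
def delProd₂ (z : ι → R) (r s : ι) : R[X] :=
  ∏ t ∈ (Finset.univ.erase r).erase s, (X - C (z t))

theorem fullProd_eq (z : ι → R) (s : ι) : fullProd z = (X - C (z s)) * delProd z s :=
  (Finset.mul_prod_erase _ _ (Finset.mem_univ s)).symm

theorem delProd_eq (z : ι → R) {r s : ι} (h : r ≠ s) :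
    delProd z r = (X - C (z s)) * delProd₂ z r s :=
  (Finset.mul_prod_erase _ (fun t => X - C (z t))
    (Finset.mem_erase.2 ⟨h.symm, Finset.mem_univ s⟩)).symm

theorem delProd₂_comm (z : ι → R) (r s : ι) : delProd₂ z r s = delProd₂ z s r := by
  rw [delProd₂, delProd₂, Finset.erase_right_comm]

theorem delProd_mul_delProd (z : ι → R) {r s : ι} (h : r ≠ s) :
    delProd z r * delProd z s = fullProd z * delProd₂ z r s := by
  rw [fullProd_eq z s, delProd_eq z h]; ring

omit [DecidableEq ι] in
theorem monic_fullProd (z : ι → R) : (fullProd z).Monic :=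
  monic_prod_of_monic _ _ fun _ _ => monic_X_sub_C _

theorem monic_delProd (z : ι → R) (s : ι) : (delProd z s).Monic :=
  monic_prod_of_monic _ _ fun _ _ => monic_X_sub_C _

omit [DecidableEq ι] in
theorem natDegree_fullProd [Nontrivial R] (z : ι → R) :
    (fullProd z).natDegree = Fintype.card ι := by
  rw [fullProd, natDegree_prod_of_monic _ _ fun _ _ => monic_X_sub_C _]
  simp

theorem natDegree_delProd [Nontrivial R] (z : ι → R) (s : ι) :
    (delProd z s).natDegree + 1 = Fintype.card ι := by
  rw [← natDegree_fullProd z, fullProd_eq z s, (monic_X_sub_C _).natDegree_mul (monic_delProd z s)]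
  simp [add_comm]

theorem eval_delProd_ne (z : ι → R) {r s : ι} (h : r ≠ s) : (delProd z r).eval (z s) = 0 := by
  rw [delProd_eq z h]; simp

omit [DecidableEq ι] in
theorem map_fullProd {S : Type*} [CommRing S] (φ : R →+* S) (z : ι → R) :
    (fullProd z).map φ = fullProd (φ ∘ z) := by
  simp [fullProd, Polynomial.map_prod]

theorem map_delProd {S : Type*} [CommRing S] (φ : R →+* S) (z : ι → R) (s : ι) :
    (delProd z s).map φ = delProd (φ ∘ z) s := by
  simp [delProd, Polynomial.map_prod]

theorem map_delProd₂ {S : Type*} [CommRing S] (φ : R →+* S) (z : ι → R) (r s : ι) :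
    (delProd₂ z r s).map φ = delProd₂ (φ ∘ z) r s := by
  simp [delProd₂, Polynomial.map_prod]

/-- The linear combination of the `delProd z s` with coefficients `a s`. -/
def delComb (z a : ι → R) : R[X] := ∑ s, C (a s) * delProd z s

theorem map_delComb {S : Type*} [CommRing S] (φ : R →+* S) (z a : ι → R) :
    (delComb z a).map φ = delComb (φ ∘ z) (φ ∘ a) := by
  simp [delComb, Polynomial.map_sum, map_delProd]

theorem eval_delComb (z a : ι → R) (t : ι) :
    (delComb z a).eval (z t) = a t * (delProd z t).eval (z t) := by
  rw [delComb, eval_finsetSum, Finset.sum_eq_single t]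
  · simp
  · intro s _ hs; simp [eval_delProd_ne z hs]
  · simp

theorem degree_delComb_lt [Nontrivial R] (z a : ι → R) :
    (delComb z a).degree < Fintype.card ι := by
  rw [delComb]
  refine lt_of_le_of_lt (degree_sum_le _ _) ?_
  rw [Finset.sup_lt_iff (by exact WithBot.bot_lt_coe _)]
  intro s _
  rw [← smul_eq_C_mul]
  refine lt_of_le_of_lt (degree_smul_le _ _) ?_
  rw [degree_eq_natDegree (monic_delProd z s).ne_zero, ← natDegree_delProd z s]
  exact_mod_cast Nat.lt_succ_self _

theorem delComb_eq (z a : ι → R) (s : ι) :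
    ∃ q, delComb z a = C (a s) * delProd z s + (X - C (z s)) * q := by
  refine ⟨∑ r ∈ Finset.univ.erase s, C (a r) * delProd₂ z r s, ?_⟩
  rw [delComb, ← Finset.add_sum_erase _ _ (Finset.mem_univ s), Finset.mul_sum]
  congr 1
  refine Finset.sum_congr rfl fun r hr => ?_
  rw [delProd_eq z (Finset.ne_of_mem_erase hr)]
  ring

theorem X_mul_delComb (z a : ι → R) :
    X * delComb z a = C (∑ s, a s) * fullProd z + delComb z (fun s => a s * z s) := by
  simp only [delComb, Finset.mul_sum, map_sum, Finset.sum_mul, ← Finset.sum_add_distrib]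
  refine Finset.sum_congr rfl fun s _ => ?_
  rw [fullProd_eq z s, C_mul]
  ring

/-- The polynomial form of `d²/dx² - ∑ m_s/(x - z_s) d/dx + ∑ h_s/(x - z_s)`. -/
def fuchsOp (z h : ι → R) (m : ι → ℕ) : R[X] →ₗ[R] R[X] :=
  LinearMap.mulLeft R (fullProd z) ∘ₗ derivative ∘ₗ derivative
    - LinearMap.mulLeft R (delComb z fun s => (m s : R)) ∘ₗ derivative
    + LinearMap.mulLeft R (delComb z h)

theorem fuchsOp_apply (z h : ι → R) (m : ι → ℕ) (f : R[X]) :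
    fuchsOp z h m f = fullProd z * derivative (derivative f) -
      delComb z (fun s => (m s : R)) * derivative f + delComb z h * f := rfl

theorem map_fuchsOp {S : Type*} [CommRing S] (φ : R →+* S) (z h : ι → R) (m : ι → ℕ) (f : R[X]) :
    (fuchsOp z h m f).map φ = fuchsOp (φ ∘ z) (φ ∘ h) m (f.map φ) := by
  have : (φ ∘ fun s => (m s : R)) = fun s => (m s : S) := by ext; simp
  simp only [fuchsOp_apply, Polynomial.map_add, Polynomial.map_sub, Polynomial.map_mul,
    map_fullProd, map_delComb, derivative_map, this]

theorem fuchsOp_pow_mul (z h : ι → R) (m : ι → ℕ) (s : ι) (k : ℕ) (g : R[X]) :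
    ∃ r, fuchsOp z h m ((X - C (z s)) ^ (k + 1) * g) = (X - C (z s)) ^ k *
      (((k : R[X]) + 1) * ((k : R[X]) - (m s : R[X])) * delProd z s * g + (X - C (z s)) * r) := by
  obtain ⟨q₁, hq₁⟩ := delComb_eq z (fun s => (m s : R)) s
  obtain ⟨q₂, hq₂⟩ := delComb_eq z h s
  simp only [map_natCast] at hq₁
  have hQ : (X - C (z s)) * derivative ((X - C (z s)) ^ k) = (k : R[X]) * (X - C (z s)) ^ k := by
    rw [derivative_X_sub_C_pow]
    cases k with
    | zero => simp
    | succ k => simp [pow_succ]; ring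
  set x := X - C (z s) with hx
  have hxd : derivative x = 1 := by simp [hx]
  have h1 : derivative (x ^ (k + 1) * g) = ((k : R[X]) + 1) * x ^ k * g + x ^ (k + 1) * derivative g := by
    rw [derivative_mul, pow_succ, derivative_mul, hxd]
    linear_combination g * hQ
  have h2 : x * derivative (derivative (x ^ (k + 1) * g)) =
      x ^ k * (((k : R[X]) + 1) * k * g + x * (2 * ((k : R[X]) + 1) * derivative g) +
        x ^ 2 * derivative (derivative g)) := by
    rw [h1]
    simp only [derivative_add, derivative_mul, derivative_natCast, derivative_one, pow_succ, hxd]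
    linear_combination (((k : R[X]) + 1) * g + x * derivative g) * hQ
  refine ⟨delProd z s * (2 * ((k : R[X]) + 1) * derivative g + x * derivative (derivative g)) -
    (m s : R[X]) * delProd z s * derivative g - q₁ * ((k + 1) * g + x * derivative g)
    + (C (h s) * delProd z s + x * q₂) * g, ?_⟩
  rw [fuchsOp_apply, fullProd_eq z s, ← hx, hq₁, hq₂]
  linear_combination delProd z s * h2 - ((m s : R[X]) * delProd z s + x * q₁) * h1

theorem pow_dvd_fuchsOp (z h : ι → R) (m : ι → ℕ) (s : ι) {f : R[X]}
    (hf : (X - C (z s)) ^ (m s + 1) ∣ f) : (X - C (z s)) ^ (m s + 1) ∣ fuchsOp z h m f := by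
  obtain ⟨g, rfl⟩ := hf
  obtain ⟨r, hr⟩ := fuchsOp_pow_mul z h m s (m s) g
  exact ⟨r, by rw [hr]; ring⟩

theorem X_sq_mul_fuchsOp (z h : ι → R) (m : ι → ℕ) (c : R) (h₀ : ∑ s, h s = 0)
    (h₁ : ∑ s, h s * z s = c) (f : R[X]) :
    X ^ 2 * fuchsOp z h m f = fullProd z * (X ^ 2 * derivative (derivative f) -
      C (∑ s, (m s : R)) * (X * derivative f) + C c * f) +
      (delComb z (fun s => h s * z s * z s) * f -
        delComb z (fun s => (m s : R) * z s) * (X * derivative f)) := by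
  have e₁ := X_mul_delComb z (fun s => (m s : R))
  have e₂ := X_mul_delComb z h
  have e₃ := X_mul_delComb z (fun s => h s * z s)
  simp only [h₀, h₁, map_zero, zero_mul, zero_add] at e₂ e₃
  rw [fuchsOp_apply]
  linear_combination (-(X * derivative f)) * e₁ + X * f * e₂ + f * e₃

theorem natDegree_X_mul_derivative_le {f : R[X]} {k : ℕ} (hf : f.natDegree ≤ k) :
    (X * derivative f).natDegree ≤ k := by
  rw [natDegree_le_iff_coeff_eq_zero] at hf ⊢
  intro i hi
  obtain ⟨i, rfl⟩ : ∃ i', i = i' + 1 := ⟨i - 1, by omega⟩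
  rw [coeff_X_mul, coeff_derivative, hf _ hi, zero_mul]

theorem coeff_X_mul_derivative (f : R[X]) (k : ℕ) :
    (X * derivative f).coeff k = k * f.coeff k := by
  cases k with
  | zero => simp
  | succ k => rw [coeff_X_mul, coeff_derivative]; push_cast; ring

theorem coeff_X_sq_mul_fuchsOp [Nontrivial R] (z h : ι → R) (m : ι → ℕ) (l l' : ℕ)
    (hll : l + l' = ∑ s, m s + 1)
    (h₀ : ∑ s, h s = 0) (h₁ : ∑ s, h s * z s = l * l') {f : R[X]} {k : ℕ}
    (hf : f.natDegree ≤ k) :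
    (X ^ 2 * fuchsOp z h m f).coeff (Fintype.card ι + k) =
      ((k : R) - l) * ((k : R) - l') * f.coeff k := by
  have hX2 : X ^ 2 * derivative (derivative f) = X * derivative (X * derivative f) - X * derivative f := by
    rw [derivative_mul, derivative_X]; ring
  have hd1 := natDegree_X_mul_derivative_le hf
  have hd2 := natDegree_X_mul_derivative_le hd1
  have hlow : ∀ a : ι → R, ∀ g : R[X], g.natDegree ≤ k →
      (delComb z a * g).coeff (Fintype.card ι + k) = 0 := by
    intro a g hg
    refine coeff_eq_zero_of_degree_lt (lt_of_le_of_lt (degree_mul_le _ _) ?_)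
    by_cases hg0 : g = 0
    · subst hg0; simp [bot_lt_iff_ne_bot]
    calc (delComb z a).degree + g.degree ≤ (delComb z a).degree + k :=
          add_le_add_right (natDegree_le_iff_degree_le.1 hg) _
      _ < (Fintype.card ι : WithBot ℕ) + k :=
          WithBot.add_lt_add_right (by exact WithBot.coe_ne_bot) (degree_delComb_lt z a)
      _ = _ := by push_cast; rfl
  have hm : (∑ s, (m s : R)) = (l : R) + l' - 1 := by
    have := congrArg (Nat.cast : ℕ → R) hll
    push_cast at this
    linear_combination -this
  rw [X_sq_mul_fuchsOp z h m _ h₀ h₁, coeff_add, coeff_sub, hlow _ _ hf, hlow _ _ hd1, hX2,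
    coeff_mul_add_eq_of_natDegree_le (natDegree_fullProd z).le]
  · have hlead : (fullProd z).coeff (Fintype.card ι) = 1 := by
      rw [← natDegree_fullProd z]; exact (monic_fullProd z).coeff_natDegree
    rw [hlead]
    simp only [coeff_add, coeff_sub, coeff_C_mul, coeff_X_mul_derivative, hm]
    ring
  · refine natDegree_add_le_of_degree_le ?_ ((natDegree_C_mul_le _ _).trans hf)
    refine (natDegree_sub_le_of_le (natDegree_sub_le_of_le hd2 hd1)
      ((natDegree_C_mul_le _ _).trans hd1)).trans ?_
    simp

end FuchsianOperator

section EigenvalueEquation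

open Polynomial Matrix

variable {R : Type*} [CommRing R] {ι : Type*} [Fintype ι] [DecidableEq ι]

theorem isUnit_sub_of_delProd {z δ' : ι → R}
    (hδ : ∀ s, δ' s * (delProd z s).eval (z s) = 1) {r s : ι} (h : r ≠ s) :
    IsUnit (z r - z s) := by
  have := hδ r
  rw [delProd_eq z h, eval_mul] at this
  refine IsUnit.of_mul_eq_one (δ' r * (delProd₂ z r s).eval (z r)) ?_
  simp only [eval_sub, eval_X, eval_C] at this
  linear_combination this

theorem eq_zero_of_eval_nodes_eq_zero [Nontrivial R] {z δ' : ι → R}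
    (hδ : ∀ s, δ' s * (delProd z s).eval (z s) = 1) {f : R[X]}
    (hf : f.degree < Fintype.card ι) (h : ∀ s, f.eval (z s) = 0) : f = 0 := by
  have hdvd : fullProd z ∣ f := by
    refine Finset.prod_dvd_of_coprime ?_ fun s _ => dvd_iff_isRoot.2 (h s)
    intro r _ s _ hrs
    exact isCoprime_X_sub_C_of_isUnit_sub (isUnit_sub_of_delProd hδ hrs)
  by_contra hne
  have := (monic_fullProd z).not_dvd_of_degree_lt hne (by
    rwa [degree_eq_natDegree (monic_fullProd z).ne_zero, natDegree_fullProd])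
  exact this hdvd

theorem eq_delComb [Nontrivial R] {z δ' : ι → R}
    (hδ : ∀ s, δ' s * (delProd z s).eval (z s) = 1) {f : R[X]}
    (hf : f.degree < Fintype.card ι) : f = delComb z fun s => f.eval (z s) * δ' s := by
  refine sub_eq_zero.1 (eq_zero_of_eval_nodes_eq_zero hδ ?_ fun s => ?_)
  · exact lt_of_le_of_lt (degree_sub_le _ _) (max_lt hf (degree_delComb_lt _ _))
  · rw [eval_sub, eval_delComb, mul_assoc, hδ, mul_one, sub_self]

/-- The product of the `(X - z s) ^ j s`. -/
def rootProd (z : ι → R) (j : ι → ℕ) : R[X] := ∏ s, (X - C (z s)) ^ j s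

omit [DecidableEq ι] in
theorem monic_rootProd (z : ι → R) (j : ι → ℕ) : (rootProd z j).Monic :=
  monic_prod_of_monic _ _ fun _ _ => (monic_X_sub_C _).pow _

omit [DecidableEq ι] in
theorem natDegree_rootProd [Nontrivial R] (z : ι → R) (j : ι → ℕ) :
    (rootProd z j).natDegree = ∑ s, j s := by
  rw [rootProd, natDegree_prod_of_monic _ _ fun _ _ => (monic_X_sub_C _).pow _]
  refine Finset.sum_congr rfl fun s _ => ?_
  rw [(monic_X_sub_C _).natDegree_pow, natDegree_X_sub_C, mul_one]

omit [DecidableEq ι] in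
theorem map_rootProd {S : Type*} [CommRing S] (φ : R →+* S) (z : ι → R) (j : ι → ℕ) :
    (rootProd z j).map φ = rootProd (φ ∘ z) j := by
  simp [rootProd, Polynomial.map_prod]

theorem rootProd_add_single (z : ι → R) (j : ι → ℕ) (s : ι) :
    rootProd z (j + Pi.single s 1) = (X - C (z s)) * rootProd z j := by
  simp only [rootProd, Pi.add_apply, pow_add, Finset.prod_mul_distrib]
  rw [mul_comm]
  congr 1
  rw [Finset.prod_eq_single s]
  · simp
  · intro r _ hr; simp [hr]
  · simp

omit [Fintype ι] in
theorem sub_single_add_single {j : ι → ℕ} {r : ι} (h : j r ≠ 0) :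
    j - Pi.single r 1 + Pi.single r 1 = j := by
  ext s
  by_cases hs : s = r
  · subst hs; simp; omega
  · simp [hs]

theorem sum_add_single (j : ι → ℕ) (r : ι) : ∑ s, (j + Pi.single r 1 : ι → ℕ) s = ∑ s, j s + 1 := by
  simp [Finset.sum_add_distrib]

theorem X_sub_C_mul_rootProd_sub (z : ι → R) {j : ι → ℕ} {r : ι} (h : j r ≠ 0) :
    (X - C (z r)) * rootProd z (j - Pi.single r 1) = rootProd z j := by
  rw [← rootProd_add_single, sub_single_add_single h]

theorem fullProd_mul_derivative_rootProd (z : ι → R) (j : ι → ℕ) :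
    fullProd z * derivative (rootProd z j) =
      rootProd z j * delComb z fun s => (j s : R) := by
  rw [rootProd, derivative_prod_finset, delComb, Finset.mul_sum, Finset.mul_sum]
  refine Finset.sum_congr rfl fun s _ => ?_
  rw [← Finset.mul_prod_erase _ _ (Finset.mem_univ s), fullProd_eq z s, derivative_X_sub_C_pow]
  cases hj : j s with
  | zero => simp
  | succ k => simp [pow_succ]; ring

theorem fullProd_mul_derivative_delProd (z : ι → R) (s : ι) :
    fullProd z * derivative (delProd z s) - derivative (fullProd z) * delProd z s =
      -(delProd z s) ^ 2 := by
  rw [fullProd_eq z s, derivative_mul, derivative_X_sub_C]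
  ring

theorem fullProd_mul_derivative_delComb (z a : ι → R) :
    fullProd z * derivative (delComb z a) - derivative (fullProd z) * delComb z a =
      -∑ s, C (a s) * (delProd z s) ^ 2 := by
  simp only [delComb, derivative_sum, derivative_C_mul, Finset.mul_sum, ← Finset.sum_sub_distrib,
    ← Finset.sum_neg_distrib]
  refine Finset.sum_congr rfl fun s _ => ?_
  linear_combination C (a s) * fullProd_mul_derivative_delProd z s

theorem delComb_mul_delComb (z a b : ι → R) :
    delComb z a * delComb z b = ∑ r, C (a r * b r) * (delProd z r) ^ 2 +
      fullProd z * ∑ r, ∑ s ∈ Finset.univ.erase r, C (a r * b s) * delProd₂ z r s := by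
  rw [delComb, delComb, Finset.sum_mul_sum]
  simp only [Finset.mul_sum, ← Finset.sum_add_distrib]
  refine Finset.sum_congr rfl fun r _ => ?_
  rw [← Finset.add_sum_erase _ _ (Finset.mem_univ r)]
  congr 1
  · rw [C_mul]; ring
  · refine Finset.sum_congr rfl fun s hs => ?_
    rw [C_mul]
    linear_combination C (a r) * C (b s) * delProd_mul_delProd z (Finset.ne_of_mem_erase hs).symm

theorem fullProd_mul_fuchsOp_rootProd (z h : ι → R) (m j : ι → ℕ) :
    fullProd z * fuchsOp z h m (rootProd z j) = rootProd z j *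
      (∑ r, C ((j r : R) * (j r - 1 - m r)) * (delProd z r) ^ 2 +
        fullProd z * (∑ r, ∑ s ∈ Finset.univ.erase r,
          C ((j r : R) * (j s - m s)) * delProd₂ z r s + delComb z h)) := by
  have h1 := fullProd_mul_derivative_rootProd z j
  have h2 := congrArg derivative h1
  rw [derivative_mul, derivative_mul] at h2
  have h3 := fullProd_mul_derivative_delComb z fun s => (j s : R)
  have h4 := delComb_mul_delComb z (fun s => (j s : R)) (fun s => (j s : R) - m s)
  have h5 : delComb z (fun s => (j s : R) - m s) =
      delComb z (fun s => (j s : R)) - delComb z (fun s => (m s : R)) := by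
    simp [delComb, sub_mul]
  have h6 : ∑ r, C ((j r : R) * (j r - 1 - m r)) * (delProd z r) ^ 2 =
      ∑ r, C ((j r : R) * (j r - m r)) * (delProd z r) ^ 2 -
        ∑ r, C (j r : R) * (delProd z r) ^ 2 := by
    rw [← Finset.sum_sub_distrib]
    refine Finset.sum_congr rfl fun r _ => ?_
    simp only [C_mul, C_sub, C_1]; ring
  rw [h5] at h4
  rw [fuchsOp_apply, h6]
  linear_combination fullProd z * h2 - derivative (fullProd z) * h1 + delComb z (fun s => (j s : R)) * h1
    - delComb z (fun s => (m s : R)) * h1 + rootProd z j * h3 + rootProd z j * h4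

theorem exists_delProd_sq (z : ι → R) (r : ι) : ∃ c, (delProd z r) ^ 2 =
    C ((delProd z r).eval (z r)) * delProd z r + fullProd z * c := by
  obtain ⟨c, hc⟩ := X_sub_C_dvd_sub_C_eval (p := delProd z r) (a := z r)
  refine ⟨c, ?_⟩
  rw [fullProd_eq z r]
  linear_combination delProd z r * hc

theorem exists_fuchsOp_rootProd (z h : ι → R) (m j : ι → ℕ) :
    ∃ q, fuchsOp z h m (rootProd z j) = rootProd z j * q +
      ∑ r, C ((j r : R) * (j r - 1 - m r) * (delProd z r).eval (z r)) *
        rootProd z (j - Pi.single r 1) := by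
  choose c hc using exists_delProd_sq z
  refine ⟨∑ r, C ((j r : R) * (j r - 1 - m r)) * c r +
    (∑ r, ∑ s ∈ Finset.univ.erase r,
          C ((j r : R) * (j s - m s)) * delProd₂ z r s + delComb z h), ?_⟩
  refine (monic_fullProd z).isRegular.left ?_
  show fullProd z * _ = fullProd z * _
  rw [fullProd_mul_fuchsOp_rootProd]
  have : rootProd z j * ∑ r, C ((j r : R) * (j r - 1 - m r)) * (delProd z r) ^ 2 =
      fullProd z * (rootProd z j * ∑ r, C ((j r : R) * (j r - 1 - m r)) * c r) +
      fullProd z * ∑ r, C ((j r : R) * (j r - 1 - m r) * (delProd z r).eval (z r)) *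
        rootProd z (j - Pi.single r 1) := by
    simp only [Finset.mul_sum, ← Finset.sum_add_distrib]
    refine Finset.sum_congr rfl fun r _ => ?_
    by_cases hj : j r = 0
    · simp [hj]
    · rw [hc, ← X_sub_C_mul_rootProd_sub z hj, fullProd_eq z r, C_mul (b := eval _ _)]
      ring
  linear_combination this

theorem degree_fuchsOp_lt [Nontrivial R] (z h : ι → R) (m : ι → ℕ) {f : R[X]} {k : ℕ}
    (hf : f.degree ≤ k) : (fuchsOp z h m f).degree < (Fintype.card ι + k : ℕ) := by
  by_cases hf0 : f = 0
  · subst hf0; simp [bot_lt_iff_ne_bot]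
  have hf1 : (derivative f).degree < k := lt_of_lt_of_le (degree_derivative_lt hf0) hf
  have hf2 : (derivative (derivative f)).degree < k := lt_of_le_of_lt (degree_derivative_le) hf1
  have hlow : ∀ a : ι → R, ∀ g : R[X], g.degree ≤ k →
      (delComb z a * g).degree < (Fintype.card ι + k : ℕ) := by
    intro a g hg
    refine lt_of_le_of_lt (degree_mul_le _ _) ?_
    calc (delComb z a).degree + g.degree ≤ (delComb z a).degree + k :=
          add_le_add_right hg _
      _ < (Fintype.card ι : WithBot ℕ) + k :=
          WithBot.add_lt_add_right (by exact WithBot.coe_ne_bot) (degree_delComb_lt z a)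
      _ = _ := by push_cast; rfl
  rw [fuchsOp_apply]
  refine lt_of_le_of_lt (degree_add_le _ _) (max_lt ?_ (hlow _ _ hf))
  refine lt_of_le_of_lt (degree_sub_le _ _) (max_lt ?_ (hlow _ _ hf1.le))
  rw [(monic_fullProd z).degree_mul_comm, (monic_fullProd z).degree_mul,
    degree_eq_natDegree (monic_fullProd z).ne_zero, natDegree_fullProd, Nat.cast_add, add_comm]
  exact WithBot.add_lt_add_left (by exact WithBot.coe_ne_bot) hf2

/-- The function `G` of the roots `y` of `d`: the determinant of `f ↦ T f mod d`. -/
def remDet (z h : ι → R) (m : ι → ℕ) (l : ℕ) (d : R[X]) : R :=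
  (remMatrix (fuchsOp z h m) l d).det

theorem exists_fuchsOp_cramerPoly [Nontrivial R] (z h : ι → R) (m : ι → ℕ) {l : ℕ} {w : R[X]}
    (hw : w.Monic) (hwl : w.natDegree + 1 = l) :
    ∃ g, fuchsOp z h m (cramerPoly (fuchsOp z h m) l w) = w * g ∧ g.degree < Fintype.card ι ∧
      ∀ y, g.eval y = remDet z h m l ((X - C y) * w) := by
  obtain ⟨g, hg, hge⟩ := exists_map_cramerPoly (fuchsOp z h m) hw hwl
  refine ⟨g, hg, ?_, hge⟩
  have h1 : (cramerPoly (fuchsOp z h m) l w).degree ≤ w.natDegree := by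
    rw [cramerPoly, degree_le_iff_coeff_zero]
    intro k hk
    refine coeff_eq_zero_of_degree_lt (lt_of_lt_of_le (degree_polyOf_lt _) ?_)
    rw [← hwl]
    exact_mod_cast hk
  have h2 := degree_fuchsOp_lt z h m h1
  rw [hg, hw.degree_mul_comm, hw.degree_mul, degree_eq_natDegree hw.ne_zero, Nat.cast_add] at h2
  by_contra hcon
  exact absurd h2 (not_lt.2 (add_le_add_left (not_lt.1 hcon) _))

theorem fullProd_mul_fuchsOp_cramerPoly [Nontrivial R] (z h : ι → R) (m : ι → ℕ) {l : ℕ}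
    {δ' : ι → R} (hδ : ∀ s, δ' s * (delProd z s).eval (z s) = 1) {j : ι → ℕ}
    (hj : ∑ s, j s = l) (r : ι) (κ : R) (hκ : j r = 0 → κ = 0) :
    C κ * (fullProd z * fuchsOp z h m
        (cramerPoly (fuchsOp z h m) l (rootProd z (j - Pi.single r 1)))) =
      rootProd z j * (delProd z r * delComb z fun s =>
        κ * remDet z h m l ((X - C (z s)) * rootProd z (j - Pi.single r 1)) * δ' s) := by
  by_cases hjr : j r = 0
  · simp [hκ hjr, delComb]
  have hw := monic_rootProd z (j - Pi.single r 1)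
  obtain ⟨g, hg, hdeg, heval⟩ := exists_fuchsOp_cramerPoly z h m (l := l) hw (by
    rw [natDegree_rootProd, ← sum_add_single _ r, sub_single_add_single hjr, hj])
  have h1 : (delComb z fun s =>
      κ * remDet z h m l ((X - C (z s)) * rootProd z (j - Pi.single r 1)) * δ' s) = C κ * g := by
    conv_rhs => rw [eq_delComb hδ hdeg]
    simp only [heval, delComb, Finset.mul_sum, C_mul]
    exact Finset.sum_congr rfl fun s _ => by ring
  rw [h1, hg, ← X_sub_C_mul_rootProd_sub z hjr, fullProd_eq z r]
  ring

theorem remDet_mul_fuchsOp_rootProd [Nontrivial R] (z h : ι → R) (m : ι → ℕ) {l : ℕ}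
    {p : R[X]} (hp : p.Monic) (hpl : p.natDegree = l) (hTp : fuchsOp z h m p = 0)
    {j : ι → ℕ} (hj : ∑ s, j s = l) :
    C (remDet z h m l (rootProd z j)) * fuchsOp z h m (rootProd z j) =
      ∑ r, C ((j r : R) * (j r - 1 - m r) * (delProd z r).eval (z r)) *
        fuchsOp z h m (cramerPoly (fuchsOp z h m) l (rootProd z (j - Pi.single r 1))) := by
  set T := fuchsOp z h m with hT
  have hD := monic_rootProd z j
  have hDl : (rootProd z j).natDegree = l := by rw [natDegree_rootProd, hj]
  have hDd : (rootProd z j).degree = l := by rw [degree_eq_natDegree hD.ne_zero, hDl]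
  have hu : (rootProd z j - p).degree < l := by
    rw [← hDd]
    refine degree_sub_lt_left ?_ hD.ne_zero (by rw [hD.leadingCoeff, hp.leadingCoeff])
    rw [hDd, degree_eq_natDegree hp.ne_zero, hpl]
  have hTu : T (rootProd z j - p) = T (rootProd z j) := by rw [map_sub, hTp, sub_zero]
  obtain ⟨q, hq⟩ := exists_fuchsOp_rootProd z h m j
  have hmod : T (rootProd z j) %ₘ rootProd z j =
      ∑ r, ((j r : R) * (j r - 1 - m r) * (delProd z r).eval (z r)) •
        rootProd z (j - Pi.single r 1) := by
    refine (div_modByMonic_unique q _ hD ⟨?_, ?_⟩).2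
    · simp only [smul_eq_C_mul]
      rw [hT, hq, add_comm]
    · rw [hDd]
      refine lt_of_le_of_lt (degree_sum_le _ _) ?_
      rw [Finset.sup_lt_iff (by exact WithBot.bot_lt_coe _)]
      intro r _
      by_cases hjr : j r = 0
      · simp [hjr, bot_lt_iff_ne_bot]
      · refine lt_of_le_of_lt (degree_smul_le _ _) ?_
        rw [degree_eq_natDegree (monic_rootProd _ _).ne_zero, natDegree_rootProd]
        have := sum_add_single (j - Pi.single r 1) r
        rw [sub_single_add_single hjr, hj] at this
        exact_mod_cast (by omega)
  have key := det_remMatrix_smul T (rootProd z j) hu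
  rw [hTu, hmod, map_sum, mulVec_sum, polyOf_sum] at key
  have key2 := congrArg T key
  rw [map_smul, hTu, smul_eq_C_mul, map_sum] at key2
  rw [remDet, key2]
  refine Finset.sum_congr rfl fun r _ => ?_
  rw [map_smul, mulVec_smul, polyOf_smul, map_smul, smul_eq_C_mul]
  by_cases hjr : j r = 0
  · simp [hjr]
  · conv_lhs => rw [← X_sub_C_mul_rootProd_sub z hjr]
    rw [polyOf_adjugate_vecOf T (monic_rootProd _ _)]

theorem delComb_mul_remDet [Nontrivial R] (z h : ι → R) (m : ι → ℕ) {l : ℕ}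
    {δ' : ι → R} (hδ : ∀ s, δ' s * (delProd z s).eval (z s) = 1)
    {p : R[X]} (hp : p.Monic) (hpl : p.natDegree = l) (hTp : fuchsOp z h m p = 0)
    {j : ι → ℕ} (hj : ∑ s, j s = l) :
    C (remDet z h m l (rootProd z j)) * delComb z h =
      ∑ r, ∑ s ∈ Finset.univ.erase r, C ((j r : R) * (j r - 1 - m r) *
        (delProd z r).eval (z r) * δ' s *
          remDet z h m l (rootProd z (j - Pi.single r 1 + Pi.single s 1)) -
        (j r : R) * (j s - m s) * remDet z h m l (rootProd z j)) * delProd₂ z r s := by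
  set G := remDet z h m l (rootProd z j) with hG
  have h1 := congrArg (fullProd z * ·) (remDet_mul_fuchsOp_rootProd z h m hp hpl hTp hj)
  simp only [Finset.mul_sum] at h1
  rw [mul_left_comm, fullProd_mul_fuchsOp_rootProd] at h1
  simp only [mul_left_comm (fullProd z) (C _)] at h1
  rw [Finset.sum_congr rfl fun r _ => fullProd_mul_fuchsOp_cramerPoly z h m hδ hj r
    ((j r : R) * (j r - 1 - m r) * (delProd z r).eval (z r)) (by intro h0; simp [h0]),
    ← Finset.mul_sum, mul_left_comm] at h1
  have h2 := (monic_rootProd z j).isRegular.left h1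
  have h3 : ∑ r, delProd z r * delComb z (fun s => (j r : R) * (j r - 1 - m r) *
      (delProd z r).eval (z r) *
        remDet z h m l ((X - C (z s)) * rootProd z (j - Pi.single r 1)) * δ' s) =
      C G * ∑ r, C ((j r : R) * (j r - 1 - m r)) * (delProd z r) ^ 2 +
      fullProd z * ∑ r, ∑ s ∈ Finset.univ.erase r, C ((j r : R) * (j r - 1 - m r) *
        (delProd z r).eval (z r) * δ' s *
          remDet z h m l (rootProd z (j - Pi.single r 1 + Pi.single s 1))) * delProd₂ z r s := by
    simp only [Finset.mul_sum, ← Finset.sum_add_distrib]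
    refine Finset.sum_congr rfl fun r _ => ?_
    rw [delComb, Finset.mul_sum, ← Finset.add_sum_erase _ _ (Finset.mem_univ r)]
    congr 1
    · by_cases hjr : j r = 0
      · simp [hjr]
      · rw [X_sub_C_mul_rootProd_sub z hjr, ← hG]
        have : C (δ' r) * C ((delProd z r).eval (z r)) = 1 := by rw [← C_mul, hδ, C_1]
        simp only [C_mul]
        linear_combination C (j r : R) * C ((j r : R) - 1 - m r) * C G * (delProd z r) ^ 2 * this
    · refine Finset.sum_congr rfl fun s hs => ?_
      rw [rootProd_add_single]
      simp only [C_mul]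
      linear_combination C (j r : R) * C ((j r : R) - 1 - m r) * C ((delProd z r).eval (z r)) *
        C (remDet z h m l ((X - C (z s)) * rootProd z (j - Pi.single r 1))) * C (δ' s) *
          delProd_mul_delProd z (Finset.ne_of_mem_erase hs).symm
  rw [h3, mul_add, add_right_inj, mul_left_comm] at h2
  have h4 := (monic_fullProd z).isRegular.left h2
  rw [mul_add, ← eq_sub_iff_add_eq'] at h4
  rw [h4, Finset.mul_sum, ← Finset.sum_sub_distrib]
  refine Finset.sum_congr rfl fun r _ => ?_
  rw [Finset.mul_sum, ← Finset.sum_sub_distrib]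
  refine Finset.sum_congr rfl fun s _ => ?_
  simp only [C_mul, C_sub]
  ring

end EigenvalueEquation

section SymmetrizableMatrix

open Matrix

theorem eq_zero_of_sq_smul_eq_zero {ι R M : Type*} [CommRing R]
    [AddCommGroup M] [Module R M] {a : ι → R} (ha : Ideal.span (Set.range a) = ⊤) {x : M}
    (h : ∀ i, a i ^ 2 • x = 0) : x = 0 := by
  have h2 := Ideal.span_pow_eq_top (Set.range a) ha 2
  have h3 : Ideal.span ((fun y : R => y ^ 2) '' Set.range a) ≤
      LinearMap.ker (LinearMap.toSpanSingleton R M x) := by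
    rw [Ideal.span_le]
    rintro _ ⟨_, ⟨i, rfl⟩, rfl⟩
    simpa using h i
  rw [h2] at h3
  simpa using h3 (Submodule.mem_top (x := (1 : R)))

theorem derivation_eq_zero_of_symmetrizable {ι : Type*} [Fintype ι]
    {A : Matrix ι ι ℝ} {ω : ι → ℝ} (hω : ∀ i, 0 < ω i)
    (hA : ∀ i j, ω i * A i j = ω j * A j i) {R M : Type*} [CommRing R] [Algebra ℂ R]
    [AddCommGroup M] [Module R M] [Module ℂ M] (d : Derivation ℂ R M) {a : ι → R}
    (ha : Ideal.span (Set.range a) = ⊤) {t : R}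
    (h : ∀ i, t * a i = ∑ j, algebraMap ℂ R (A i j : ℂ) * a j) : d t = 0 := by
  classical
  let φ : ℝ →+* R := (algebraMap ℂ R).comp Complex.ofRealHom
  have hφd : ∀ x, d (φ x) = 0 := fun x => d.map_algebraMap (x : ℂ)
  replace h : ∀ i, t * a i = ∑ j, φ (A i j) * a j := h
  let S : Matrix ι ι ℝ := Matrix.of fun i j => √(ω i) * A i j * (√(ω j))⁻¹
  have hs : ∀ i, √(ω i) ≠ 0 := fun i => (Real.sqrt_pos.2 (hω i)).ne'
  have hss : ∀ i, √(ω i) * √(ω i) = ω i := fun i => Real.mul_self_sqrt (hω i).le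
  have hsymm : ∀ i j, S i j = S j i := by
    intro i j
    have h1 := hA i j
    rw [← hss i, ← hss j] at h1
    have := hs i
    have := hs j
    simp only [S, of_apply]
    field_simp
    linear_combination h1
  have hS : S.IsHermitian := by
    ext i j
    simp [hsymm i j]
  let U : Matrix ι ι ℝ := hS.eigenvectorUnitary
  have hUU : ∀ i j, ∑ k, U i k * U j k = if i = j then 1 else 0 := by
    intro i j
    have h1 : U * star U = 1 := (Matrix.mem_unitaryGroup_iff).1 hS.eigenvectorUnitary.2
    have := congrFun (congrFun h1 i) j
    simpa [Matrix.mul_apply, Matrix.one_apply] using this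
  have hSU : ∀ j k, ∑ i, S i j * U i k = hS.eigenvalues k * U j k := by
    intro j k
    have := congrFun (hS.mulVec_eigenvectorBasis k) j
    simp only [mulVec, dotProduct, Pi.smul_apply, smul_eq_mul] at this
    simp only [U, hS.eigenvectorUnitary_apply, hsymm _ j]
    exact this
  let b : ι → R := fun i => φ √(ω i) * a i
  have hb : ∀ i, t * b i = ∑ j, φ (S i j) * b j := by
    intro i
    simp only [b]
    rw [mul_left_comm, h i, Finset.mul_sum]
    refine Finset.sum_congr rfl fun j _ => ?_
    have : φ (S i j) * φ √(ω j) = φ √(ω i) * φ (A i j) := by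
      rw [← map_mul, ← map_mul]
      congr 1
      simp only [S, of_apply]
      field_simp [hs j]
    linear_combination -a j * this
  let c : ι → R := fun k => ∑ i, φ (U i k) * b i
  have hc : ∀ k, t * c k = φ (hS.eigenvalues k) * c k := by
    intro k
    simp only [c, Finset.mul_sum]
    simp only [mul_left_comm t, hb, Finset.mul_sum]
    rw [Finset.sum_comm]
    refine Finset.sum_congr rfl fun j _ => ?_
    rw [← mul_assoc, ← map_mul, ← hSU, map_sum, Finset.sum_mul]
    refine Finset.sum_congr rfl fun i _ => ?_
    rw [map_mul]; ring
  have hbc : ∀ i, b i = ∑ k, φ (U i k) * c k := by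
    intro i
    simp only [c, Finset.mul_sum]
    rw [Finset.sum_comm]
    rw [Finset.sum_congr rfl fun j _ => show ∑ k, φ (U i k) * (φ (U j k) * b j) =
      φ (∑ k, U i k * U j k) * b j by
        rw [map_sum, Finset.sum_mul]
        exact Finset.sum_congr rfl fun k _ => by rw [map_mul]; ring]
    simp [hUU]
  have hspan : Ideal.span (Set.range c) = ⊤ := by
    rw [← top_le_iff, ← ha, Ideal.span_le]
    rintro _ ⟨i, rfl⟩
    have h1 : a i = φ (√(ω i))⁻¹ * b i := by
      simp only [b]
      rw [← mul_assoc, ← map_mul, inv_mul_cancel₀ (hs i), map_one, one_mul]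
    rw [SetLike.mem_coe, h1, hbc]
    refine Ideal.mul_mem_left _ _ (Ideal.sum_mem _ fun k _ => Ideal.mul_mem_left _ _ ?_)
    exact Ideal.subset_span ⟨k, rfl⟩
  refine eq_zero_of_sq_smul_eq_zero hspan fun k => ?_
  have h1 : (t - φ (hS.eigenvalues k)) * c k = 0 := by rw [sub_mul, hc, sub_self]
  have h2 := congrArg d h1
  rw [d.leibniz, map_zero, map_sub, hφd, sub_zero] at h2
  have h3 := congrArg (c k • ·) h2
  simp only [smul_add, smul_zero, ← mul_smul] at h3
  rw [mul_comm (c k) (t - _), h1, zero_smul, zero_add, ← pow_two] at h3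
  exact h3

end SymmetrizableMatrix

section Field

open Polynomial

variable {K : Type*} [Field K]

theorem exists_prod_X_sub_C_forall_dvd [Infinite K] (k : ℕ) :
    ∀ V : Submodule K K[X], FiniteDimensional K V → Module.finrank K V ≤ k →
      ∃ Y : Multiset K, Y.card = k ∧ ∀ f ∈ V, (Y.map fun y => X - C y).prod ∣ f → f = 0 := by
  induction k with
  | zero =>
    intro V _ hV
    refine ⟨0, rfl, fun f hf _ => ?_⟩
    have : V = ⊥ := Submodule.finrank_eq_zero.1 (Nat.le_zero.1 hV)
    simpa [this] using hf
  | succ k ih =>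
    intro V hfin hV
    obtain ⟨y, hy⟩ : ∃ y : K, V = ⊥ ∨ ∃ f ∈ V, f.eval y ≠ 0 := by
      by_cases hbot : V = ⊥
      · exact ⟨0, Or.inl hbot⟩
      · obtain ⟨f, hf, hf0⟩ := V.exists_mem_ne_zero_of_ne_bot hbot
        obtain ⟨y, hy⟩ : ∃ y, f.eval y ≠ 0 := by
          by_contra! hcon
          exact hf0 (Polynomial.funext fun y => by simpa using hcon y)
        exact ⟨y, Or.inr ⟨f, hf, hy⟩⟩
    let μ := LinearMap.mulLeft K (X - C y)
    have hμ : Function.Injective μ := fun f g hfg => mul_left_cancel₀ (X_sub_C_ne_zero y) hfg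
    have hW : FiniteDimensional K (V.comap μ) :=
      Module.Finite.of_injective (μ.restrict (p := V.comap μ) (q := V) fun f hf => hf)
        (fun f g hfg => Subtype.ext (hμ (congrArg Subtype.val hfg)))
    have hmap : Module.finrank K ((V.comap μ).map μ) = Module.finrank K (V.comap μ) :=
      (Submodule.equivMapOfInjective μ hμ _).finrank_eq.symm
    have hle : (V.comap μ).map μ ≤ V := Submodule.map_comap_le _ _
    have hrank : Module.finrank K (V.comap μ) ≤ k := by
      rw [← hmap]
      rcases hy with rfl | ⟨f, hf, hfy⟩
      · exact (Submodule.finrank_mono hle).trans (by simp)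
      · have hlt : (V.comap μ).map μ < V := by
          refine lt_of_le_of_ne hle fun heq => hfy ?_
          rw [← heq] at hf
          obtain ⟨g, -, rfl⟩ := hf
          simp [μ]
        have := Submodule.finrank_lt_finrank_of_lt hlt
        omega
    obtain ⟨Y, hYc, hY⟩ := ih _ hW hrank
    refine ⟨y ::ₘ Y, by simp [hYc], fun f hf hdvd => ?_⟩
    rw [Multiset.map_cons, Multiset.prod_cons] at hdvd
    obtain ⟨g, rfl⟩ := hdvd
    rw [mul_assoc] at hf ⊢
    rw [hY _ (show (Y.map fun y => X - C y).prod * g ∈ V.comap μ from hf) (dvd_mul_right _ _),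
      mul_zero]

end Field

section FuchsianField

open Polynomial

variable {K : Type*} [Field K] [CharZero K] {ι : Type*} [Fintype ι] [DecidableEq ι]

theorem eq_zero_of_fuchsOp_eq_zero (z h : ι → K) (m : ι → ℕ) {l l' : ℕ} (hlt : l < l')
    (hll : l + l' = ∑ s, m s + 1) (h₀ : ∑ s, h s = 0) (h₁ : ∑ s, h s * z s = l * l') {f : K[X]}
    (hf : f.degree < l) (hT : fuchsOp z h m f = 0) : f = 0 := by
  by_contra hf0
  have hk : f.natDegree < l := (natDegree_lt_iff_degree_lt hf0).2 hf
  have h := coeff_X_sq_mul_fuchsOp z h m l l' hll h₀ h₁ (le_refl f.natDegree)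
  rw [hT, mul_zero, coeff_zero, eq_comm, mul_eq_zero, mul_eq_zero, sub_eq_zero, sub_eq_zero,
    Nat.cast_inj, Nat.cast_inj] at h
  rcases h with (h | h) | h
  · omega
  · omega
  · exact hf0 (leadingCoeff_eq_zero.1 h)

theorem eval_cofactor_ne_zero {z h : ι → K} {m : ι → ℕ} {s : ι}
    (hδ : (delProd z s).eval (z s) ≠ 0) {k : ℕ} {g : K[X]} (hk : k ≠ m s)
    (hT : fuchsOp z h m ((X - C (z s)) ^ (k + 1) * g) = 0) : g.eval (z s) = 0 := by
  obtain ⟨r, hr⟩ := fuchsOp_pow_mul z h m s k g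
  rw [hT, eq_comm, mul_eq_zero_iff_left (pow_ne_zero _ (X_sub_C_ne_zero _))] at hr
  have h2 := congrArg (eval (z s)) hr
  simp only [eval_add, eval_mul, eval_natCast, eval_one, eval_sub, eval_X, eval_C, sub_self,
    zero_mul, add_zero, eval_zero, mul_eq_zero, hδ, or_false, sub_eq_zero, Nat.cast_inj, hk] at h2
  exact h2.resolve_left (Nat.cast_add_one_ne_zero k)

theorem exists_eq_pow_mul_of_fuchsOp_eq_zero {z h : ι → K} {m : ι → ℕ} {s : ι}
    (hδ : (delProd z s).eval (z s) ≠ 0) {f : K[X]} (hf : f ≠ 0) (hT : fuchsOp z h m f = 0)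
    (hs : f.eval (z s) = 0) :
    ∃ g, f = (X - C (z s)) ^ (m s + 1) * g ∧ g.eval (z s) ≠ 0 := by
  obtain ⟨g, hg, hdvd⟩ := exists_eq_pow_rootMultiplicity_mul_and_not_dvd f hf (z s)
  rw [dvd_iff_isRoot, IsRoot.def] at hdvd
  obtain ⟨k, hk⟩ : ∃ k, rootMultiplicity (z s) f = k + 1 :=
    Nat.exists_eq_succ_of_ne_zero ((rootMultiplicity_pos hf).2 hs).ne'
  rw [hk] at hg
  by_cases hkm : k = m s
  · subst hkm; exact ⟨g, hg, hdvd⟩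
  · rw [hg] at hT
    exact absurd (eval_cofactor_ne_zero hδ hkm hT) hdvd

theorem eval_ne_zero_or_of_fuchsOp_eq_zero {z h : ι → K} {m : ι → ℕ} {s : ι}
    (hδ : (delProd z s).eval (z s) ≠ 0) {p q : K[X]} (hp : p.Monic) (hq : q.Monic)
    (hpq : p.natDegree < q.natDegree) (hTp : fuchsOp z h m p = 0) (hTq : fuchsOp z h m q = 0) :
    ¬ (p.eval (z s) = 0 ∧ q.eval (z s) = 0) := by
  rintro ⟨hps, hqs⟩
  obtain ⟨p₁, hp₁, hp₁s⟩ := exists_eq_pow_mul_of_fuchsOp_eq_zero hδ hp.ne_zero hTp hps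
  obtain ⟨q₁, hq₁, hq₁s⟩ := exists_eq_pow_mul_of_fuchsOp_eq_zero hδ hq.ne_zero hTq hqs
  set f := p₁.eval (z s) • q - q₁.eval (z s) • p with hf
  have hTf : fuchsOp z h m f = 0 := by simp [hf, hTp, hTq]
  have hf0 : f ≠ 0 := by
    intro h0
    have := congrArg (fun f => coeff f q.natDegree) h0
    simp [hf, coeff_eq_zero_of_natDegree_lt hpq, hq.coeff_natDegree, hp₁s] at this
  have hfs : f.eval (z s) = 0 := by simp [hf, hps, hqs]
  obtain ⟨g, hg, hgs⟩ := exists_eq_pow_mul_of_fuchsOp_eq_zero hδ hf0 hTf hfs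
  refine hgs ?_
  have : (X - C (z s)) ^ (m s + 1) * g =
      (X - C (z s)) ^ (m s + 1) * (p₁.eval (z s) • q₁ - q₁.eval (z s) • p₁) := by
    rw [← hg, hf]
    simp only [smul_eq_C_mul]
    linear_combination C (p₁.eval (z s)) * hq₁ - C (q₁.eval (z s)) * hp₁
  have h2 := mul_left_cancel₀ (pow_ne_zero _ (X_sub_C_ne_zero _)) this
  rw [h2]
  simp [mul_comm]

theorem exists_remDet_rootProd_ne_zero (z h : ι → K) (m : ι → ℕ) {l l' : ℕ} (hlt : l < l')
    (hll : l + l' = ∑ s, m s + 1) (h₀ : ∑ s, h s = 0) (h₁ : ∑ s, h s * z s = l * l')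
    (hδ : ∀ s, (delProd z s).eval (z s) ≠ 0) :
    ∃ j : ι → ℕ, ∑ s, j s = l ∧ remDet z h m l (rootProd z j) ≠ 0 := by
  by_contra! hcon
  have key : ∀ (Y : Multiset K) (j : ι → ℕ), Y.card + ∑ s, j s = l →
      remDet z h m l ((Y.map fun y => X - C y).prod * rootProd z j) = 0 := by
    intro Y
    induction Y using Multiset.induction_on with
    | empty => intro j hj; simpa using hcon j (by simpa using hj)
    | cons y Y ih =>
      intro j hj
      rw [Multiset.card_cons] at hj
      have hY : (Y.map fun y => X - C y).prod.Monic :=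
        monic_multiset_prod_of_monic _ _ fun y _ => monic_X_sub_C y
      obtain ⟨g, -, hdeg, hg⟩ := exists_fuchsOp_cramerPoly z h m (l := l)
        (hY.mul (monic_rootProd z j)) (by
          rw [hY.natDegree_mul (monic_rootProd z j), natDegree_multiset_prod_X_sub_C_eq_card,
            natDegree_rootProd]; omega)
      have hg0 : g = 0 := by
        refine eq_zero_of_eval_nodes_eq_zero (δ' := fun s => ((delProd z s).eval (z s))⁻¹)
          (fun s => inv_mul_cancel₀ (hδ s)) hdeg fun s => ?_
        rw [hg, mul_left_comm, ← rootProd_add_single]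
        exact ih _ (by rw [sum_add_single]; omega)
      rw [Multiset.map_cons, Multiset.prod_cons, mul_assoc, ← hg, hg0, eval_zero]
  set T := fuchsOp z h m with hT
  let V : Submodule K K[X] := (degreeLT K l).map T
  have hfin : Module.Finite K (degreeLT K l) := Module.Finite.equiv (degreeLTEquiv K l).symm
  have hrank : Module.finrank K (degreeLT K l) = l := by
    rw [(degreeLTEquiv K l).finrank_eq]; simp
  obtain ⟨Y, hYc, hY⟩ := exists_prod_X_sub_C_forall_dvd l V inferInstance
    ((Submodule.finrank_map_le _ _).trans hrank.le)
  have hdet := key Y 0 (by simp [hYc])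
  have hmon : (Y.map fun y => X - C y).prod.Monic :=
    monic_multiset_prod_of_monic _ _ fun y _ => monic_X_sub_C y
  rw [show rootProd z 0 = 1 by simp [rootProd], mul_one] at hdet
  obtain ⟨v, hv0, hv⟩ := Matrix.exists_mulVec_eq_zero_iff.2 hdet
  have h2 := polyOf_remMatrix_mulVec T hmon
    (by rw [natDegree_multiset_prod_X_sub_C_eq_card, hYc]) v
  rw [hv, polyOf_zero, eq_comm, modByMonic_eq_zero_iff_dvd hmon] at h2
  have h3 := hY (T (polyOf v)) ⟨polyOf v, mem_degreeLT.2 (degree_polyOf_lt v), rfl⟩ h2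
  have h4 := eq_zero_of_fuchsOp_eq_zero z h m hlt hll h₀ h₁ (degree_polyOf_lt v) h3
  apply hv0
  rw [← vecOf_polyOf v, h4, map_zero]

end FuchsianField

section AccessoryParameters

open Polynomial

variable {ι : Type*} [Fintype ι] [DecidableEq ι]

/-- The symmetrizing weight. -/
def rootWeight (δ : ι → ℝ) (m j : ι → ℕ) : ℝ :=
  ∏ s, ((m s - j s).factorial : ℝ) / ((j s).factorial * δ s ^ (2 * j s))

omit [DecidableEq ι] in
theorem rootWeight_pos {δ : ι → ℝ} (hδ : ∀ s, δ s ≠ 0) (m j : ι → ℕ) : 0 < rootWeight δ m j := by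
  refine Finset.prod_pos fun s _ => div_pos (by positivity) ?_
  have : 0 < δ s ^ (2 * j s) := by rw [pow_mul]; have := hδ s; positivity
  positivity

theorem rootWeight_add_single {δ : ι → ℝ} (hδ : ∀ s, δ s ≠ 0) (m c : ι → ℕ) {r : ι}
    (hr : c r + 1 ≤ m r) :
    rootWeight δ m (c + Pi.single r 1) * ((c r + 1) * (m r - c r) * δ r ^ 2) =
      rootWeight δ m c := by
  rw [rootWeight, rootWeight, ← Finset.mul_prod_erase _ _ (Finset.mem_univ r),
    ← Finset.mul_prod_erase Finset.univ (fun s => ((m s - c s).factorial : ℝ) / _)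
      (Finset.mem_univ r)]
  have h1 : ∏ s ∈ Finset.univ.erase r, ((m s - (c + Pi.single r 1 : ι → ℕ) s).factorial : ℝ) /
      (((c + Pi.single r 1 : ι → ℕ) s).factorial * δ s ^ (2 * (c + Pi.single r 1 : ι → ℕ) s)) =
      ∏ s ∈ Finset.univ.erase r, ((m s - c s).factorial : ℝ) /
        ((c s).factorial * δ s ^ (2 * c s)) := by
    refine Finset.prod_congr rfl fun s hs => ?_
    simp [Finset.ne_of_mem_erase hs]
  rw [h1]
  obtain ⟨k, hk⟩ : ∃ k, m r = c r + k + 1 := ⟨m r - (c r + 1), by omega⟩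
  have e1 : c r + k + 1 - (c r + 1) = k := by omega
  have e2 : c r + k + 1 - c r = k + 1 := by omega
  simp only [Pi.add_apply, Pi.single_eq_same, hk, e1, e2, Nat.factorial_succ]
  have := hδ r
  push_cast
  field_simp
  ring

theorem sum_sum_erase_comm {M : Type*} [AddCommMonoid M] (F : ι → ι → M) :
    ∑ r, ∑ s ∈ Finset.univ.erase r, F r s = ∑ r, ∑ s ∈ Finset.univ.erase r, F s r := by
  refine Finset.sum_comm' fun r s => ?_
  simp [eq_comm]

/-- The real matrix whose eigenvalue is the accessory parameter at `z t`. -/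
def accessoryMatrix (z : ι → ℝ) (m : ι → ℕ) (t : ι) (j j' : ι → ℕ) : ℝ :=
  ((delProd z t).eval (z t))⁻¹ * ∑ r, ∑ s ∈ Finset.univ.erase r, (delProd₂ z r s).eval (z t) *
    ((if j + Pi.single s 1 = j' + Pi.single r 1 then (j r : ℝ) * (j r - 1 - m r) *
        (delProd z r).eval (z r) * ((delProd z s).eval (z s))⁻¹ else 0) +
      if j = j' then (j r : ℝ) * (m s - j s) else 0)

theorem rootWeight_mul_accessoryMatrix {z : ι → ℝ} (hδ : ∀ s, (delProd z s).eval (z s) ≠ 0)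
    (m : ι → ℕ) (t : ι) {j j' : ι → ℕ} (hj : ∀ s, j s ≤ m s) (hj' : ∀ s, j' s ≤ m s) :
    rootWeight (fun s => (delProd z s).eval (z s)) m j * accessoryMatrix z m t j j' =
      rootWeight (fun s => (delProd z s).eval (z s)) m j' * accessoryMatrix z m t j' j := by
  set δ : ι → ℝ := fun s => (delProd z s).eval (z s) with hδdef
  simp only [accessoryMatrix]
  rw [mul_left_comm, mul_left_comm (rootWeight δ m j')]
  congr 1
  simp only [mul_add, Finset.sum_add_distrib]
  congr 1
  · rw [sum_sum_erase_comm, Finset.mul_sum, Finset.mul_sum]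
    refine Finset.sum_congr rfl fun r _ => ?_
    rw [Finset.mul_sum, Finset.mul_sum]
    refine Finset.sum_congr rfl fun s hs => ?_
    have hsr : s ≠ r := Finset.ne_of_mem_erase hs
    rw [delProd₂_comm z s r]
    by_cases hjj : j + Pi.single r 1 = j' + Pi.single s 1
    · rw [if_pos hjj, if_pos hjj.symm]
      have hjs : j s ≠ 0 := by
        have := congrFun hjj s
        simp [hsr] at this; omega
      obtain ⟨c, rfl⟩ : ∃ c : ι → ℕ, j = c + Pi.single s 1 := ⟨_, (sub_single_add_single hjs).symm⟩
      obtain rfl : j' = c + Pi.single r 1 := by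
        rw [add_right_comm] at hjj
        exact (add_right_cancel hjj).symm
      have h1 := rootWeight_add_single (δ := δ) hδ m c (r := s) (by simpa using hj s)
      have h2 := rootWeight_add_single (δ := δ) hδ m c (r := r) (by simpa using hj' r)
      have hr : δ r ≠ 0 := hδ r
      have hs : δ s ≠ 0 := hδ s
      simp only [Pi.add_apply, Pi.single_eq_same, Nat.cast_add, Nat.cast_one]
      change _ * (_ * (_ * δ s * (δ r)⁻¹)) = _ * (_ * (_ * δ r * (δ s)⁻¹))
      generalize δ r = x at *
      generalize δ s = y at *
      generalize eval (z t) (delProd₂ z r s) = D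
      have hx : x * x⁻¹ = 1 := mul_inv_cancel₀ hr
      have hy : y * y⁻¹ = 1 := mul_inv_cancel₀ hs
      refine mul_right_cancel₀ (mul_ne_zero hr hs) ?_
      linear_combination (D * (h2 - h1)) +
        (rootWeight δ m (c + Pi.single s 1) * D * (c s + 1) * (c s - m s) * y ^ 2) * hx -
        (rootWeight δ m (c + Pi.single r 1) * D * (c r + 1) * (c r - m r) * x ^ 2) * hy
    · rw [if_neg hjj, if_neg (Ne.symm hjj)]; simp
  · by_cases hjj : j = j'
    · subst hjj; rfl
    · simp [hjj, Ne.symm hjj]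

theorem remDet_rootProd_eq_zero {R : Type*} [CommRing R] [Nontrivial R] (z h : ι → R) (m : ι → ℕ)
    {l : ℕ} {p q : R[X]} (hTp : fuchsOp z h m p = 0) (hTq : fuchsOp z h m q = 0) {s : ι}
    (hpq : IsCoprime (p.eval (z s)) (q.eval (z s))) {j : ι → ℕ} (hj : ∑ s, j s = l)
    (hs : m s < j s) : remDet z h m l (rootProd z j) = 0 := by
  have hdvd : (X - C (z s)) ^ (m s + 1) ∣ rootProd z j :=
    (pow_dvd_pow _ hs).trans
      (Finset.dvd_prod_of_mem (fun s => (X - C (z s)) ^ j s) (Finset.mem_univ s))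
  have key : ∀ f, fuchsOp z h m f = 0 → remDet z h m l (rootProd z j) * f.eval (z s) = 0 :=
    fun f hf => det_remMatrix_mul_eval_eq_zero _ (monic_rootProd z j)
      ((natDegree_rootProd z j).trans hj) (Nat.succ_ne_zero (m s)) hdvd
      (fun g hg => pow_dvd_fuchsOp z h m s hg) hf
  obtain ⟨a, b, hab⟩ := hpq
  linear_combination a * key p hTp + b * key q hTq - remDet z h m l (rootProd z j) * hab

theorem eval_delProd_ne_zero {K : Type*} [Field K] {z : ι → K} (hz : Function.Injective z) (s : ι) :
    (delProd z s).eval (z s) ≠ 0 := by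
  rw [delProd, eval_prod, Finset.prod_ne_zero_iff]
  intro r hr
  simpa [sub_eq_zero] using fun h => Finset.ne_of_mem_erase hr (hz h).symm

theorem map_remDet {R S : Type*} [CommRing R] [CommRing S] (φ : R →+* S) (z h : ι → R)
    (m : ι → ℕ) (l : ℕ) {d : R[X]} (hd : d.Monic) :
    φ (remDet z h m l d) = remDet (φ ∘ z) (φ ∘ h) m l (d.map φ) :=
  map_det_remMatrix φ _ _ (map_fuchsOp φ z h m) l hd

theorem isCoprime_eval_of_fuchsOp_eq_zero {A : Type*} [CommRing A] (φ : ℝ →+* A) {z : ι → ℝ}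
    (hz : Function.Injective z) {h : ι → A} {m : ι → ℕ} {p q : A[X]} (hp : p.Monic) (hq : q.Monic)
    (hpq : p.natDegree < q.natDegree) (hTp : fuchsOp (φ ∘ z) h m p = 0)
    (hTq : fuchsOp (φ ∘ z) h m q = 0) (s : ι) :
    IsCoprime (p.eval (φ (z s))) (q.eval (φ (z s))) := by
  refine Ideal.mem_span_pair.1 ((Ideal.eq_top_iff_one _).1 ?_)
  by_contra hne
  obtain ⟨I, hI, hle⟩ := Ideal.exists_le_maximal _ hne
  let := Ideal.Quotient.field I
  let ψ := Ideal.Quotient.mk I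
  have : CharZero (A ⧸ I) := charZero_of_injective_ringHom (ψ.comp φ).injective
  have hinj : Function.Injective ((ψ.comp φ) ∘ z) := (ψ.comp φ).injective.comp hz
  have hzero : ∀ f ∈ ({p.eval (φ (z s)), q.eval (φ (z s))} : Set A), ψ f = 0 := fun f hf =>
    Ideal.Quotient.eq_zero_iff_mem.2 (hle (Ideal.subset_span hf))
  refine eval_ne_zero_or_of_fuchsOp_eq_zero (z := (ψ.comp φ) ∘ z) (h := ψ ∘ h) (m := m) (s := s)
    (eval_delProd_ne_zero hinj s) (hp.map ψ) (hq.map ψ) ?_ ?_ ?_ ⟨?_, ?_⟩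
  · rwa [hp.natDegree_map, hq.natDegree_map]
  · exact (map_fuchsOp ψ (φ ∘ z) h m p).symm.trans (by rw [hTp, Polynomial.map_zero])
  · exact (map_fuchsOp ψ (φ ∘ z) h m q).symm.trans (by rw [hTq, Polynomial.map_zero])
  · exact (eval_map_apply ψ _).trans (hzero _ (by simp))
  · exact (eval_map_apply ψ _).trans (hzero _ (by simp))

theorem span_remDet_eq_top {A : Type*} [CommRing A] (φ : ℝ →+* A) {z : ι → ℝ}
    (hz : Function.Injective z) {h : ι → A} {m : ι → ℕ} {l l' : ℕ} (hlt : l < l')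
    (hll : l + l' = ∑ s, m s + 1) (h₀ : ∑ s, h s = 0) (h₁ : ∑ s, h s * φ (z s) = l * l') :
    Ideal.span {g | ∃ j : ι → ℕ, ∑ s, j s = l ∧ g = remDet (φ ∘ z) h m l (rootProd (φ ∘ z) j)} =
      ⊤ := by
  by_contra hne
  obtain ⟨I, hI, hle⟩ := Ideal.exists_le_maximal _ hne
  let := Ideal.Quotient.field I
  let ψ := Ideal.Quotient.mk I
  have : CharZero (A ⧸ I) := charZero_of_injective_ringHom (ψ.comp φ).injective
  have hinj : Function.Injective ((ψ.comp φ) ∘ z) := (ψ.comp φ).injective.comp hz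
  obtain ⟨j, hj, hne⟩ := exists_remDet_rootProd_ne_zero ((ψ.comp φ) ∘ z) (ψ ∘ h) m hlt hll
    (by simpa using congrArg ψ h₀) (by simpa using congrArg ψ h₁)
    fun s => eval_delProd_ne_zero hinj s
  refine hne ?_
  have h2 := map_remDet ψ (φ ∘ z) h m l (monic_rootProd (φ ∘ z) j)
  rw [map_rootProd] at h2
  refine h2.symm.trans (Ideal.Quotient.eq_zero_iff_mem.2 (hle (Ideal.subset_span ⟨j, hj, rfl⟩)))

omit [Fintype ι] [DecidableEq ι] in
theorem eval_fuchs_node {A : Type*} [CommRing A] (φ : ℝ →+* A) (z : ι → ℝ) (f : ℝ[X]) (t : ι) :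
    (f.map φ).eval ((φ ∘ z) t) = φ (f.eval (z t)) := eval_map_apply φ _

/-- The multi-indices of weight `l` bounded by `m`. -/
abbrev BoundedIndex (m : ι → ℕ) (l : ℕ) : Type _ :=
  {j : ι → ℕ // (∀ s, j s ≤ m s) ∧ ∑ s, j s = l}

instance (m : ι → ℕ) (l : ℕ) : Finite (BoundedIndex m l) :=
  ((Set.finite_Iic m).subset fun _ hj => hj.1).to_subtype

theorem derivation_accessory_eq_zero {A : Type*} [CommRing A] [Algebra ℂ A] {z : ι → ℝ}
    (hz : Function.Injective z) {h : ι → A} {m : ι → ℕ} {l l' : ℕ} (hlt : l < l')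
    (hll : l + l' = ∑ s, m s + 1) (φ : ℝ →+* A) (hφ : ∀ x, φ x = algebraMap ℂ A x)
    (h₀ : ∑ s, h s = 0) (h₁ : ∑ s, h s * φ (z s) = l * l')
    {p q : A[X]} (hp : p.Monic) (hpl : p.natDegree = l) (hq : q.Monic) (hql : q.natDegree = l')
    (hTp : fuchsOp (φ ∘ z) h m p = 0) (hTq : fuchsOp (φ ∘ z) h m q = 0)
    {M : Type*} [AddCommGroup M] [Module A M] [Module ℂ M] (d : Derivation ℂ A M) (t : ι) :
    d (h t) = 0 := by
  rcases subsingleton_or_nontrivial A with hA | hA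
  · rw [Subsingleton.elim (h t) 0, map_zero]
  have := Fintype.ofFinite (BoundedIndex m l)
  have hδ := eval_delProd_ne_zero hz
  have hevδ : ∀ s, (delProd (φ ∘ z) s).eval ((φ ∘ z) s) = φ ((delProd z s).eval (z s)) := by
    intro s; rw [← map_delProd, eval_fuchs_node]
  let G : (ι → ℕ) → A := fun j => remDet (φ ∘ z) h m l (rootProd (φ ∘ z) j)
  have hG0 : ∀ j : ι → ℕ, ∑ s, j s = l → ¬ (∀ s, j s ≤ m s) → G j = 0 := by
    intro j hj hjm
    push Not at hjm
    obtain ⟨s, hs⟩ := hjm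
    exact remDet_rootProd_eq_zero _ h m hTp hTq
      (isCoprime_eval_of_fuchsOp_eq_zero φ hz hp hq (by omega) hTp hTq s) hj hs
  have hspan : Ideal.span (Set.range fun j : BoundedIndex m l => G j) = ⊤ := by
    rw [← top_le_iff, ← span_remDet_eq_top φ hz hlt hll h₀ h₁, Ideal.span_le]
    rintro _ ⟨j, hj, rfl⟩
    by_cases hjm : ∀ s, j s ≤ m s
    · exact Ideal.subset_span ⟨⟨j, hjm, hj⟩, rfl⟩
    · rw [SetLike.mem_coe]
      change G j ∈ _
      rw [hG0 j hj hjm]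
      exact Ideal.zero_mem _
  refine derivation_eq_zero_of_symmetrizable
    (A := Matrix.of fun j j' : BoundedIndex m l => accessoryMatrix z m t j j')
    (ω := fun j => rootWeight (fun s => (delProd z s).eval (z s)) m j)
    (fun j => rootWeight_pos hδ m j)
    (fun j j' => rootWeight_mul_accessoryMatrix hδ m t j.2.1 j'.2.1) d hspan fun j => ?_
  obtain ⟨j, hjm, hj⟩ := j
  have hsel : ∀ (r s : ι) (c : ℝ), r ≠ s → (j r = 0 → c = 0) →
      ∑ k : BoundedIndex m l, φ (if j + Pi.single s 1 = k.1 + Pi.single r 1 then c else 0) * G k =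
        φ c * G (j - Pi.single r 1 + Pi.single s 1) := by
    intro r s c hrs hc
    by_cases hjr : j r = 0
    · simp [hc hjr]
    have hk : ∀ k : ι → ℕ, j + Pi.single s 1 = k + Pi.single r 1 ↔
        k = j - Pi.single r 1 + Pi.single s 1 := by
      intro k
      conv_lhs => rw [← sub_single_add_single hjr, add_right_comm]
      rw [add_left_inj, eq_comm]
    simp only [hk]
    set k := j - Pi.single r 1 + Pi.single s 1 with hkdef
    have hkl : ∑ s, k s = l := by
      rw [hkdef, sum_add_single, ← sum_add_single _ r, sub_single_add_single hjr, hj]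
    by_cases hkm : ∀ s, k s ≤ m s
    · rw [Finset.sum_eq_single ⟨k, hkm, hkl⟩]
      · simp
      · intro b _ hb
        rw [if_neg fun h => hb (Subtype.ext h), map_zero, zero_mul]
      · simp
    · rw [hG0 k hkl hkm, mul_zero]
      refine Finset.sum_eq_zero fun b _ => ?_
      rw [if_neg fun h => hkm (by rw [← h]; exact b.2.1), map_zero, zero_mul]
  have hdiag : ∀ c : ℝ, ∑ k : BoundedIndex m l, φ (if j = k.1 then c else 0) * G k =
      φ c * G j := by
    intro c
    rw [Finset.sum_eq_single ⟨j, hjm, hj⟩]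
    · simp
    · intro b _ hb
      rw [if_neg fun h => hb (Subtype.ext h.symm), map_zero, zero_mul]
    · simp
  have key := congrArg (eval ((φ ∘ z) t)) (delComb_mul_remDet (φ ∘ z) h m
    (δ' := fun s => φ ((delProd z s).eval (z s))⁻¹)
    (fun s => by rw [hevδ, ← map_mul, inv_mul_cancel₀ (hδ s), map_one]) hp hpl hTp hj)
  rw [eval_mul, eval_C, eval_delComb, hevδ] at key
  simp only [eval_finsetSum, eval_mul, eval_C, ← map_delProd₂, eval_fuchs_node] at key
  have hunit : φ ((delProd z t).eval (z t))⁻¹ * φ ((delProd z t).eval (z t)) = 1 := by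
    rw [← map_mul, inv_mul_cancel₀ (hδ t), map_one]
  have hL : h t * G j = φ ((delProd z t).eval (z t))⁻¹ *
      (G j * (h t * φ ((delProd z t).eval (z t)))) := by
    linear_combination -(h t * G j) * hunit
  change h t * G j = ∑ k : BoundedIndex m l, algebraMap ℂ A (accessoryMatrix z m t j k : ℂ) * G k
  rw [hL, key]
  simp only [← hφ, accessoryMatrix, map_mul, map_sum, map_add, mul_assoc, ← Finset.mul_sum]
  congr 1
  simp only [Finset.sum_mul]
  rw [Finset.sum_comm]
  refine Finset.sum_congr rfl fun r _ => ?_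
  rw [Finset.sum_comm]
  refine Finset.sum_congr rfl fun s hs => ?_
  have hrs : r ≠ s := (Finset.ne_of_mem_erase hs).symm
  simp only [mul_assoc, ← Finset.mul_sum, add_mul, Finset.sum_add_distrib]
  rw [hdiag, hsel r s _ hrs (fun h0 => by simp [h0])]
  simp only [hevδ, map_mul, map_sub, map_natCast, map_one]
  simp only [G]
  ring

end AccessoryParameters

section Generation

open Polynomial

variable {ι : Type*} [Fintype ι] [DecidableEq ι]

theorem coeff_mem_of_fuchsOp_eq_zero_of_lt {A : Type*} [CommRing A] [Algebra ℂ A] [Nontrivial A]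
    (S : Subalgebra ℂ A) {z h : ι → A} (hz : ∀ s, z s ∈ S) (hh : ∀ s, h s ∈ S) {m : ι → ℕ}
    {l l' : ℕ} (hll : l + l' = ∑ s, m s + 1) (h₀ : ∑ s, h s = 0)
    (h₁ : ∑ s, h s * z s = l * l') {f : A[X]} (hf : fuchsOp z h m f = 0) {k : ℕ}
    (hk : ∀ j, k < j → f.coeff j ∈ S) (hkl : k ≠ l) (hkl' : k ≠ l') : f.coeff k ∈ S := by
  set v : A[X] := ∑ i ∈ Finset.range (k + 1), monomial i (f.coeff i) with hv
  have hvc : ∀ j, v.coeff j = if j < k + 1 then f.coeff j else 0 := by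
    intro j
    simp [hv, finsetSum_coeff, coeff_monomial]
  have hvd : v.natDegree ≤ k := by
    rw [natDegree_le_iff_coeff_eq_zero]
    intro j hj
    rw [hvc, if_neg (by omega)]
  have hu : f - v ∈ lifts S.val.toRingHom := by
    rw [lifts_iff_coeff_lifts]
    intro j
    rw [coeff_sub, hvc]
    split_ifs with hj
    · exact ⟨0, by simp⟩
    · exact ⟨⟨_, hk j (by omega)⟩, by simp⟩
  obtain ⟨u, hu⟩ := (mem_lifts _).1 hu
  have hTv : fuchsOp z h m v =
      -(fuchsOp (fun s => (⟨z s, hz s⟩ : S)) (fun s => ⟨h s, hh s⟩) m u).map S.val.toRingHom := by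
    rw [map_fuchsOp, hu]
    change _ = -fuchsOp z h m (f - v)
    rw [map_sub, hf]
    simp
  have hc := coeff_X_sq_mul_fuchsOp z h m l l' hll h₀ h₁ hvd
  rw [hvc, if_pos (by omega), hTv, mul_neg, coeff_neg] at hc
  have hmem : ((k : A) - l) * ((k : A) - l') * f.coeff k ∈ S := by
    rw [← hc, show (X : A[X]) ^ 2 = (X ^ 2 : S[X]).map S.val.toRingHom by simp, ← Polynomial.map_mul,
      coeff_map]
    exact S.neg_mem (Subtype.prop _)
  have hne : ((k : ℂ) - l) * ((k : ℂ) - l') ≠ 0 :=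
    mul_ne_zero (sub_ne_zero.2 (by exact_mod_cast hkl)) (sub_ne_zero.2 (by exact_mod_cast hkl'))
  have hsm : f.coeff k = (((k : ℂ) - l) * ((k : ℂ) - l'))⁻¹ •
      (((k : A) - l) * ((k : A) - l') * f.coeff k) := by
    have : ((k : A) - l) * ((k : A) - l') = algebraMap ℂ A (((k : ℂ) - l) * ((k : ℂ) - l')) := by
      simp
    rw [this, ← Algebra.smul_def, smul_smul, inv_mul_cancel₀ hne, one_smul]
  rw [hsm]
  exact S.smul_mem hmem _

theorem coeff_mem_of_fuchsOp_eq_zero {A : Type*} [CommRing A] [Algebra ℂ A] [Nontrivial A]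
    (S : Subalgebra ℂ A) {z h : ι → A} (hz : ∀ s, z s ∈ S) (hh : ∀ s, h s ∈ S) {m : ι → ℕ}
    {l l' : ℕ} (hll : l + l' = ∑ s, m s + 1) (h₀ : ∑ s, h s = 0)
    (h₁ : ∑ s, h s * z s = l * l') {f : A[X]} (hf : fuchsOp z h m f = 0)
    (hfl : f.coeff l ∈ S) (hfl' : f.coeff l' ∈ S) (k : ℕ) : f.coeff k ∈ S := by
  have key : ∀ N k, f.natDegree < k + N → f.coeff k ∈ S := by
    intro N
    induction N with
    | zero =>
      intro k hk
      rw [coeff_eq_zero_of_natDegree_lt (by omega)]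
      exact S.zero_mem
    | succ N ih =>
      intro k hk
      by_cases hkl : k = l
      · rwa [hkl]
      by_cases hkl' : k = l'
      · rwa [hkl']
      exact coeff_mem_of_fuchsOp_eq_zero_of_lt S hz hh hll h₀ h₁ hf
        (fun j hj => ih j (by omega)) hkl hkl'
  exact key (f.natDegree + 1) k (by omega)

/-- An algebra of finite type over `ℂ` generated by elements killed by every derivation is
reduced. -/
theorem isReduced_of_adjoin_eq_top {A : Type*} [CommRing A] [Algebra ℂ A] [Algebra.FiniteType ℂ A]
    {s : Set A} (hs : Algebra.adjoin ℂ s = ⊤)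
    (hD : ∀ a ∈ s, KaehlerDifferential.D ℂ A a = 0) : IsReduced A := by
  have hD0 : ∀ a, KaehlerDifferential.D ℂ A a = 0 := fun a =>
    Derivation.eqOn_adjoin (D1 := KaehlerDifferential.D ℂ A) (D2 := 0) (fun a ha => hD a ha)
      (hs ▸ Algebra.mem_top : a ∈ Algebra.adjoin ℂ s)
  have : Algebra.FormallyUnramified ℂ A := by
    constructor
    rw [← Submodule.subsingleton_iff A, ← subsingleton_iff_bot_eq_top,
      ← KaehlerDifferential.span_range_derivation, eq_comm, Submodule.span_eq_bot]
    rintro _ ⟨a, rfl⟩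
    exact hD0 a
  exact Algebra.FormallyUnramified.isReduced_of_field ℂ A

end Generation

section SchubertAlgebra

open Polynomial

variable {n : ℕ} (m : Fin n → ℕ) (l : ℕ) (z : Fin n → ℝ)

theorem topP_eq_fuchsOp (f : (MvPolynomial (VarsP m l) ℂ)[X]) :
    TopP m l z f = fuchsOp (fun s => MvPolynomial.C (z s : ℂ))
      (fun s => MvPolynomial.X (Sum.inr (Sum.inr s))) m f := by
  simp [fuchsOp_apply, TopP, fullProd, delComb, delProd]

theorem degree_pP_tail_lt :
    (∑ i : Fin l, C (MvPolynomial.X (R := ℂ) (Sum.inl i : VarsP m l)) *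
      X ^ (l - 1 - (i : ℕ))).degree < (l : WithBot ℕ) := by
  refine (degree_sum_le _ _).trans_lt ((Finset.sup_lt_iff (WithBot.bot_lt_coe l)).2 fun i _ => ?_)
  refine (degree_C_mul_X_pow_le _ _).trans_lt ?_
  have := i.2
  exact WithBot.coe_lt_coe.2 (by simp only [Nat.cast_id]; omega)

theorem degree_ptP_tail_lt :
    (∑ k : {k : Fin (ltilde m l) // (k : ℕ) ≠ l},
      C (MvPolynomial.X (R := ℂ) (Sum.inr (Sum.inl k) : VarsP m l)) *
        X ^ ((k : Fin (ltilde m l)) : ℕ)).degree < (ltilde m l : WithBot ℕ) := by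
  refine (degree_sum_le _ _).trans_lt
    ((Finset.sup_lt_iff (WithBot.bot_lt_coe (ltilde m l))).2 fun k _ => ?_)
  refine (degree_C_mul_X_pow_le _ _).trans_lt ?_
  exact WithBot.coe_lt_coe.2 k.1.2

theorem monic_pP : (pP m l).Monic := monic_X_pow_add (degree_pP_tail_lt m l)

theorem monic_ptP : (ptP m l).Monic := monic_X_pow_add (degree_ptP_tail_lt m l)

theorem natDegree_pP : (pP m l).natDegree = l := by
  rw [pP, natDegree_add_eq_left_of_degree_lt, natDegree_X_pow]
  rw [degree_X_pow]
  exact degree_pP_tail_lt m l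

theorem natDegree_ptP : (ptP m l).natDegree = ltilde m l := by
  rw [ptP, natDegree_add_eq_left_of_degree_lt, natDegree_X_pow]
  rw [degree_X_pow]
  exact degree_ptP_tail_lt m l

theorem coeff_pP (i : Fin l) : (pP m l).coeff (l - 1 - i) = MvPolynomial.X (Sum.inl i) := by
  have hi := i.2
  rw [pP, coeff_add, coeff_X_pow, if_neg (by omega), zero_add, finsetSum_coeff,
    Finset.sum_eq_single i]
  · simp
  · intro j _ hj
    have hj' : (j : ℕ) ≠ i := fun h => hj (Fin.ext h)
    have := j.2
    rw [coeff_C_mul_X_pow, if_neg (by omega)]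
  · simp

theorem coeff_ptP (k : {k : Fin (ltilde m l) // (k : ℕ) ≠ l}) :
    (ptP m l).coeff (k : Fin (ltilde m l)) = MvPolynomial.X (Sum.inr (Sum.inl k)) := by
  have hk := k.1.2
  rw [ptP, coeff_add, coeff_X_pow, if_neg (by omega), zero_add, finsetSum_coeff,
    Finset.sum_eq_single k]
  · simp
  · intro j _ hj
    have hj' : ((j : Fin (ltilde m l)) : ℕ) ≠ (k : Fin (ltilde m l)) :=
      fun h => hj (Subtype.ext (Fin.ext h))
    rw [coeff_C_mul_X_pow, if_neg (Ne.symm hj')]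
  · simp

theorem coeff_ptP_self (hl : l < ltilde m l) : (ptP m l).coeff l = 0 := by
  rw [ptP, coeff_add, coeff_X_pow, if_neg hl.ne, zero_add, finsetSum_coeff]
  exact Finset.sum_eq_zero fun k _ => by rw [coeff_C_mul_X_pow, if_neg (Ne.symm k.2)]

theorem map_mk_fuchsOp_eq_zero {f : (MvPolynomial (VarsP m l) ℂ)[X]}
    (hf : ∀ k, (TopP m l z f).coeff k ∈ idealP m l z) :
    fuchsOp (((algebraMap ℂ (MvPolynomial (VarsP m l) ℂ ⧸ idealP m l z)).comp
        Complex.ofRealHom) ∘ z)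
      (fun s => Ideal.Quotient.mk (idealP m l z) (MvPolynomial.X (Sum.inr (Sum.inr s)))) m
      (f.map (Ideal.Quotient.mk (idealP m l z))) = 0 := by
  have h := map_fuchsOp (Ideal.Quotient.mk (idealP m l z)) (fun s => MvPolynomial.C (z s : ℂ))
      (fun s => MvPolynomial.X (Sum.inr (Sum.inr s))) m f
  rw [← topP_eq_fuchsOp] at h
  refine h.symm.trans ?_
  ext k
  rw [coeff_map, coeff_zero]
  exact Ideal.Quotient.eq_zero_iff_mem.2 (hf k)

end SchubertAlgebra

theorem statement_19 {n : ℕ} (hn : 1 ≤ n) (m : Fin n → ℕ) (l : ℕ)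
    (hl : 2 * l ≤ ∑ s, m s) (z : Fin n → ℝ) (hz : Function.Injective z) :
    IsReduced (MvPolynomial (VarsP m l) ℂ ⧸ idealP m l z) := by
  set A := MvPolynomial (VarsP m l) ℂ ⧸ idealP m l z
  set mk : MvPolynomial (VarsP m l) ℂ →+* A := Ideal.Quotient.mk (idealP m l z) with hmk
  rcases subsingleton_or_nontrivial A with hA | hA
  · exact ⟨fun x _ => Subsingleton.elim x 0⟩
  let φ : ℝ →+* A := (algebraMap ℂ A).comp Complex.ofRealHom
  let h : Fin n → A := fun s => mk (MvPolynomial.X (Sum.inr (Sum.inr s)))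
  have hlt : l < ltilde m l := by rw [ltilde]; omega
  have hll : l + ltilde m l = ∑ s, m s + 1 := by rw [ltilde]; omega
  have hcast : ((∑ s, (m s : ℂ)) + 1 - l) = (ltilde m l : ℂ) := by
    rw [sub_eq_iff_eq_add, add_comm (ltilde m l : ℂ)]
    exact_mod_cast hll.symm
  have hmem : ∀ x ∈ idealP m l z, mk x = 0 := fun x => Ideal.Quotient.eq_zero_iff_mem.2
  have h₀ : ∑ s, h s = 0 := by
    rw [← map_sum]
    exact hmem _ (Ideal.subset_span (by simp))
  have h₁ : ∑ s, h s * (φ ∘ z) s = l * (ltilde m l : ℕ) := by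
    have hx := hmem _ (Ideal.subset_span (Or.inl (Or.inl (Or.inr rfl))))
    rw [hcast, map_sub, sub_eq_zero, map_sum] at hx
    have hC : ∀ c : ℂ, mk (MvPolynomial.C c) = algebraMap ℂ A c := fun _ => rfl
    simp only [map_mul, hC, map_natCast] at hx
    rw [← hx]
    exact Finset.sum_congr rfl fun s _ => mul_comm _ _
  have hTp : fuchsOp (φ ∘ z) h m ((pP m l).map mk) = 0 :=
    map_mk_fuchsOp_eq_zero m l z fun k => Ideal.subset_span (Or.inl (Or.inr ⟨k, rfl⟩))
  have hTq : fuchsOp (φ ∘ z) h m ((ptP m l).map mk) = 0 :=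
    map_mk_fuchsOp_eq_zero m l z fun k => Ideal.subset_span (Or.inr ⟨k, rfl⟩)
  have hpm := (monic_pP m l).map mk
  have hqm := (monic_ptP m l).map mk
  have hpd : ((pP m l).map mk).natDegree = l := by rw [(monic_pP m l).natDegree_map, natDegree_pP]
  have hqd : ((ptP m l).map mk).natDegree = ltilde m l := by
    rw [(monic_ptP m l).natDegree_map, natDegree_ptP]
  have hpc := hpm.coeff_natDegree
  rw [hpd] at hpc
  have hqc := hqm.coeff_natDegree
  rw [hqd] at hqc
  refine isReduced_of_adjoin_eq_top (s := Set.range h) ?_ ?_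
  · let S := Algebra.adjoin ℂ (Set.range h)
    have hh : ∀ s, h s ∈ S := fun s => Algebra.subset_adjoin ⟨s, rfl⟩
    have hzS : ∀ s, (φ ∘ z) s ∈ S := fun s => S.algebraMap_mem _
    have hpS := coeff_mem_of_fuchsOp_eq_zero S hzS hh hll h₀ h₁ hTp
      (by rw [hpc]; exact S.one_mem)
      (by rw [Polynomial.coeff_eq_zero_of_natDegree_lt (hpd.trans_lt hlt)]; exact S.zero_mem)
    have hqS := coeff_mem_of_fuchsOp_eq_zero S hzS hh hll h₀ h₁ hTq
      (by rw [Polynomial.coeff_map, coeff_ptP_self m l hlt, map_zero]; exact S.zero_mem)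
      (by rw [hqc]; exact S.one_mem)
    rw [eq_top_iff]
    intro a _
    obtain ⟨x, rfl⟩ := Ideal.Quotient.mk_surjective a
    induction x using MvPolynomial.induction_on with
    | C c => exact S.algebraMap_mem c
    | add x y hx hy => rw [map_add]; exact S.add_mem (hx trivial) (hy trivial)
    | mul_X x i hx =>
      rw [map_mul]
      refine S.mul_mem (hx trivial) ?_
      rcases i with i | k | s
      · rw [← coeff_pP, ← Polynomial.coeff_map]
        exact hpS _
      · rw [← coeff_ptP, ← Polynomial.coeff_map]
        exact hqS _
      · exact hh s
  · rintro _ ⟨s, rfl⟩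
    exact derivation_accessory_eq_zero hz hlt hll φ (fun _ => rfl) h₀ h₁ hpm hpd hqm hqd hTp hTq _ s

end
end
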